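/- arXiv:1909.09043 — 3 statements merged into one kernel-verified Lean document; each statement's English description precedes it below -/
import Mathlib

section
/- Let P ⊆ ℝ² be the region of a simple n-gon with vertex cycle v 0, …, v (n-1), and let G be a set of vertices of the polygon such that no two consecutive vertices are both outside G (guards placed at every second vertex). If X is a point outside P that is not observed by any guard in G, then X is not visible from any point outside the convex hull of the vertices; that is, for every point Q ∉ convexHull {v 0, …, v (n-1)}, the closed segment [X, Q] meets the interior of P. -/
/-- A simple `n`-gon in the plane: `n ≥ 3` distinct vertices `v 0, …, v (n-1)`
(indices mod `n`, so indexed by `ZMod n`), whose consecutive edges meet exactly in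
their shared endpoint and whose non-consecutive edges are disjoint, together with a
compact region `P` equal to the closure of its interior whose topological frontier
is the union of the edges. -/
def IsSimplePolygon (n : ℕ) (v : ZMod n → ℝ × ℝ) (P : Set (ℝ × ℝ)) : Prop :=
  3 ≤ n ∧
  Function.Injective v ∧
  (∀ i : ZMod n,
    segment ℝ (v i) (v (i + 1)) ∩ segment ℝ (v (i + 1)) (v (i + 2)) = {v (i + 1)}) ∧
  (∀ i j : ZMod n, j ≠ i → j ≠ i + 1 → i ≠ j + 1 →
    segment ℝ (v i) (v (i + 1)) ∩ segment ℝ (v j) (v (j + 1)) = ∅) ∧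
  IsCompact P ∧
  P = closure (interior P) ∧
  frontier P = ⋃ i : ZMod n, segment ℝ (v i) (v (i + 1))

/-- The signed area of the parallelogram spanned by two plane vectors. -/
def planeCross (a b : ℝ × ℝ) : ℝ := a.1 * b.2 - a.2 * b.1

/-- The point `p` is visible from the origin, with the interior of `P` as obstacle. -/
def OriginSees (P : Set (ℝ × ℝ)) (p : ℝ × ℝ) : Prop :=
  ∀ s ∈ Set.Icc (0 : ℝ) 1, s • p ∉ interior P

/-- A compact plane region bounded by finitely many segments, the edges, which meet only in their
endpoints. The relation `E a b` says that `a` and `b` are the endpoints of an edge. -/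
structure IsSegmentBounded (E : ℝ × ℝ → ℝ × ℝ → Prop) (P : Set (ℝ × ℝ)) : Prop where
  symm : ∀ {a b}, E a b → E b a
  finite : {a | ∃ b, E a b}.Finite
  eq_of_mem : ∀ {a b c d z}, E a b → E c d → z ∈ segment ℝ a b → z ∈ segment ℝ c d →
    (∀ e, ¬ E z e) → (a = c ∧ b = d) ∨ (a = d ∧ b = c)
  not_vertex : ∀ {a b z}, E a b → z ∈ openSegment ℝ a b → ∀ e, ¬ E z e
  frontier_eq : frontier P = {z | ∃ a b, E a b ∧ z ∈ segment ℝ a b}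
  compact : IsCompact P
  closure_interior : P = closure (interior P)
  interior_nonempty : (interior P).Nonempty

theorem exists_pos_add_smul_mem {U : Set (ℝ × ℝ)} (hU : IsOpen U) {z : ℝ × ℝ} (hz : z ∈ U)
    (u : ℝ × ℝ) : ∃ ε > 0, z + (ε : ℝ) • u ∈ U := by
  have hc : Filter.Tendsto (fun ε : ℝ => z + ε • u) (nhds 0) (nhds z) := by
    have : Continuous (fun ε : ℝ => z + ε • u) := by fun_prop
    simpa using this.tendsto 0
  have h : ∀ᶠ ε in nhdsWithin (0 : ℝ) (Set.Ioi 0), z + ε • u ∈ U :=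
    (hc.eventually (hU.mem_nhds hz)).filter_mono nhdsWithin_le_nhds
  obtain ⟨ε, h1, h2⟩ := (h.and self_mem_nhdsWithin).exists
  exact ⟨ε, h2, h1⟩

theorem IsPreconnected.subset_interior_of_disjoint_frontier {α : Type*} [TopologicalSpace α]
    {s t : Set α} (ht : IsPreconnected t) (hts : Disjoint t (frontier s))
    (hne : (t ∩ interior s).Nonempty) : t ⊆ interior s := by
  refine ht.subset_left_of_subset_union isOpen_interior isClosed_closure.isOpen_compl
    (Set.disjoint_compl_right_iff_subset.2 interior_subset_closure) (fun x hx => ?_) hne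
  by_contra hxu
  rw [Set.mem_union, not_or, Set.mem_compl_iff, not_not] at hxu
  exact Set.disjoint_left.1 hts hx ⟨hxu.2, hxu.1⟩

theorem isClosed_originSees (P : Set (ℝ × ℝ)) : IsClosed {p | OriginSees P p} := by
  have : {p | OriginSees P p} = ⋂ s ∈ Set.Icc (0 : ℝ) 1, {p | s • p ∉ interior P} := by
    ext p; simp [OriginSees]
  rw [this]
  refine isClosed_biInter fun s _ => ?_
  have : IsOpen ((fun p : ℝ × ℝ => s • p) ⁻¹' interior P) :=
    isOpen_interior.preimage (by fun_prop)
  exact this.isClosed_compl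

theorem OriginSees.smul {P : Set (ℝ × ℝ)} {p : ℝ × ℝ} (h : OriginSees P p) {r : ℝ} (h0 : 0 ≤ r)
    (h1 : r ≤ 1) : OriginSees P (r • p) := by
  intro s hs
  rw [smul_smul]
  exact h _ ⟨mul_nonneg hs.1 h0, mul_le_one₀ hs.2 h0 h1⟩

theorem planeCross_eq_zero_of_mem_segment {a b z : ℝ × ℝ} (hz : z ∈ segment ℝ a b) :
    planeCross (b - a) (z - a) = 0 := by
  obtain ⟨s, t, hs, ht, hst, rfl⟩ := hz
  obtain rfl : s = 1 - t := by linarith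
  simp [planeCross]; ring

/-- The affine coordinate system with origin `X` and basis `p`, `q`. -/
noncomputable def planeFrame (X p q : ℝ × ℝ) (h : planeCross p q ≠ 0) : ℝ × ℝ ≃ₜ ℝ × ℝ where
  toFun z := X + z.1 • p + z.2 • q
  invFun w := (planeCross (w - X) q / planeCross p q, planeCross p (w - X) / planeCross p q)
  left_inv z := by
    ext
    · dsimp only
      rw [div_eq_iff h]; simp [planeCross]; ring
    · dsimp only
      rw [div_eq_iff h]; simp [planeCross]; ring
  right_inv w := by
    have key : ∀ x : ℝ × ℝ, (planeCross x q / planeCross p q) • p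
        + (planeCross p x / planeCross p q) • q = x := by
      intro x
      ext
      · simp only [Prod.fst_add, Prod.smul_fst, smul_eq_mul]
        field_simp
        simp [planeCross]; ring
      · simp only [Prod.snd_add, Prod.smul_snd, smul_eq_mul]
        field_simp
        simp [planeCross]; ring
    dsimp only
    rw [add_assoc, key]
    simp
  continuous_toFun := by fun_prop
  continuous_invFun := by
    unfold planeCross
    fun_prop

theorem planeFrame_affine (X p q : ℝ × ℝ) (h : planeCross p q ≠ 0) (z w : ℝ × ℝ) (s t : ℝ)
    (hst : s + t = 1) :
    planeFrame X p q h (s • z + t • w) = s • planeFrame X p q h z + t • planeFrame X p q h w := by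
  obtain rfl : s = 1 - t := by linarith
  ext <;> simp [planeFrame] <;> ring

theorem map_mem_segment (g : ℝ × ℝ → ℝ × ℝ)
    (hg : ∀ (z w : ℝ × ℝ) (s t : ℝ), s + t = 1 → g (s • z + t • w) = s • g z + t • g w)
    {a b z : ℝ × ℝ} (hz : z ∈ segment ℝ a b) : g z ∈ segment ℝ (g a) (g b) := by
  obtain ⟨s, t, hs, ht, hst, rfl⟩ := hz
  exact ⟨s, t, hs, ht, hst, (hg a b s t hst).symm⟩

/-- A function of the direction of a nonzero vector which increases counterclockwise, starting
at the positive `x`-axis. -/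
noncomputable def diamondAngle (z : ℝ × ℝ) : ℝ :=
  if 0 ≤ z.2 then -z.1 / (|z.1| + |z.2|) else 2 + z.1 / (|z.1| + |z.2|)

theorem diamondAngle_lt {a d : ℝ × ℝ} (had : 0 < planeCross a d) (h : a.2 < 0 → d.2 < 0) :
    diamondAngle a < diamondAngle d := by
  have hpos : ∀ z : ℝ × ℝ, z ≠ 0 → 0 < |z.1| + |z.2| := by
    intro z hz
    by_contra! hle
    have h1 := abs_nonneg z.1
    have h2 := abs_nonneg z.2
    exact hz (Prod.ext (abs_eq_zero.1 (by linarith)) (abs_eq_zero.1 (by linarith)))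
  have ha := hpos a (by rintro rfl; simp [planeCross] at had)
  have hd := hpos d (by rintro rfl; simp [planeCross] at had)
  unfold planeCross at had
  unfold diamondAngle
  by_cases h1 : 0 ≤ a.2
  · by_cases h2 : 0 ≤ d.2
    · rw [if_pos h1, if_pos h2, div_lt_div_iff₀ ha hd, abs_of_nonneg h1, abs_of_nonneg h2]
      rcases abs_cases a.1 with ⟨e1, _⟩ | ⟨e1, _⟩ <;>
        rcases abs_cases d.1 with ⟨e2, _⟩ | ⟨e2, _⟩ <;> rw [e1, e2] <;> nlinarith
    · rw [if_pos h1, if_neg h2]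
      push Not at h2
      have e1 : -a.1 / (|a.1| + |a.2|) ≤ 1 := by
        rw [div_le_one ha]
        linarith [neg_abs_le a.1, abs_nonneg a.2]
      have e2 : -1 < d.1 / (|d.1| + |d.2|) := by
        rw [lt_div_iff₀ hd]
        linarith [neg_abs_le d.1, abs_pos.2 h2.ne]
      linarith
  · have h2 := h (not_le.1 h1)
    push Not at h1
    rw [if_neg h1.not_ge, if_neg h2.not_ge, add_lt_add_iff_left, div_lt_div_iff₀ ha hd,
      abs_of_neg h1, abs_of_neg h2]
    rcases abs_cases a.1 with ⟨e1, _⟩ | ⟨e1, _⟩ <;>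
      rcases abs_cases d.1 with ⟨e2, _⟩ | ⟨e2, _⟩ <;> rw [e1, e2] <;> nlinarith

namespace IsSegmentBounded

variable {E : ℝ × ℝ → ℝ × ℝ → Prop} {P : Set (ℝ × ℝ)}

/-- Near a relative interior point of an edge whose line misses the origin, one side of the ray
through that point lies in the interior of the region. -/
theorem eventually_smul_mem_interior (h : IsSegmentBounded E P) {a b p : ℝ × ℝ} (hE : E a b)
    (hp : p ∈ openSegment ℝ a b) (hab : planeCross a b ≠ 0) :
    (∀ᶠ s in nhdsWithin (1 : ℝ) (Set.Ioi 1), s • p ∈ interior P) ∨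
      (∀ᶠ s in nhdsWithin (1 : ℝ) (Set.Iio 1), s • p ∈ interior P) := by
  have hpv := h.not_vertex hE hp
  have hps := openSegment_subset_segment ℝ a b hp
  have hpL := planeCross_eq_zero_of_mem_segment hps
  set T : Set ((ℝ × ℝ) × (ℝ × ℝ)) :=
    {e | E e.1 e.2 ∧ ¬ ((a = e.1 ∧ b = e.2) ∨ (a = e.2 ∧ b = e.1))} with hT
  have hTf : T.Finite := by
    refine (h.finite.prod h.finite).subset ?_
    rintro ⟨c, d⟩ ⟨he, -⟩
    exact ⟨⟨d, he⟩, ⟨c, h.symm he⟩⟩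
  have hKc : IsClosed (⋃ e ∈ T, segment ℝ e.1 e.2) :=
    hTf.isClosed_biUnion fun e _ => by
      rw [← convexHull_pair]
      exact ((Set.toFinite _).isCompact_convexHull ℝ).isClosed
  have hpK : p ∈ (⋃ e ∈ T, segment ℝ e.1 e.2)ᶜ := by
    simp only [Set.mem_compl_iff, Set.mem_iUnion, not_exists]
    rintro e ⟨he, hne⟩ hpe
    exact hne (h.eq_of_mem hE he hps hpe hpv)
  obtain ⟨r, hr, hball⟩ := Metric.isOpen_iff.1 hKc.isOpen_compl p hpK
  have hedge : ∀ z ∈ Metric.ball p r, z ∈ frontier P → planeCross (b - a) (z - a) = 0 := by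
    intro z hz hzf
    rw [h.frontier_eq] at hzf
    obtain ⟨c, d, hcd, hzs⟩ := hzf
    have hzK := hball hz
    by_cases hcd' : (a = c ∧ b = d) ∨ (a = d ∧ b = c)
    · rcases hcd' with ⟨rfl, rfl⟩ | ⟨rfl, rfl⟩
      · exact planeCross_eq_zero_of_mem_segment hzs
      · exact planeCross_eq_zero_of_mem_segment (segment_symm ℝ b a ▸ hzs)
    · exact absurd (Set.mem_biUnion (show (c, d) ∈ T from ⟨hcd, hcd'⟩) hzs) hzK
  have hκ : planeCross (b - a) p = - planeCross a b := by
    simp only [planeCross, Prod.fst_sub, Prod.snd_sub] at hpL ⊢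
    linarith
  have hpP : p ∈ closure (interior P) := by
    rw [← h.closure_interior, ← h.compact.isClosed.closure_eq]
    apply frontier_subset_closure
    rw [h.frontier_eq]
    exact ⟨a, b, hE, hps⟩
  obtain ⟨z, ⟨hzb, hzi⟩, hzL⟩ : ∃ z ∈ Metric.ball p r ∩ interior P,
      planeCross (b - a) (z - a) ≠ 0 := by
    obtain ⟨z, hz⟩ := mem_closure_iff.1 hpP _ Metric.isOpen_ball (Metric.mem_ball_self hr)
    by_cases hzL : planeCross (b - a) (z - a) = 0
    · obtain ⟨ε, hε, hzε⟩ :=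
        exists_pos_add_smul_mem (Metric.isOpen_ball.inter isOpen_interior) hz p
      refine ⟨_, hzε, ?_⟩
      have : planeCross (b - a) (z + ε • p - a) = ε * planeCross (b - a) p := by
        simp only [planeCross, Prod.fst_sub, Prod.snd_sub, Prod.fst_add, Prod.snd_add,
          Prod.smul_fst, Prod.smul_snd, smul_eq_mul] at hzL ⊢
        linear_combination hzL
      rw [this, hκ]
      exact mul_ne_zero hε.ne' (neg_ne_zero.2 hab)
    · exact ⟨z, hz, hzL⟩
  set τ := planeCross (b - a) (z - a) with hτ
  set U : Set (ℝ × ℝ) := {w | w ∈ Metric.ball p r ∧ 0 < τ * planeCross (b - a) (w - a)} with hUdef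
  have hUc : Convex ℝ U := by
    intro x hx y hy s t hs ht hst
    refine ⟨convex_ball p r hx.1 hy.1 hs ht hst, ?_⟩
    have e : planeCross (b - a) (s • x + t • y - a)
        = s * planeCross (b - a) (x - a) + t * planeCross (b - a) (y - a) := by
      obtain rfl : s = 1 - t := by linarith
      simp [planeCross]; ring
    have hx2 := hx.2
    have hy2 := hy.2
    rw [e]
    rcases hs.eq_or_lt with rfl | hs
    · obtain rfl : t = 1 := by linarith
      simpa using hy2
    · nlinarith [mul_pos hs hx2, mul_nonneg ht hy2.le]
  have hUf : Disjoint U (frontier P) := by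
    rw [Set.disjoint_left]
    intro w hw hwf
    have := hw.2
    rw [hedge w hw.1 hwf] at this
    simp at this
  have hzU : z ∈ U := ⟨hzb, mul_self_pos.2 hzL⟩
  have hUP : U ⊆ interior P :=
    hUc.isPreconnected.subset_interior_of_disjoint_frontier hUf ⟨z, hzU, hzi⟩
  have hnear : ∀ᶠ s in nhds (1 : ℝ), s • p ∈ Metric.ball p r := by
    have hc : Continuous (fun s : ℝ => s • p) := by fun_prop
    have := hc.tendsto 1
    rw [one_smul] at this
    exact this.eventually (Metric.ball_mem_nhds p hr)
  have hval : ∀ s : ℝ, planeCross (b - a) (s • p - a) = (s - 1) * planeCross (b - a) p := by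
    intro s
    simp only [planeCross, Prod.fst_sub, Prod.snd_sub, Prod.smul_fst, Prod.smul_snd,
      smul_eq_mul] at hpL ⊢
    linear_combination hpL
  have hτκ : τ * planeCross (b - a) p ≠ 0 := by
    rw [hκ]; exact mul_ne_zero hzL (neg_ne_zero.2 hab)
  rcases hτκ.lt_or_gt with hneg | hpos
  · right
    filter_upwards [hnear.filter_mono nhdsWithin_le_nhds, self_mem_nhdsWithin] with s hs hs1
    refine hUP ⟨hs, ?_⟩
    rw [hval]
    have : s < 1 := hs1
    nlinarith
  · left
    filter_upwards [hnear.filter_mono nhdsWithin_le_nhds, self_mem_nhdsWithin] with s hs hs1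
    refine hUP ⟨hs, ?_⟩
    rw [hval]
    have : 1 < s := hs1
    nlinarith

/-- If the unit segment on the `x`-axis misses the interior, the one on the `y`-axis meets it, and
no vertex lies in the half-open quadrant, then the first edge met on the `y`-axis starts at a
vertex on the unit segment of the `x`-axis. -/
theorem exists_edge_of_quadrant (h : IsSegmentBounded E P) (h0 : (0 : ℝ × ℝ) ∉ P)
    (hvert : ∀ w e, E w e → 0 ≤ w.1 → 0 < w.2 → False)
    (hx : OriginSees P (1, 0)) (hy : ¬ OriginSees P (0, 1))
    (hcross : ∀ c d z, E c d → z ∈ segment ℝ c d → 0 ≤ z.1 → 0 ≤ z.2 → z.1 + z.2 = 1 →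
      (∃ e, E z e) ∨ (c.1 + c.2 = 1 ∧ d.1 + d.2 = 1)) :
    ∃ d m, E d m ∧ d.2 = 0 ∧ 0 < d.1 ∧ d.1 ≤ 1 ∧ m.1 < 0 ∧ 0 < m.2 ∧
      ∃ c ∈ openSegment ℝ d m, OriginSees P c := by
  have hcont : Continuous (fun s : ℝ => ((0 : ℝ), s)) := by fun_prop
  obtain ⟨s₁, hs₁, hs₁i⟩ : ∃ s₁ ∈ Set.Icc (0 : ℝ) 1, ((0 : ℝ), s₁) ∈ interior P := by
    simpa [OriginSees, and_assoc] using hy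
  have hs₁P : ((0 : ℝ), s₁) ∈ P := interior_subset hs₁i
  have hKc : IsCompact (Set.Icc (0 : ℝ) 1 ∩ (fun s : ℝ => ((0 : ℝ), s)) ⁻¹' P) :=
    isCompact_Icc.inter_right (h.compact.isClosed.preimage hcont)
  obtain ⟨β, ⟨hβ, hβP⟩, hβmin⟩ := hKc.exists_isLeast ⟨s₁, hs₁, hs₁P⟩
  have hβP : ((0 : ℝ), β) ∈ P := hβP
  have hβ0 : 0 < β := by
    rcases hβ.1.eq_or_lt with h' | h'
    · exact absurd (by rw [← h'] at hβP; exact hβP) h0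
    · exact h'
  have hlt : ∀ s : ℝ, 0 ≤ s → s < β → ((0 : ℝ), s) ∉ P := fun s hs0 hs hsP =>
    absurd (hβmin ⟨⟨hs0, hs.le.trans hβ.2⟩, hsP⟩) (not_le.2 hs)
  have hβi : ((0 : ℝ), β) ∉ interior P := by
    intro hi
    have h1 : ∀ᶠ s in nhdsWithin β (Set.Iio β), ((0 : ℝ), s) ∈ interior P :=
      ((hcont.tendsto β).eventually (isOpen_interior.mem_nhds hi)).filter_mono nhdsWithin_le_nhds
    have h2 : ∀ᶠ s in nhdsWithin β (Set.Iio β), 0 < s :=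
      (lt_mem_nhds hβ0).filter_mono nhdsWithin_le_nhds
    obtain ⟨s, ⟨h1, h2⟩, h3⟩ := ((h1.and h2).and self_mem_nhdsWithin).exists
    exact hlt s h2.le h3 (interior_subset h1)
  have hβ1 : β < 1 := by
    have h1 : β ≤ s₁ := hβmin ⟨hs₁, hs₁P⟩
    rcases h1.eq_or_lt with h' | h'
    · exact absurd (h' ▸ hs₁i) hβi
    · exact h'.trans_le hs₁.2
  have hsees : OriginSees P (0, β) := by
    intro s hs hsi
    have e : s • ((0 : ℝ), β) = (0, s * β) := by simp
    rw [e] at hsi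
    rcases hs.2.eq_or_lt with rfl | hs1
    · rw [one_mul] at hsi; exact hβi hsi
    · exact hlt _ (mul_nonneg hs.1 hβ0.le) (by nlinarith) (interior_subset hsi)
  have hβf : ((0 : ℝ), β) ∈ frontier P := by
    rw [h.compact.isClosed.frontier_eq]; exact ⟨hβP, hβi⟩
  rw [h.frontier_eq] at hβf
  obtain ⟨d, m, hdm, hseg, hle⟩ : ∃ d m, E d m ∧ ((0 : ℝ), β) ∈ segment ℝ d m ∧ m.1 ≤ d.1 := by
    obtain ⟨d, m, hdm, hs⟩ := hβf
    rcases le_total m.1 d.1 with hl | hl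
    · exact ⟨d, m, hdm, hs, hl⟩
    · exact ⟨m, d, h.symm hdm, segment_symm ℝ d m ▸ hs, hl⟩
  have hopen : ((0 : ℝ), β) ∈ openSegment ℝ d m := by
    refine mem_openSegment_of_ne_left_right ?_ ?_ hseg
    · rintro rfl; exact hvert _ _ hdm le_rfl hβ0
    · rintro rfl; exact hvert _ _ (h.symm hdm) le_rfl hβ0
  obtain ⟨r, s, hr, hs, hrs, hc⟩ := id hopen
  have hc1 : r * d.1 + s * m.1 = 0 := by simpa using congrArg Prod.fst hc
  have hc2 : r * d.2 + s * m.2 = β := by simpa using congrArg Prod.snd hc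
  obtain rfl : r = 1 - s := by linarith
  have hd0 : 0 ≤ d.1 := by nlinarith
  have hd2 : d.2 ≤ 0 := not_lt.1 fun hlt => hvert _ _ hdm hd0 hlt
  have hm2 : 0 < m.2 := by
    by_contra hm; nlinarith
  have hm1 : m.1 < 0 := not_le.1 fun hle => hvert _ _ (h.symm hdm) hle hm2
  have hd1 : 0 < d.1 := by nlinarith
  have hpt : ∀ u : ℝ, 0 ≤ u → u ≤ 1 →
      ((1 - u) * d.1 + u * m.1, (1 - u) * d.2 + u * m.2) ∈ segment ℝ d m := fun u hu hu1 =>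
    ⟨1 - u, u, by linarith, hu, by ring, by ext <;> simp⟩
  -- the edge meets the `x`-axis for the parameter `u`
  obtain ⟨u, hu0, hus, hu2⟩ : ∃ u, 0 ≤ u ∧ u < s ∧ (1 - u) * d.2 + u * m.2 = 0 := by
    have hpos : 0 < m.2 - d.2 := by linarith
    refine ⟨-d.2 / (m.2 - d.2), div_nonneg (by linarith) hpos.le, ?_, ?_⟩
    · rw [div_lt_iff₀ hpos]; linarith
    · field_simp; ring
  have hs1 : s < 1 := by linarith
  have hu1 : 0 < (1 - u) * d.1 + u * m.1 := by nlinarith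
  have hnotline : ¬ (d.1 + d.2 = 1 ∧ m.1 + m.2 = 1) := by
    rintro ⟨e1, e2⟩
    have : β = 1 := by
      rw [← hc2]; linear_combination (1 - s) * e1 + s * e2 - hc1
    exact hβ1.ne this
  have hule : (1 - u) * d.1 + u * m.1 ≤ 1 := by
    by_contra! hgt
    obtain ⟨w, hw, hw1⟩ : ∃ w ∈ Set.Icc u s,
        (1 - w) * (d.1 + d.2) + w * (m.1 + m.2) = 1 := by
      have hcw : ContinuousOn (fun w : ℝ => (1 - w) * (d.1 + d.2) + w * (m.1 + m.2))
          (Set.Icc u s) := by fun_prop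
      apply intermediate_value_Icc' hus.le hcw
      constructor <;> nlinarith
    have hwu : u ≠ w := by
      rintro rfl; linarith
    have hwu : u < w := lt_of_le_of_ne hw.1 hwu
    have hw2 : 0 < (1 - w) * d.2 + w * m.2 := by nlinarith
    have hw3 : 0 ≤ (1 - w) * d.1 + w * m.1 := by nlinarith [hw.2]
    rcases hcross _ _ _ hdm (hpt w (by linarith) (by linarith [hw.2])) hw3 hw2.le
      (by dsimp only; linarith) with ⟨e, he⟩ | hl
    · exact hvert _ _ he hw3 hw2
    · exact hnotline hl
  rcases hd2.eq_or_lt with hd2 | hd2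
  · have hu : u = 0 := by
      rw [hd2] at hu2
      have := hm2.ne'
      simpa [this] using hu2
    rw [hu] at hule
    exact ⟨d, m, hdm, hd2, hd1, by linarith, hm1, hm2, _, hopen, hsees⟩
  · exfalso
    have hu0 : 0 < u := by
      rcases hu0.eq_or_lt with rfl | h'
      · linarith
      · exact h'
    set α := (1 - u) * d.1 + u * m.1 with hα
    have hα0 : ((α, 0) : ℝ × ℝ) ∈ openSegment ℝ d m :=
      ⟨1 - u, u, by linarith, hu0, by ring, by ext <;> simp [hα, hu2]⟩
    have hne : planeCross d m ≠ 0 := by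
      have : 0 < planeCross d m := by
        have e : planeCross d m * u = - α * d.2 := by
          rw [hα, planeCross]; linear_combination d.1 * hu2
        have : 0 < planeCross d m * u := by rw [e]; nlinarith
        exact pos_of_mul_pos_left this hu0.le
      exact this.ne'
    have key : ∀ t : ℝ, 0 ≤ t → t * α ≤ 1 → t • ((α, 0) : ℝ × ℝ) ∉ interior P := by
      intro t ht0 ht1
      have := hx (t * α) ⟨mul_nonneg ht0 hu1.le, ht1⟩
      simpa using this
    rcases h.eventually_smul_mem_interior hdm hα0 hne with hev | hev
    · rcases hule.eq_or_lt with h1 | h1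
      · rcases hcross _ _ (α, 0) hdm (openSegment_subset_segment _ _ _ hα0) hu1.le le_rfl
          (by simpa using h1) with ⟨e, he⟩ | hl
        · exact h.not_vertex hdm hα0 e he
        · exact hnotline hl
      · have h2 : ∀ᶠ t in nhdsWithin (1 : ℝ) (Set.Ioi 1), t * α < 1 := by
          have hc : Continuous (fun t : ℝ => t * α) := by fun_prop
          exact ((hc.tendsto 1).eventually (gt_mem_nhds (by simpa using h1))).filter_mono
            nhdsWithin_le_nhds
        obtain ⟨t, ⟨h2, h3⟩, h4⟩ := ((h2.and hev).and self_mem_nhdsWithin).exists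
        exact key t (zero_le_one.trans (le_of_lt h4)) h2.le h3
    · have h2 : ∀ᶠ t in nhdsWithin (1 : ℝ) (Set.Iio 1), 0 < t :=
        (lt_mem_nhds zero_lt_one).filter_mono nhdsWithin_le_nhds
      obtain ⟨t, ⟨h2, h3⟩, h4⟩ := ((h2.and hev).and self_mem_nhdsWithin).exists
      have h4 : t < 1 := h4
      exact key t h2.le (by nlinarith) h3

/-- The region seen in affine coordinates is again bounded by segments. -/
theorem preimage (h : IsSegmentBounded E P) (g : ℝ × ℝ ≃ₜ ℝ × ℝ)
    (hg : ∀ (z w : ℝ × ℝ) (s t : ℝ), s + t = 1 → g (s • z + t • w) = s • g z + t • g w) :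
    IsSegmentBounded (fun a b => E (g a) (g b)) (g ⁻¹' P) where
  symm hab := h.symm hab
  finite := by
    refine (h.finite.preimage g.injective.injOn).subset ?_
    rintro a ⟨b, hb⟩
    exact ⟨g b, hb⟩
  eq_of_mem := by
    intro a b c d z hab hcd hz hz' hv
    have := h.eq_of_mem hab hcd (map_mem_segment g hg hz) (map_mem_segment g hg hz')
      (fun e he => hv (g.symm e) (by simpa using he))
    simpa [g.injective.eq_iff] using this
  not_vertex := by
    rintro a b z hab ⟨s, t, hs, ht, hst, rfl⟩ e he
    exact h.not_vertex hab ⟨s, t, hs, ht, hst, (hg a b s t hst).symm⟩ _ he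
  frontier_eq := by
    rw [← g.preimage_frontier, h.frontier_eq]
    ext z
    constructor
    · rintro ⟨a, b, hab, s, t, hs, ht, hst, hz⟩
      refine ⟨g.symm a, g.symm b, by simpa using hab, s, t, hs, ht, hst, g.injective ?_⟩
      rw [hg _ _ _ _ hst]
      simpa using hz
    · rintro ⟨a, b, hab, hz⟩
      exact ⟨g a, g b, hab, map_mem_segment g hg hz⟩
  compact := g.isCompact_preimage.2 h.compact
  closure_interior := by
    rw [← g.preimage_interior, ← g.preimage_closure, ← h.closure_interior]
  interior_nonempty := by
    rw [← g.preimage_interior]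
    exact h.interior_nonempty.preimage g.surjective

/-- If visibility is lost between `a` and `b` on a segment that no edge crosses, then some edge
whose first endpoint is visible starts in the triangle spanned by `a`, `b` and the origin. -/
theorem exists_next_edge (h : IsSegmentBounded E P) (h0 : (0 : ℝ × ℝ) ∉ P) {a b : ℝ × ℝ}
    (hab : 0 < planeCross a b) (ha : OriginSees P a) (hb : ¬ OriginSees P b)
    (hcross : ∀ c d z, E c d → z ∈ segment ℝ c d → z ∈ segment ℝ a b →
      (∃ e, E z e) ∨ (planeCross (b - a) (c - a) = 0 ∧ planeCross (b - a) (d - a) = 0)) :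
    ∃ t : ℝ, 0 ≤ t ∧ t < 1 ∧ ∃ r : ℝ, 0 < r ∧ ∃ d m, d = r • (a + t • (b - a)) ∧ E d m ∧
      0 < planeCross d m ∧ OriginSees P d ∧ ∃ c ∈ openSegment ℝ d m, OriginSees P c := by
  have hpc : Continuous (fun t : ℝ => a + t • (b - a)) := by fun_prop
  obtain ⟨t, ht0, ht1, htv, hfreq⟩ : ∃ t : ℝ, 0 ≤ t ∧ t < 1 ∧ OriginSees P (a + t • (b - a)) ∧
      ∃ᶠ s in nhdsWithin t (Set.Ioi t), ¬ OriginSees P (a + s • (b - a)) := by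
    by_contra! hcon
    have hcl : IsClosed {t : ℝ | OriginSees P (a + t • (b - a))} :=
      (isClosed_originSees P).preimage hpc
    have := (hcl.inter isClosed_Icc).Icc_subset_of_forall_mem_nhdsWithin (a := 0) (b := 1)
      (by simpa using ha) (fun x hx => by
        have := hcon x hx.2.1 hx.2.2 hx.1
        exact this)
    have h1 := this (Set.right_mem_Icc.2 zero_le_one)
    simp only [Set.mem_ofPred_eq, one_smul, add_sub_cancel] at h1
    exact hb h1
  set p := a + t • (b - a) with hp
  have hpq : ∀ s : ℝ, planeCross p (a + s • (b - a)) = (s - t) * planeCross a b := by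
    intro s; simp [hp, planeCross]; ring
  have hev : ∀ᶠ s in nhdsWithin t (Set.Ioi t), ∀ w ∈ {w | ∃ e, E w e},
      0 < planeCross p w → planeCross w (a + s • (b - a)) < 0 := by
    refine (Filter.eventually_all_finite h.finite).2 fun w _ => ?_
    by_cases hw : 0 < planeCross p w
    · have hc : Continuous (fun s : ℝ => planeCross w (a + s • (b - a))) := by
        unfold planeCross; fun_prop
      have hlt : planeCross w p < 0 := by
        have : planeCross w p = - planeCross p w := by unfold planeCross; ring
        linarith
      filter_upwards [((hc.tendsto t).eventually (gt_mem_nhds hlt)).filter_mono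
        nhdsWithin_le_nhds] with s hs _ using hs
    · exact Filter.Eventually.of_forall fun s hs => absurd hs hw
  have hlt1 : ∀ᶠ s in nhdsWithin t (Set.Ioi t), s < 1 :=
    (gt_mem_nhds ht1).filter_mono nhdsWithin_le_nhds
  obtain ⟨t₁, hq, ⟨hv, ht₁⟩, htt⟩ :=
    (hfreq.and_eventually ((hev.and hlt1).and self_mem_nhdsWithin)).exists
  have htt : t < t₁ := htt
  have hDeq := hpq t₁
  set q := a + t₁ • (b - a) with hqdef
  have hD : 0 < planeCross p q := by
    rw [hDeq]; exact mul_pos (sub_pos.2 htt) hab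
  set g := planeFrame 0 p q hD.ne' with hgdef
  have hgval : ∀ z, g z = z.1 • p + z.2 • q := fun z => by simp [g, planeFrame]
  have hsees : ∀ z, OriginSees (g ⁻¹' P) z ↔ OriginSees P (g z) := by
    intro z
    unfold OriginSees
    simp only [← g.preimage_interior, Set.mem_preimage]
    have e : ∀ s : ℝ, g (s • z) = s • g z := by
      intro s; simp [hgval, smul_smul, smul_add]
    simp only [e]
  have hpc1 : ∀ z : ℝ × ℝ, planeCross p (g z) = z.2 * planeCross p q := by
    intro z; rw [hgval]; simp [planeCross]; ring
  have hqc1 : ∀ z : ℝ × ℝ, planeCross (g z) q = z.1 * planeCross p q := by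
    intro z; rw [hgval]; simp [planeCross]; ring
  have hline : ∀ z : ℝ × ℝ, planeCross (b - a) (g z - a) = 0 → z.1 + z.2 = 1 := by
    intro z hz
    have e : planeCross (b - a) (g z - a) = (1 - (z.1 + z.2)) * planeCross a b := by
      rw [hgval]; simp [planeCross, hp, hqdef]; ring
    rw [e] at hz
    have := (mul_eq_zero.1 hz).resolve_right hab.ne'
    linarith
  obtain ⟨d, m, hdm, hd2, hd1, hd1', hm1, hm2, c, hc, hcs⟩ :=
    (h.preimage g (planeFrame_affine 0 p q hD.ne')).exists_edge_of_quadrant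
      (by simpa [hgval] using h0)
      (by
        intro w e he hw1 hw2
        have h1 := hv (g w) ⟨_, he⟩ (by rw [hpc1]; exact mul_pos hw2 hD)
        rw [hqc1] at h1
        nlinarith)
      (by rw [hsees]; simpa [hgval] using htv)
      (by rw [hsees]; simpa [hgval] using hq)
      (by
        intro c d z hcd hz hz1 hz2 hz3
        have hmem : g z ∈ segment ℝ a b := by
          refine ⟨1 - (z.1 * t + z.2 * t₁), z.1 * t + z.2 * t₁, ?_, ?_, by ring, ?_⟩
          · nlinarith
          · have : 0 < t₁ := by linarith
            positivity
          · have hz1' : z.1 = 1 - z.2 := by linarith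
            rw [hgval]
            ext <;> simp [hp, hqdef, hz1'] <;> ring
        rcases hcross _ _ _ hcd (map_mem_segment g (planeFrame_affine 0 p q hD.ne') hz) hmem with
          ⟨e, he⟩ | ⟨e1, e2⟩
        · exact Or.inl ⟨g.symm e, by simpa using he⟩
        · exact Or.inr ⟨hline _ e1, hline _ e2⟩)
  have hgd : g d = d.1 • p := by rw [hgval, hd2]; simp
  refine ⟨t, ht0, ht1, d.1, hd1, g d, g m, hgd, hdm, ?_, ?_, g c, ?_, (hsees c).1 hcs⟩
  · have e : planeCross (g d) (g m) = d.1 * planeCross p (g m) := by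
      rw [hgd]; simp [planeCross]; ring
    rw [e, hpc1]
    exact mul_pos hd1 (mul_pos hm2 hD)
  · rw [hgd]; exact htv.smul hd1.le hd1'
  · obtain ⟨s, u, hs, hu, hsu, rfl⟩ := hc
    exact ⟨s, u, hs, hu, hsu, (planeFrame_affine 0 p q hD.ne' d m s u hsu).symm⟩

theorem eventually_disjoint_far_segment (h : IsSegmentBounded E P) {a b : ℝ × ℝ}
    (hab : 0 < planeCross a b) :
    ∀ᶠ R : ℝ in Filter.atTop, Disjoint (segment ℝ (R • a) (R • b)) P := by
  have hc : Continuous (fun w : ℝ × ℝ => planeCross w b + planeCross a w) := by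
    unfold planeCross; fun_prop
  obtain ⟨M, hM⟩ := (h.compact.image hc).bddAbove
  filter_upwards [Filter.eventually_gt_atTop (M / planeCross a b)] with R hR
  rw [Set.disjoint_left]
  rintro w ⟨s, t, hs, ht, hst, rfl⟩ hw
  have h1 := hM ⟨_, hw, rfl⟩
  rw [div_lt_iff₀ hab] at hR
  obtain rfl : s = 1 - t := by linarith
  have e : planeCross ((1 - t) • R • a + t • R • b) b + planeCross a ((1 - t) • R • a + t • R • b)
      = R * planeCross a b := by
    simp [planeCross]; ring
  simp only [e] at h1
  linarith

/-- If visibility is lost between two directions along a segment disjoint from the region, then some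
edge starts at a visible vertex and is visible at some relative interior point. -/
theorem exists_edge_of_far (h : IsSegmentBounded E P) (h0 : (0 : ℝ × ℝ) ∉ P) {a b : ℝ × ℝ} {R : ℝ}
    (hR : 0 < R) (hdisj : Disjoint (segment ℝ (R • a) (R • b)) P)
    (hab : 0 < planeCross a b) (ha : OriginSees P (R • a)) (hb : ¬ OriginSees P (R • b)) :
    ∃ d m, E d m ∧ 0 < planeCross d m ∧ OriginSees P d ∧
      ∃ c ∈ openSegment ℝ d m, OriginSees P c := by
  have hab' : 0 < planeCross (R • a) (R • b) := by
    have e : planeCross (R • a) (R • b) = R * R * planeCross a b := by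
      simp [planeCross]; ring
    rw [e]; positivity
  obtain ⟨t, -, -, r, -, d, m, -, hE, hcr, hd, hc⟩ := h.exists_next_edge h0 hab' ha hb (by
    intro c d z hcd hz hz'
    refine absurd (h.compact.isClosed.frontier_subset ?_) (Set.disjoint_left.1 hdisj hz')
    rw [h.frontier_eq]
    exact ⟨c, d, hcd, hz⟩)
  exact ⟨d, m, hE, hcr, hd, hc⟩

theorem exists_visible_edge_start (h : IsSegmentBounded E P) (h0 : (0 : ℝ × ℝ) ∉ P)
    (hray : ∀ r : ℝ, 0 ≤ r → (r, (0 : ℝ)) ∉ interior P) :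
    ∃ d m, E d m ∧ 0 < planeCross d m ∧ OriginSees P d ∧
      ∃ c ∈ openSegment ℝ d m, OriginSees P c := by
  obtain ⟨z, hz, hz2⟩ : ∃ z ∈ interior P, z.2 ≠ 0 := by
    obtain ⟨z, hz⟩ := h.interior_nonempty
    by_cases hz2 : z.2 = 0
    · obtain ⟨ε, hε, hzε⟩ := exists_pos_add_smul_mem isOpen_interior hz (0, 1)
      exact ⟨_, hzε, by simp [hz2, hε.ne']⟩
    · exact ⟨z, hz, hz2⟩
  have hrayR : ∀ R : ℝ, 0 < R → OriginSees P (R • ((1 : ℝ), (0 : ℝ))) := by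
    intro R hR s hs
    have := hray (s * R) (mul_nonneg hs.1 hR.le)
    simpa using this
  have hzR : ∀ R : ℝ, 1 ≤ R → ¬ OriginSees P (R • z) := by
    intro R hR hv
    have hR0 : 0 < R := by linarith
    refine hv R⁻¹ ⟨by positivity, inv_le_one_of_one_le₀ hR⟩ ?_
    rwa [inv_smul_smul₀ hR0.ne']
  rcases hz2.lt_or_gt with hneg | hpos
  · set C : ℝ × ℝ := (-1 - z.1, -z.2) with hC
    have h1 : 0 < planeCross (1, 0) C := by simp [planeCross, hC, hneg]
    have h2 : 0 < planeCross C z := by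
      have : planeCross C z = - z.2 := by simp [planeCross, hC]; ring
      linarith
    obtain ⟨R, ⟨hd1, hd2⟩, hR⟩ := (((h.eventually_disjoint_far_segment h1).and
      (h.eventually_disjoint_far_segment h2)).and (Filter.eventually_ge_atTop 1)).exists
    have hR0 : 0 < R := by linarith
    by_cases hv : OriginSees P (R • C)
    · exact h.exists_edge_of_far h0 hR0 hd2 h2 hv (hzR R hR)
    · exact h.exists_edge_of_far h0 hR0 hd1 h1 (hrayR R hR0) hv
  · have h1 : 0 < planeCross (1, 0) z := by simpa [planeCross] using hpos
    obtain ⟨R, hd, hR⟩ := ((h.eventually_disjoint_far_segment h1).and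
      (Filter.eventually_ge_atTop 1)).exists
    have hR0 : 0 < R := by linarith
    exact h.exists_edge_of_far h0 hR0 hd h1 (hrayR R hR0) (hzR R hR)

/-- If the positive `x`-axis avoids the interior and the origin is exterior, then the origin sees
both endpoints of some edge. -/
theorem exists_visible_edge (h : IsSegmentBounded E P) (h0 : (0 : ℝ × ℝ) ∉ P)
    (hray : ∀ r : ℝ, 0 ≤ r → (r, (0 : ℝ)) ∉ interior P) :
    ∃ a b, E a b ∧ OriginSees P a ∧ OriginSees P b := by
  by_contra! hcon
  set S : Set ((ℝ × ℝ) × (ℝ × ℝ)) := {e | E e.1 e.2 ∧ 0 < planeCross e.1 e.2 ∧ OriginSees P e.1 ∧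
    ∃ c ∈ openSegment ℝ e.1 e.2, OriginSees P c} with hS
  have hSf : S.Finite := by
    refine (h.finite.prod h.finite).subset ?_
    rintro ⟨c, d⟩ ⟨he, -⟩
    exact ⟨⟨d, he⟩, ⟨c, h.symm he⟩⟩
  have hSn : S.Nonempty := by
    obtain ⟨d, m, hd⟩ := h.exists_visible_edge_start h0 hray
    exact ⟨(d, m), hd⟩
  obtain ⟨⟨a, b⟩, ⟨hE, hab, ha, c, hc, hcv⟩, hmax⟩ :=
    Set.exists_max_image S (fun e => diamondAngle e.1) hSf hSn
  dsimp only at hE hab ha hc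
  obtain ⟨s₀, t₀, hs₀, ht₀, hst, rfl⟩ := hc
  obtain rfl : s₀ = 1 - t₀ := by linarith
  set a' := (1 - t₀) • a + t₀ • b with ha'
  have hE1 : planeCross a' b = (1 - t₀) * planeCross a b := by
    simp [ha', planeCross]; ring
  have hab' : 0 < planeCross a' b := by rw [hE1]; exact mul_pos hs₀ hab
  have hseg : segment ℝ a' b ⊆ segment ℝ a b :=
    (convex_segment a b).segment_subset ⟨1 - t₀, t₀, hs₀.le, ht₀.le, by ring, rfl⟩
      (right_mem_segment ℝ a b)
  have hba : planeCross (b - a') (b - a') = 0 ∧ planeCross (b - a') (a - a') = 0 := by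
    constructor <;> simp [ha', planeCross] <;> ring
  obtain ⟨t, ht0, ht1, r, hr, d, m, hd, hdm, hcr, hdv, hcm⟩ :=
    h.exists_next_edge h0 hab' hcv (hcon a b hE ha) (by
      intro c d z hcd hz hz'
      by_cases hv : ∃ e, E z e
      · exact Or.inl hv
      · rcases h.eq_of_mem hE hcd (hseg hz') hz (not_exists.1 hv) with ⟨rfl, rfl⟩ | ⟨rfl, rfl⟩
        · exact Or.inr ⟨hba.2, hba.1⟩
        · exact Or.inr hba)
  have hle : diamondAngle d ≤ diamondAngle a := hmax (d, m) ⟨hdm, hcr, hdv, hcm⟩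
  refine absurd hle (not_le.2 (diamondAngle_lt ?_ ?_))
  · have e : planeCross a d = r * ((t₀ + t * (1 - t₀)) * planeCross a b) := by
      rw [hd]; simp [ha', planeCross]; ring
    rw [e]
    have : 0 < t₀ + t * (1 - t₀) := by nlinarith
    positivity
  · intro ha2
    by_contra! hd2
    set u := t₀ + t * (1 - t₀) with hu
    have hu0 : 0 < u := by nlinarith
    have hu1 : u < 1 := by nlinarith
    have hdu : d = r • ((1 - u) • a + u • b) := by
      rw [hd]; ext <;> simp [ha', hu] <;> ring
    have hu2 : 0 ≤ (1 - u) * a.2 + u * b.2 := by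
      have : 0 ≤ r * ((1 - u) * a.2 + u * b.2) := by simpa [hdu, mul_add] using hd2
      exact nonneg_of_mul_nonneg_right this hr
    have hden : 0 < b.2 - a.2 := by nlinarith
    set s := -a.2 / (b.2 - a.2) with hs
    have hs0 : 0 < s := div_pos (by linarith) hden
    have hs1 : s < 1 := by
      rw [hs, div_lt_one hden]; nlinarith
    have hs2 : (1 - s) * a.2 + s * b.2 = 0 := by
      rw [hs]; field_simp; ring
    set x := (1 - s) * a.1 + s * b.1 with hx
    have hmem : ((x, 0) : ℝ × ℝ) ∈ openSegment ℝ a b :=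
      ⟨1 - s, s, by linarith, hs0, by ring, by ext <;> simp [hx, hs2]⟩
    have hx0 : 0 < x := by
      have e : s * planeCross a b = -a.2 * x := by
        rw [hx, planeCross]; linear_combination a.1 * hs2
      have : 0 < -a.2 * x := by rw [← e]; positivity
      exact pos_of_mul_pos_right this (by linarith)
    have hno : ∀ r : ℝ, 0 ≤ r → r • ((x, 0) : ℝ × ℝ) ∉ interior P := by
      intro r hr
      have := hray (r * x) (by positivity)
      simpa using this
    rcases h.eventually_smul_mem_interior hE hmem hab.ne' with hev | hev
    · obtain ⟨y, h3, h4⟩ := (hev.and self_mem_nhdsWithin).exists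
      exact hno y (zero_le_one.trans (le_of_lt h4)) h3
    · have h2 : ∀ᶠ y in nhdsWithin (1 : ℝ) (Set.Iio 1), 0 < y :=
        (lt_mem_nhds zero_lt_one).filter_mono nhdsWithin_le_nhds
      obtain ⟨y, h3, h4⟩ := (hev.and h2).exists
      exact hno y h4.le h3

end IsSegmentBounded

/-- The region of a simple polygon is bounded by the segments joining consecutive vertices. -/
theorem IsSimplePolygon.isSegmentBounded {n : ℕ} {v : ZMod n → ℝ × ℝ} {P : Set (ℝ × ℝ)}
    (h : IsSimplePolygon n v P) :
    IsSegmentBounded (fun a b => ∃ i, (a = v i ∧ b = v (i + 1)) ∨ (a = v (i + 1) ∧ b = v i)) P := by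
  obtain ⟨hn, hinj, hcons, hdisj, hcomp, hclos, hfr⟩ := h
  have : NeZero n := ⟨by omega⟩
  have : Fact (1 < n) := ⟨by omega⟩
  have hmem : ∀ {a b z : ℝ × ℝ} {i : ZMod n},
      (a = v i ∧ b = v (i + 1)) ∨ (a = v (i + 1) ∧ b = v i) → z ∈ segment ℝ a b →
      z ∈ segment ℝ (v i) (v (i + 1)) := by
    rintro a b z i (⟨rfl, rfl⟩ | ⟨rfl, rfl⟩) hz
    · exact hz
    · rwa [segment_symm]
  have hnext : ∀ {i : ZMod n} {z}, z ∈ segment ℝ (v i) (v (i + 1)) →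
      z ∈ segment ℝ (v (i + 1)) (v (i + 1 + 1)) → z = v (i + 1) := by
    intro i z h1 h2
    have e : i + 1 + 1 = i + 2 := by ring
    rw [e] at h2
    have hz := Set.mem_inter h1 h2
    rwa [hcons i, Set.mem_singleton_iff] at hz
  refine
    { symm := ?_, finite := ?_, eq_of_mem := ?_, not_vertex := ?_, frontier_eq := ?_,
      compact := hcomp, closure_interior := hclos, interior_nonempty := ?_ }
  · rintro a b ⟨i, hi⟩
    exact ⟨i, by tauto⟩
  · refine (Set.finite_range v).subset ?_
    rintro a ⟨b, i, ⟨rfl, -⟩ | ⟨rfl, -⟩⟩ <;> exact ⟨_, rfl⟩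
  · rintro a b c d z ⟨i, hi⟩ ⟨j, hj⟩ hz hz' hv
    have hzi := hmem hi hz
    have hzj := hmem hj hz'
    have hv' : ∀ k, z ≠ v k := fun k hk => hv (v (k + 1)) ⟨k, Or.inl ⟨hk, rfl⟩⟩
    by_cases hji : j = i
    · subst hji
      rcases hi with ⟨rfl, rfl⟩ | ⟨rfl, rfl⟩ <;> rcases hj with ⟨rfl, rfl⟩ | ⟨rfl, rfl⟩ <;> simp
    · by_cases hji1 : j = i + 1
      · subst hji1; exact absurd (hnext hzi hzj) (hv' _)
      · by_cases hij1 : i = j + 1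
        · subst hij1; exact absurd (hnext hzj hzi) (hv' _)
        · exact absurd (Set.mem_inter hzi hzj) (by rw [hdisj i j hji hji1 hij1]; simp)
  · rintro a b z ⟨i, hi⟩ hz e ⟨k, hk⟩
    obtain ⟨j, rfl⟩ : ∃ j, z = v j := by
      rcases hk with ⟨rfl, -⟩ | ⟨rfl, -⟩ <;> exact ⟨_, rfl⟩
    have hab : a ≠ b := by
      rcases hi with ⟨rfl, rfl⟩ | ⟨rfl, rfl⟩ <;> simp [hinj.eq_iff]
    have hza : v j ≠ a := by
      intro h'; rw [h', left_mem_openSegment_iff] at hz; exact hab hz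
    have hzb : v j ≠ b := by
      intro h'; rw [h', right_mem_openSegment_iff] at hz; exact hab hz
    have hzi := hmem hi (openSegment_subset_segment ℝ a b hz)
    have hji : j ≠ i := by rintro rfl; tauto
    have hji1 : j ≠ i + 1 := by rintro rfl; tauto
    have hzj : v j ∈ segment ℝ (v j) (v (j + 1)) := left_mem_segment ℝ _ _
    by_cases hij1 : i = j + 1
    · subst hij1
      exact hji (hinj (hnext hzj hzi))
    · exact absurd (Set.mem_inter hzi hzj) (by rw [hdisj i j hji hji1 hij1]; simp)
  · rw [hfr]
    ext z
    simp only [Set.mem_iUnion]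
    constructor
    · rintro ⟨i, hz⟩
      exact ⟨_, _, ⟨i, Or.inl ⟨rfl, rfl⟩⟩, hz⟩
    · rintro ⟨a, b, ⟨i, hi⟩, hz⟩
      exact ⟨i, hmem hi hz⟩
  · have h0 : v 0 ∈ frontier P := by
      rw [hfr]; exact Set.mem_iUnion.2 ⟨0, left_mem_segment ℝ _ _⟩
    have h1 := hcomp.isClosed.frontier_subset h0
    rw [hclos] at h1
    exact closure_nonempty_iff.1 ⟨_, h1⟩

/-- A ray avoiding the frontier of a compact plane set avoids its interior. -/
theorem IsCompact.ray_notMem_interior {P : Set (ℝ × ℝ)} (hP : IsCompact P) {X q : ℝ × ℝ}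
    (hq : q ≠ 0) {r₀ : ℝ} (hf : ∀ r, r₀ ≤ r → X + r • q ∉ frontier P) {r : ℝ} (hr : r₀ ≤ r) :
    X + r • q ∉ interior P := by
  intro hi
  set W := (fun r : ℝ => X + r • q) '' Set.Ici r₀ with hW
  have hWc : IsPreconnected W := isPreconnected_Ici.image _ (by fun_prop)
  have hWf : Disjoint W (frontier P) := by
    rw [Set.disjoint_left]
    rintro _ ⟨s, hs, rfl⟩
    exact hf s hs
  have hWi := hWc.subset_interior_of_disjoint_frontier hWf ⟨_, ⟨r, hr, rfl⟩, hi⟩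
  have hc : Continuous (fun w : ℝ × ℝ => w.1 * q.1 + w.2 * q.2) := by fun_prop
  obtain ⟨M, hM⟩ := (hP.image hc).bddAbove
  have hqq : 0 < q.1 * q.1 + q.2 * q.2 := by
    by_contra! hle
    have h1 := mul_self_nonneg q.1
    have h2 := mul_self_nonneg q.2
    exact hq (Prod.ext (mul_self_eq_zero.1 (by linarith)) (mul_self_eq_zero.1 (by linarith)))
  set N := (M - (X.1 * q.1 + X.2 * q.2)) / (q.1 * q.1 + q.2 * q.2) with hN
  have hmem := hM ⟨_, interior_subset (hWi ⟨max r₀ (N + 1), Set.mem_Ici.2 (le_max_left _ _), rfl⟩), rfl⟩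
  have hlt : N < max r₀ (N + 1) := (lt_add_one N).trans_le (le_max_right _ _)
  rw [hN, div_lt_iff₀ hqq, ← hN] at hlt
  simp only [Prod.fst_add, Prod.snd_add, Prod.smul_fst, Prod.smul_snd, smul_eq_mul] at hmem
  linarith

/-- A point from which some point outside the convex hull is visible is the origin of a ray
avoiding the interior of the region. -/
theorem IsSimplePolygon.exists_ray {n : ℕ} {v : ZMod n → ℝ × ℝ} {P : Set (ℝ × ℝ)}
    (h : IsSimplePolygon n v P) {X Q : ℝ × ℝ} (hQ : Q ∉ convexHull ℝ (Set.range v))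
    (hXQ : Disjoint (segment ℝ X Q) (interior P)) :
    ∃ q : ℝ × ℝ, q ≠ 0 ∧ ∀ r : ℝ, 0 ≤ r → X + r • q ∉ interior P := by
  obtain ⟨-, -, -, -, hcomp, -, hfr⟩ := h
  have hconv := convex_convexHull ℝ (Set.range v)
  have hv : ∀ i, v i ∈ convexHull ℝ (Set.range v) := fun i => subset_convexHull ℝ _ ⟨i, rfl⟩
  have hfh : frontier P ⊆ convexHull ℝ (Set.range v) := by
    rw [hfr]
    exact Set.iUnion_subset fun i => hconv.segment_subset (hv _) (hv _)
  by_cases hX : X ∈ convexHull ℝ (Set.range v)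
  · have hq : Q - X ≠ 0 := by
      intro h'; rw [sub_eq_zero.1 h'] at hQ; exact hQ hX
    refine ⟨Q - X, hq, fun r hr => ?_⟩
    rcases le_total r 1 with h1 | h1
    · refine Set.disjoint_left.1 hXQ ?_
      rw [segment_eq_image']
      exact ⟨r, ⟨hr, h1⟩, rfl⟩
    · refine hcomp.ray_notMem_interior hq (r₀ := 1) (fun s hs hsf => hQ ?_) h1
      have hs0 : 0 < s := by linarith
      have := hconv.add_smul_mem hX (hfh hsf) ⟨(inv_pos.2 hs0).le, inv_le_one_of_one_le₀ hs⟩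
      rwa [inv_smul_smul₀ hs0.ne', add_sub_cancel] at this
  · have hq : X - v 0 ≠ 0 := by
      intro h'; rw [sub_eq_zero.1 h'] at hX; exact hX (hv 0)
    refine ⟨X - v 0, hq, fun r hr => ?_⟩
    refine hcomp.ray_notMem_interior hq (r₀ := 0) (fun s hs hsf => hX ?_) hr
    have hs0 : 0 < 1 + s := by linarith
    refine hconv.segment_subset (hv 0) (hfh hsf) ⟨s / (1 + s), 1 / (1 + s), ?_, ?_, ?_, ?_⟩
    · positivity
    · positivity
    · field_simp; ring
    · ext <;> simp <;> field_simp <;> ring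

/-- Lemma 1 of the paper: if `G` is a set of vertices of the polygon containing at
least one endpoint of every edge (guards at every second vertex) and `X` is an exterior
point not observed by any guard of `G`, then `X` is not visible from any point outside
the convex hull of the vertices: for every `Q` outside the convex hull, the segment
`[X, Q]` meets the interior of `P`. -/
theorem fortress_unobserved_not_visible_outside_hull
    {n : ℕ} {v : ZMod n → ℝ × ℝ} {P : Set (ℝ × ℝ)}
    (hpoly : IsSimplePolygon n v P)
    (G : Set (ℝ × ℝ)) (hGsub : G ⊆ Set.range v)
    (hG : ∀ i : ZMod n, v i ∈ G ∨ v (i + 1) ∈ G)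
    (X : ℝ × ℝ) (hX : X ∉ P)
    (hunobs : ∀ g ∈ G, (segment ℝ X g ∩ interior P).Nonempty)
    (Q : ℝ × ℝ) (hQ : Q ∉ convexHull ℝ (Set.range v)) :
    (segment ℝ X Q ∩ interior P).Nonempty := by
  by_contra hne
  have hXQ : Disjoint (segment ℝ X Q) (interior P) :=
    Set.disjoint_iff_inter_eq_empty.2 (Set.not_nonempty_iff_eq_empty.1 hne)
  obtain ⟨q, hq, hray⟩ := hpoly.exists_ray hQ hXQ
  have hD : planeCross q (-q.2, q.1) ≠ 0 := by
    intro hD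
    have hD : q.1 * q.1 + q.2 * q.2 = 0 := by simpa [planeCross] using hD
    have h1 := mul_self_nonneg q.1
    have h2 := mul_self_nonneg q.2
    exact hq (Prod.ext (mul_self_eq_zero.1 (by linarith)) (mul_self_eq_zero.1 (by linarith)))
  set g := planeFrame X q (-q.2, q.1) hD with hg
  have hg0 : g 0 = X := by simp [hg, planeFrame]
  have hgaff := planeFrame_affine X q (-q.2, q.1) hD
  obtain ⟨a, b, ⟨i, hi⟩, ha, hb⟩ :=
    (hpoly.isSegmentBounded.preimage g hgaff).exists_visible_edge (by simpa [hg0] using hX)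
      (by
        intro r hr
        rw [← g.preimage_interior]
        have e : g (r, 0) = X + r • q := by simp [hg, planeFrame]
        simpa [e] using hray r hr)
  have hnot : ∀ z, OriginSees (g ⁻¹' P) z → g z ∉ G := by
    intro z hz hzG
    obtain ⟨w, ⟨s, t, hs, ht, hst, rfl⟩, hwi⟩ := hunobs _ hzG
    refine hz t ⟨ht, by linarith⟩ ?_
    rw [← g.preimage_interior, Set.mem_preimage]
    have e := hgaff 0 z s t hst
    rw [← hg, smul_zero, zero_add, hg0] at e
    rwa [e]
  have ha := hnot a ha
  have hb := hnot b hb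
  rcases hi with ⟨e1, e2⟩ | ⟨e1, e2⟩ <;> rw [e1] at ha <;> rw [e2] at hb
  · exact (hG i).elim ha hb
  · exact (hG i).elim hb ha
end

section
/- Let P ⊆ ℝ² be the region of a simple n-gon with vertex cycle v 0, …, v (n-1) and n < 12. Then there exists a starting index k such that, with the every-second-vertex guard set G_k = {v((k + 2j) mod n) : 0 ≤ j < ⌈n/2⌉}, every point X outside P is observed by some guard in G_k. -/
/-- The every-second-vertex guard set with starting index `k`:
`G_k = {v ((k + 2*j) mod n) : 0 ≤ j < ⌈n/2⌉}`. -/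
def EverySecondGuards (n : ℕ) (v : ZMod n → ℝ × ℝ) (k : ZMod n) : Set (ℝ × ℝ) :=
  {p | ∃ j : ℕ, j < (n + 1) / 2 ∧ p = v (k + ((2 * j : ℕ) : ZMod n))}

namespace Fortress

open Set

/-- A preconnected set that meets an open set without lying inside it meets the boundary. -/
theorem _root_.IsPreconnected.exists_mem_closure_notMem {α : Type*} [TopologicalSpace α] {C T : Set α}
    (hC : IsPreconnected C) (hT : IsOpen T) {p q : α} (hp : p ∈ C) (hpT : p ∈ T)
    (hq : q ∈ C) (hqT : q ∉ T) : ∃ r ∈ C, r ∈ closure T ∧ r ∉ T := by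
  by_contra! h
  have hq' : q ∈ (closure T)ᶜ := fun hc => hqT (h q hq hc)
  obtain ⟨r, -, hr, hr'⟩ := hC T (closure T)ᶜ hT isClosed_closure.isOpen_compl
    (fun r hr => by
      by_cases hc : r ∈ closure T
      · exact Or.inl (h r hr hc)
      · exact Or.inr hc) ⟨p, hp, hpT⟩ ⟨q, hq, hq'⟩
  exact hr' (subset_closure hr)

theorem exists_mem_segment_closure_notMem {T : Set (ℝ × ℝ)} (hT : IsOpen T) {p q : ℝ × ℝ}
    (hp : p ∈ T) (hq : q ∉ T) : ∃ r ∈ segment ℝ p q, r ∈ closure T ∧ r ∉ T :=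
  (convex_segment p q).isPreconnected.exists_mem_closure_notMem hT
    (left_mem_segment ℝ p q) hp (right_mem_segment ℝ p q) hq

theorem exists_of_mem_segment {p q r : ℝ × ℝ} (h : r ∈ segment ℝ p q) :
    ∃ t : ℝ, 0 ≤ t ∧ t ≤ 1 ∧ r = p + t • (q - p) := by
  obtain ⟨a, b, ha, hb, hab, rfl⟩ := h
  refine ⟨b, hb, by linarith, ?_⟩
  obtain rfl : a = 1 - b := by linarith
  module

theorem add_smul_sub_mem_segment (p q : ℝ × ℝ) {t : ℝ} (h0 : 0 ≤ t) (h1 : t ≤ 1) :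
    p + t • (q - p) ∈ segment ℝ p q :=
  ⟨1 - t, t, by linarith, h0, by ring, by module⟩

/-- The cross product of two plane vectors, scaled by `σ` to choose an orientation. -/
def cross (σ : ℝ) (p q : ℝ × ℝ) : ℝ := σ * (p.1 * q.2 - p.2 * q.1)

theorem cross_swap (σ : ℝ) (p q : ℝ × ℝ) : cross σ q p = -cross σ p q := by
  unfold cross; ring

@[simp] theorem cross_self (σ : ℝ) (p : ℝ × ℝ) : cross σ p p = 0 := by
  unfold cross; ring

@[simp] theorem cross_zero_left (σ : ℝ) (p : ℝ × ℝ) : cross σ 0 p = 0 := by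
  simp [cross]

@[simp] theorem cross_zero_right (σ : ℝ) (p : ℝ × ℝ) : cross σ p 0 = 0 := by
  simp [cross]

theorem cross_add_left (σ : ℝ) (p q r : ℝ × ℝ) :
    cross σ (p + q) r = cross σ p r + cross σ q r := by
  simp only [cross, Prod.fst_add, Prod.snd_add]; ring

theorem cross_add_right (σ : ℝ) (p q r : ℝ × ℝ) :
    cross σ r (p + q) = cross σ r p + cross σ r q := by
  simp only [cross, Prod.fst_add, Prod.snd_add]; ring

theorem cross_sub_left (σ : ℝ) (p q r : ℝ × ℝ) :
    cross σ (p - q) r = cross σ p r - cross σ q r := by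
  simp only [cross, Prod.fst_sub, Prod.snd_sub]; ring

theorem cross_sub_right (σ : ℝ) (p q r : ℝ × ℝ) :
    cross σ r (p - q) = cross σ r p - cross σ r q := by
  simp only [cross, Prod.fst_sub, Prod.snd_sub]; ring

theorem cross_smul_left (σ t : ℝ) (p r : ℝ × ℝ) : cross σ (t • p) r = t * cross σ p r := by
  simp only [cross, Prod.smul_fst, Prod.smul_snd, smul_eq_mul]; ring

theorem cross_smul_right (σ t : ℝ) (p r : ℝ × ℝ) : cross σ r (t • p) = t * cross σ r p := by
  simp only [cross, Prod.smul_fst, Prod.smul_snd, smul_eq_mul]; ring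

@[fun_prop]
theorem continuous_cross_left (σ : ℝ) (r : ℝ × ℝ) : Continuous fun p => cross σ p r := by
  unfold cross; fun_prop

@[fun_prop]
theorem continuous_cross_right (σ : ℝ) (r : ℝ × ℝ) : Continuous fun p => cross σ r p := by
  unfold cross; fun_prop

theorem cross_smul_eq (σ : ℝ) (z u p : ℝ × ℝ) :
    cross σ z u • p = cross σ p u • z + cross σ z p • u := by
  ext
  · simp only [cross, Prod.fst_add, Prod.smul_fst, smul_eq_mul]; ring
  · simp only [cross, Prod.snd_add, Prod.smul_snd, smul_eq_mul]; ring

theorem cross_mul_cross (σ : ℝ) (z u p q : ℝ × ℝ) :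
    cross σ z u * cross σ p q = cross σ p u * cross σ z q + cross σ z p * cross σ u q := by
  simp only [cross]; ring

theorem eq_of_cross (σ : ℝ) {z u p : ℝ × ℝ} (h : cross σ z u ≠ 0) :
    p = (cross σ p u / cross σ z u) • z + (cross σ z p / cross σ z u) • u := by
  have := cross_smul_eq σ z u p
  rw [div_eq_inv_mul, div_eq_inv_mul, mul_smul, mul_smul, ← smul_add, ← this, smul_smul,
    inv_mul_cancel₀ h, one_smul]

/-- The open triangle with vertices `0`, `z`, `u`, for `0 < cross σ z u`. -/
def openTri (σ : ℝ) (z u : ℝ × ℝ) : Set (ℝ × ℝ) :=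
  {p | 0 < cross σ z p ∧ 0 < cross σ p u ∧ cross σ z p + cross σ p u < cross σ z u}

theorem isOpen_openTri (σ : ℝ) (z u : ℝ × ℝ) : IsOpen (openTri σ z u) := by
  unfold openTri
  exact (isOpen_lt continuous_const (continuous_cross_right σ z)).inter
    ((isOpen_lt continuous_const (continuous_cross_left σ u)).inter
      (isOpen_lt ((continuous_cross_right σ z).add (continuous_cross_left σ u)) continuous_const))

theorem mem_segment_zero_of_cross {σ : ℝ} {z u p : ℝ × ℝ} (h : 0 < cross σ z u)
    (h1 : cross σ z p = 0) (h2 : 0 ≤ cross σ p u) (h3 : cross σ p u ≤ cross σ z u) :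
    p ∈ segment ℝ 0 z := by
  have := eq_of_cross σ (p := p) h.ne'
  rw [h1, zero_div, zero_smul, add_zero] at this
  rw [this]
  refine ⟨1 - cross σ p u / cross σ z u, cross σ p u / cross σ z u, ?_, ?_, by ring, by simp⟩
  · rw [sub_nonneg, div_le_one h]; exact h3
  · positivity

theorem mem_segment_of_cross {σ : ℝ} {z u p : ℝ × ℝ} (h : 0 < cross σ z u)
    (h1 : 0 ≤ cross σ z p) (h2 : 0 ≤ cross σ p u)
    (h3 : cross σ z p + cross σ p u = cross σ z u) : p ∈ segment ℝ z u := by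
  have := eq_of_cross σ (p := p) h.ne'
  rw [this]
  refine ⟨cross σ p u / cross σ z u, cross σ z p / cross σ z u, by positivity, by positivity,
    ?_, rfl⟩
  rw [← add_div, add_comm, h3, div_self h.ne']

/-- The `i`-th edge of a closed polygonal curve. -/
def edge {n : ℕ} (w : ZMod n → ℝ × ℝ) (i : ZMod n) : Set (ℝ × ℝ) := segment ℝ (w i) (w (i + 1))

/-- The conditions on the vertices of a simple polygon that do not involve the region. -/
structure IsSimpleCurve {n : ℕ} (w : ZMod n → ℝ × ℝ) : Prop where
  three_le : 3 ≤ n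
  injective : Function.Injective w
  adjacent : ∀ i, edge w i ∩ edge w (i + 1) = {w (i + 1)}
  disjoint : ∀ i j, j ≠ i → j ≠ i + 1 → i ≠ j + 1 → edge w i ∩ edge w j = ∅

/-- The origin lies on no line through two vertices. -/
def IsGeneric {n : ℕ} (σ : ℝ) (w : ZMod n → ℝ × ℝ) : Prop :=
  ∀ i j, i ≠ j → cross σ (w i) (w j) ≠ 0

/-- The vertex `i` is seen from the origin without touching the curve elsewhere. -/
def Sees {n : ℕ} (w : ZMod n → ℝ × ℝ) (i : ZMod n) : Prop :=
  ∀ j, ∀ p ∈ edge w j, p ∈ segment ℝ 0 (w i) → p = w i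

theorem mem_segment_zero {p q : ℝ × ℝ} (h : p ∈ segment ℝ 0 q) :
    ∃ t : ℝ, 0 ≤ t ∧ t ≤ 1 ∧ p = t • q := by
  obtain ⟨t, h0, h1, rfl⟩ := exists_of_mem_segment h
  exact ⟨t, h0, h1, by simp⟩

theorem smul_mem_segment_zero (q : ℝ × ℝ) {t : ℝ} (h0 : 0 ≤ t) (h1 : t ≤ 1) :
    t • q ∈ segment ℝ 0 q := ⟨1 - t, t, by linarith, h0, by ring, by simp⟩

theorem one_ne_zero_zmod {n : ℕ} (hn : 3 ≤ n) : (1 : ZMod n) ≠ 0 := by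
  have : Fact (1 < n) := ⟨by omega⟩
  exact one_ne_zero

theorem two_ne_zero_zmod {n : ℕ} (hn : 3 ≤ n) : (2 : ZMod n) ≠ 0 := by
  intro h
  have : ((2 : ℕ) : ZMod n) = 0 := by exact_mod_cast h
  rw [ZMod.natCast_eq_zero_iff] at this
  exact absurd (Nat.le_of_dvd (by norm_num) this) (by omega)

section
variable {n : ℕ} {w : ZMod n → ℝ × ℝ} {σ : ℝ}

theorem left_mem_edge (i : ZMod n) : w i ∈ edge w i := left_mem_segment _ _ _

theorem right_mem_edge (i : ZMod n) : w (i + 1) ∈ edge w i := right_mem_segment _ _ _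

theorem IsSimpleCurve.succ_ne (hw : IsSimpleCurve w) (i : ZMod n) : i + 1 ≠ i := fun h =>
  one_ne_zero_zmod hw.three_le (by simpa using h)

theorem IsSimpleCurve.eq_or_eq_of_mem_edge (hw : IsSimpleCurve w) {i j : ZMod n}
    (h : w i ∈ edge w j) : i = j ∨ i = j + 1 := by
  by_contra! hc
  by_cases hj : j = i + 1
  · subst hj
    have : w i ∈ edge w i ∩ edge w (i + 1) := ⟨left_mem_edge i, h⟩
    rw [hw.adjacent] at this
    exact hw.succ_ne i (hw.injective this).symm
  · have : w i ∈ edge w j ∩ edge w i := ⟨h, left_mem_edge i⟩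
    rw [hw.disjoint j i hc.1 hc.2 hj] at this
    exact this

theorem IsSimpleCurve.eq_vertex_of_mem_of_mem (hw : IsSimpleCurve w) {i j : ZMod n} (hij : i ≠ j)
    {p : ℝ × ℝ} (hi : p ∈ edge w i) (hj : p ∈ edge w j) :
    (j = i + 1 ∧ p = w j) ∨ (i = j + 1 ∧ p = w i) := by
  by_cases h1 : j = i + 1
  · subst h1
    have : p ∈ edge w i ∩ edge w (i + 1) := ⟨hi, hj⟩
    rw [hw.adjacent] at this
    exact Or.inl ⟨rfl, this⟩
  by_cases h2 : i = j + 1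
  · subst h2
    have : p ∈ edge w j ∩ edge w (j + 1) := ⟨hj, hi⟩
    rw [hw.adjacent] at this
    exact Or.inr ⟨rfl, this⟩
  have : p ∈ edge w i ∩ edge w j := ⟨hi, hj⟩
  rw [hw.disjoint i j hij.symm h1 h2] at this
  exact this.elim

theorem IsGeneric.cross_edge_ne (hw : IsSimpleCurve w) (hg : IsGeneric σ w) (i : ZMod n) :
    cross σ (w i) (w (i + 1)) ≠ 0 := hg _ _ (hw.succ_ne i).symm

theorem IsGeneric.zero_notMem_edge (hw : IsSimpleCurve w) (hg : IsGeneric σ w) (j : ZMod n) :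
    (0 : ℝ × ℝ) ∉ edge w j := by
  intro h
  obtain ⟨a, b, ha, hb, hab, h⟩ := h
  have h1 := congrArg (cross σ (w j)) h
  have h2 := congrArg (fun p => cross σ p (w (j + 1))) h
  simp only [cross_add_right, cross_add_left, cross_smul_right, cross_smul_left, cross_self,
    mul_zero, zero_add, add_zero, cross_zero_left, cross_zero_right, mul_eq_zero,
    hg.cross_edge_ne hw j, or_false] at h1 h2
  linarith

/-- An edge meeting a ray through a vertex away from that vertex crosses it properly. -/
theorem IsGeneric.cross_mul_neg (hw : IsSimpleCurve w) (hg : IsGeneric σ w) {j b : ZMod n}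
    {p : ℝ × ℝ} (hp : p ∈ edge w j) (hpb : p ≠ w b) (h : cross σ p (w b) = 0) :
    cross σ (w j) (w b) * cross σ (w (j + 1)) (w b) < 0 := by
  obtain ⟨s, t, hs, ht, hst, rfl⟩ := hp
  have hne := hg.cross_edge_ne hw j
  rw [cross_add_left, cross_smul_left, cross_smul_left] at h
  have hj : j ≠ b := by
    rintro rfl
    rw [cross_self, mul_zero, zero_add, cross_swap] at h
    have ht0 : t = 0 := by
      rcases mul_eq_zero.1 h with h | h
      · exact h
      · exact absurd (neg_eq_zero.1 h) hne
    obtain rfl : s = 1 := by linarith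
    simp [ht0] at hpb
  have hj' : j + 1 ≠ b := by
    rintro rfl
    rw [cross_self, mul_zero, add_zero] at h
    have hs0 : s = 0 := by
      rcases mul_eq_zero.1 h with h | h
      · exact h
      · exact absurd h hne
    obtain rfl : t = 1 := by linarith
    simp [hs0] at hpb
  have h1 := hg _ _ hj
  have h2 := hg _ _ hj'
  rcases lt_or_gt_of_ne h1 with h1 | h1 <;> rcases lt_or_gt_of_ne h2 with h2 | h2
  · exfalso
    rcases hs.eq_or_lt with rfl | hs
    · nlinarith
    · nlinarith [mul_nonneg ht (neg_pos.2 h2).le, mul_pos hs (neg_pos.2 h1)]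
  · exact mul_neg_of_neg_of_pos h1 h2
  · exact mul_neg_of_pos_of_neg h1 h2
  · exfalso
    rcases hs.eq_or_lt with rfl | hs
    · nlinarith
    · nlinarith [mul_nonneg ht h2.le, mul_pos hs h1]

theorem closure_openTri_subset (σ : ℝ) (z u : ℝ × ℝ) : closure (openTri σ z u) ⊆
    {p | 0 ≤ cross σ z p ∧ 0 ≤ cross σ p u ∧ cross σ z p + cross σ p u ≤ cross σ z u} := by
  refine closure_minimal (fun p hp => ⟨hp.1.le, hp.2.1.le, hp.2.2.le⟩) ?_
  exact (isClosed_le continuous_const (continuous_cross_right σ z)).inter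
    ((isClosed_le continuous_const (continuous_cross_left σ u)).inter
      (isClosed_le ((continuous_cross_right σ z).add (continuous_cross_left σ u))
        continuous_const))

/-- If an edge meeting the open triangle `0 z u` can leave it only across the side `0 u`, then
no edge meets a vertex-free part of the triangle that is cut off by a ray. -/
theorem not_cross_pos_of_mem_openTri
    {z : ℝ × ℝ} {u : ZMod n} (hzu : 0 < cross σ z (w u))
    (H : ∀ j, ∀ p ∈ edge w j, p ∈ openTri σ z (w u) → ∀ q ∈ edge w j,
      q ∉ segment ℝ 0 z ∧ (q ∈ segment ℝ z (w u) → q = w u))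
    {b : ℝ × ℝ} (hb : b = w u ∨ b ∈ openTri σ z (w u))
    (hv : ∀ i, w i ∈ openTri σ z (w u) → ¬ 0 < cross σ (w i) b)
    {j : ZMod n} {p : ℝ × ℝ} (hp : p ∈ edge w j) (hpT : p ∈ openTri σ z (w u)) :
    ¬ 0 < cross σ p b := by
  intro hpb
  set T : Set (ℝ × ℝ) := openTri σ z (w u) ∩ {p | 0 < cross σ p b} with hT
  have hTo : IsOpen T := (isOpen_openTri _ _ _).inter
    (isOpen_lt continuous_const (continuous_cross_left σ b))
  have hcl : closure T ⊆ closure (openTri σ z (w u)) ∩ {p | 0 ≤ cross σ p b} :=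
    (closure_inter_subset_inter_closure _ _).trans
      (inter_subset_inter_right _ (closure_minimal (fun q (hq : 0 < cross σ q b) => hq.le)
        (isClosed_le continuous_const (continuous_cross_left σ b))))
  have key : ∀ q, q ∉ T → segment ℝ p q ⊆ edge w j → cross σ q b ≤ 0 := by
    intro q hq hsub
    obtain ⟨r, hr, hrc, hrT⟩ := exists_mem_segment_closure_notMem hTo (p := p) ⟨hpT, hpb⟩ hq
    have hre := hsub hr
    obtain ⟨hr1, hr2⟩ := H j p hp hpT r hre
    obtain ⟨hrt, hrb⟩ := hcl hrc
    obtain ⟨c1, c2, c3⟩ := closure_openTri_subset _ _ _ hrt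
    have hrb' : 0 ≤ cross σ r b := hrb
    have hr0 : cross σ r b = 0 := by
      by_contra hne
      have hpos : 0 < cross σ r b := lt_of_le_of_ne hrb' (Ne.symm hne)
      have hid := cross_mul_cross σ z (w u) r b
      have c1' : 0 < cross σ z r := by
        refine lt_of_le_of_ne c1 fun h => hr1 (mem_segment_zero_of_cross hzu h.symm c2 ?_)
        linarith
      have c2' : 0 < cross σ r (w u) := by
        refine lt_of_le_of_ne c2 fun h => ?_
        rcases hb with rfl | hb
        · exact hne h.symm
        · rw [← h, zero_mul, zero_add, cross_swap σ b (w u)] at hid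
          nlinarith [mul_pos hzu hpos, mul_pos c1' hb.2.1]
      have c3' : cross σ z r + cross σ r (w u) < cross σ z (w u) := by
        refine lt_of_le_of_ne c3 fun h => ?_
        have := hr2 (mem_segment_of_cross hzu c1 c2 h)
        rw [this, cross_self] at c2'
        exact lt_irrefl _ c2'
      exact hrT ⟨⟨c1', c2', c3'⟩, hpos⟩
    obtain ⟨t, ht0, ht1, rfl⟩ := exists_of_mem_segment hr
    rw [cross_add_left, cross_smul_left, cross_sub_left] at hr0
    by_contra! hc
    rcases ht0.eq_or_lt with rfl | ht0
    · linarith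
    · nlinarith [mul_nonneg (sub_nonneg.2 ht1) hpb.le, mul_pos ht0 hc]
  obtain ⟨s, t, hs, ht, hst, rfl⟩ := id hp
  have hcv := convex_segment (𝕜 := ℝ) (w j) (w (j + 1))
  have h1 := key (w j) (fun h => hv j h.1 h.2) (hcv.segment_subset hp (left_mem_edge j))
  have h2 := key (w (j + 1)) (fun h => hv _ h.1 h.2) (hcv.segment_subset hp (right_mem_edge j))
  rw [cross_add_left, cross_smul_left, cross_smul_left] at hpb
  nlinarith [mul_nonneg hs (neg_nonneg.2 h1), mul_nonneg ht (neg_nonneg.2 h2)]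
end

theorem exists_add_smul_sub_mem {O : Set (ℝ × ℝ)} (hO : IsOpen O) {p : ℝ × ℝ} (hp : p ∈ O)
    (q : ℝ × ℝ) : ∃ ε : ℝ, 0 < ε ∧ ε ≤ 1 ∧ p + ε • (q - p) ∈ O := by
  have hc : Continuous fun ε : ℝ => p + ε • (q - p) := by fun_prop
  have h0 : (fun ε : ℝ => p + ε • (q - p)) ⁻¹' O ∈ nhds (0 : ℝ) :=
    (hO.preimage hc).mem_nhds (by simpa using hp)
  obtain ⟨δ, hδ, hball⟩ := Metric.mem_nhds_iff.1 h0
  refine ⟨min (δ / 2) 1, by positivity, min_le_right _ _, hball ?_⟩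
  rw [Metric.mem_ball, Real.dist_eq, sub_zero, abs_of_pos (by positivity)]
  exact (min_le_left _ _).trans_lt (by linarith)

section
variable {n : ℕ} {w : ZMod n → ℝ × ℝ} {σ : ℝ}

theorem edge_segment_subset {j : ZMod n} {p q : ℝ × ℝ} (hp : p ∈ edge w j) (hq : q ∈ edge w j) :
    segment ℝ p q ⊆ edge w j :=
  (convex_segment (w j) (w (j + 1))).segment_subset hp hq

theorem sees_of_no_vertex_right (hw : IsSimpleCurve w) (hg : IsGeneric σ w)
    {z : ℝ × ℝ} {u : ZMod n} (hzu : 0 < cross σ z (w u))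
    (H : ∀ j, ∀ p ∈ edge w j, p ∈ openTri σ z (w u) → ∀ q ∈ edge w j,
      q ∉ segment ℝ 0 z ∧ (q ∈ segment ℝ z (w u) → q = w u))
    {b : ZMod n} (hb : b = u ∨ w b ∈ openTri σ z (w u))
    (hv : ∀ i, w i ∈ openTri σ z (w u) → ¬ 0 < cross σ (w i) (w b)) : Sees w b := by
  have hb' : w b = w u ∨ w b ∈ openTri σ z (w u) := hb.imp_left (congrArg w)
  intro j p hp hpb
  by_contra hne
  obtain ⟨t, ht0, ht1, rfl⟩ := mem_segment_zero hpb
  have ht0 : 0 < t := by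
    refine lt_of_le_of_ne ht0 fun h => hg.zero_notMem_edge hw j ?_
    rwa [← h, zero_smul] at hp
  have ht1 : t < 1 := lt_of_le_of_ne ht1 fun h => hne (by rw [h, one_smul])
  have hc0 : cross σ (t • w b) (w b) = 0 := by rw [cross_smul_left, cross_self, mul_zero]
  have hneg := hg.cross_mul_neg hw hp hne hc0
  obtain ⟨q, hq, hqb⟩ : ∃ q ∈ edge w j, 0 < cross σ q (w b) := by
    rcases lt_or_ge 0 (cross σ (w j) (w b)) with h | h
    · exact ⟨_, left_mem_edge j, h⟩
    · exact ⟨_, right_mem_edge j, by nlinarith⟩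
  set p := t • w b with hpdef
  have hcr : ∀ ε : ℝ, cross σ (p + ε • (q - p)) (w b) = ε * cross σ q (w b) := by
    intro ε
    rw [cross_add_left, hc0, cross_smul_left, cross_sub_left, hc0]
    ring
  obtain ⟨ε, hε0, hε1, hεT⟩ : ∃ ε : ℝ, 0 < ε ∧ ε ≤ 1 ∧
      p + ε • (q - p) ∈ openTri σ z (w u) := by
    rcases hb with rfl | hb
    · have hO : IsOpen {p : ℝ × ℝ | 0 < cross σ z p ∧
          cross σ z p + cross σ p (w b) < cross σ z (w b)} :=
        (isOpen_lt continuous_const (continuous_cross_right σ z)).inter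
          (isOpen_lt ((continuous_cross_right σ z).add (continuous_cross_left σ _))
            continuous_const)
      obtain ⟨ε, h0, h1, h2, h3⟩ := exists_add_smul_sub_mem hO (p := p) (by
        refine ⟨?_, ?_⟩
        · rw [hpdef, cross_smul_right]; positivity
        · rw [hc0, hpdef, cross_smul_right]; nlinarith) q
      exact ⟨ε, h0, h1, h2, by rw [hcr]; positivity, h3⟩
    · refine exists_add_smul_sub_mem (isOpen_openTri _ _ _) ?_ q
      obtain ⟨h1, h2, h3⟩ := hb
      refine ⟨?_, ?_, ?_⟩ <;> simp only [hpdef, cross_smul_right, cross_smul_left]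
      · positivity
      · positivity
      · nlinarith
  refine not_cross_pos_of_mem_openTri hzu H hb' hv
    (edge_segment_subset hp hq (add_smul_sub_mem_segment p q hε0.le hε1)) hεT ?_
  rw [hcr]
  positivity

/-- Sweeping the triangle `0 z u` from the side `0 z`, one finds a visible vertex, either `u` or
one whose neighbours lie both further along the sweep. -/
theorem exists_sees_of_openTri (hw : IsSimpleCurve w) (hg : IsGeneric σ w)
    {z : ℝ × ℝ} {u : ZMod n} (hzu : 0 < cross σ z (w u))
    (H : ∀ j, ∀ p ∈ edge w j, p ∈ openTri σ z (w u) → ∀ q ∈ edge w j,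
      q ∉ segment ℝ 0 z ∧ (q ∈ segment ℝ z (w u) → q = w u)) :
    ∃ b, Sees w b ∧ (b = u ∨ (w b ∈ openTri σ z (w u) ∧
      0 < cross σ (w b) (w (b + 1)) ∧ 0 < cross σ (w b) (w (b - 1)))) := by
  have : NeZero n := ⟨by have := hw.three_le; omega⟩
  classical
  by_cases hne : ∃ i, w i ∈ openTri σ z (w u)
  · obtain ⟨b, hbS, hbmin⟩ := (Finset.univ.filter fun i => w i ∈ openTri σ z (w u)).exists_min_image
      (fun i => cross σ z (w i) / cross σ (w i) (w u)) (by
        obtain ⟨i, hi⟩ := hne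
        exact ⟨i, by simpa using hi⟩)
    simp only [Finset.mem_filter, Finset.mem_univ, true_and] at hbS hbmin
    have hv : ∀ i, w i ∈ openTri σ z (w u) → ¬ 0 < cross σ (w i) (w b) := by
      intro i hi hpos
      have h := hbmin i hi
      rw [div_le_div_iff₀ hbS.2.1 hi.2.1] at h
      have hid := cross_mul_cross σ z (w u) (w i) (w b)
      rw [cross_swap σ (w b) (w u)] at hid
      nlinarith [mul_pos hzu hpos]
    refine ⟨b, sees_of_no_vertex_right hw hg hzu H (Or.inr hbS) hv, Or.inr ⟨hbS, ?_⟩⟩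
    have nb : ∀ c j, c ≠ b → w b ∈ edge w j → w c ∈ edge w j → 0 < cross σ (w b) (w c) := by
      intro c j hcb hbj hcj
      refine lt_of_le_of_ne (not_lt.1 fun hlt => ?_) (hg _ _ hcb.symm).symm
      rw [cross_swap, neg_lt_zero] at hlt
      obtain ⟨ε, hε0, hε1, hεT⟩ := exists_add_smul_sub_mem (isOpen_openTri σ z (w u)) hbS (w c)
      refine not_cross_pos_of_mem_openTri hzu H (Or.inr hbS) hv
        (edge_segment_subset hbj hcj (add_smul_sub_mem_segment _ _ hε0.le hε1)) hεT ?_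
      rw [cross_add_left, cross_smul_left, cross_sub_left, cross_self]
      nlinarith
    refine ⟨nb _ b (hw.succ_ne b) (left_mem_edge b) (right_mem_edge b), nb _ (b - 1) ?_ ?_ ?_⟩
    · intro h
      exact hw.succ_ne b (by rw [sub_eq_iff_eq_add] at h; exact h.symm)
    · simpa using right_mem_edge (w := w) (b - 1)
    · exact left_mem_edge _
  · push Not at hne
    exact ⟨u, sees_of_no_vertex_right hw hg hzu H (Or.inl rfl) fun i hi => absurd hi (hne i),
      Or.inl rfl⟩
end

section
variable {n : ℕ} {w : ZMod n → ℝ × ℝ} {σ : ℝ}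

theorem smul_ne_of_cross {p q : ℝ × ℝ} (h : cross σ p q ≠ 0) : σ ≠ 0 := by
  rintro rfl
  simp [cross] at h

theorem IsGeneric.congr {τ : ℝ} (hg : IsGeneric σ w) (hτ : τ ≠ 0) : IsGeneric τ w := by
  intro i j hij h
  refine hg i j hij ?_
  simp only [cross, mul_eq_zero, hτ, false_or] at h ⊢
  exact Or.inr h

/-- Some vertex is visible. -/
theorem exists_sees (hw : IsSimpleCurve w) (hg : IsGeneric σ w) : ∃ a, Sees w a := by
  have : NeZero n := ⟨by have := hw.three_le; omega⟩
  have hcpt : IsCompact (⋃ j, edge w j) := isCompact_iUnion fun j => by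
    rw [edge, segment_eq_image ℝ]
    exact isCompact_Icc.image (by fun_prop)
  obtain ⟨z, hz, hmin⟩ := hcpt.exists_isMinOn ⟨_, mem_iUnion.2 ⟨0, left_mem_edge 0⟩⟩
    continuous_norm.continuousOn
  obtain ⟨e, he⟩ := mem_iUnion.1 hz
  have hz0 : z ≠ 0 := by
    rintro rfl
    exact hg.zero_notMem_edge hw e he
  have hnear : ∀ j, ∀ p ∈ edge w j, p ∈ segment ℝ 0 z → p = z := by
    intro j p hp hpz
    obtain ⟨t, ht0, ht1, rfl⟩ := mem_segment_zero hpz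
    have h : ‖z‖ ≤ ‖t • z‖ := hmin (mem_iUnion.2 ⟨j, hp⟩)
    rw [norm_smul, Real.norm_of_nonneg ht0] at h
    have hzp := norm_pos_iff.2 hz0
    obtain rfl : t = 1 := by nlinarith
    rw [one_smul]
  by_cases hzv : ∃ i, z = w i
  · obtain ⟨i, rfl⟩ := hzv
    exact ⟨i, hnear⟩
  push Not at hzv
  obtain ⟨s, t, hs, ht, hst, hz⟩ := id he
  have hs0 : 0 < s := by
    refine hs.lt_of_ne ?_
    rintro rfl
    obtain rfl : t = 1 := by linarith
    exact hzv (e + 1) (by simp [← hz])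
  have ht0 : 0 < t := by
    refine ht.lt_of_ne ?_
    rintro rfl
    obtain rfl : s = 1 := by linarith
    exact hzv e (by simp [← hz])
  obtain ⟨τ, hτ⟩ : ∃ τ : ℝ, 0 < cross τ (w e) (w (e + 1)) := by
    have h := hg.cross_edge_ne hw e
    rcases lt_or_gt_of_ne h with h | h
    · exact ⟨-σ, by simp only [cross] at h ⊢; linarith⟩
    · exact ⟨σ, h⟩
  have hg' : IsGeneric τ w := hg.congr (smul_ne_of_cross hτ.ne')
  have hzu : cross τ z (w (e + 1)) = s * cross τ (w e) (w (e + 1)) := by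
    rw [← hz, cross_add_left, cross_smul_left, cross_smul_left, cross_self]; ring
  have hzu0 : 0 < cross τ z (w (e + 1)) := by rw [hzu]; positivity
  obtain ⟨b, hb, -⟩ := exists_sees_of_openTri hw hg' hzu0 (by
    intro j p hp hpT q hq
    have hje : e ≠ j := by
      rintro rfl
      obtain ⟨s', t', hs', ht', hst', rfl⟩ := hp
      have h3 := hpT.2.2
      have : cross τ z (w e) = - (t * cross τ (w e) (w (e + 1))) := by
        rw [← hz, cross_add_left, cross_smul_left, cross_smul_left, cross_self,
          cross_swap τ (w e)]; ring
      rw [cross_add_right, cross_add_left, cross_smul_left, cross_smul_left, cross_smul_right,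
        cross_smul_right, cross_self, hzu, this] at h3
      obtain rfl : s' = 1 - t' := by linarith
      obtain rfl : s = 1 - t := by linarith
      nlinarith
    constructor
    · intro hq0
      have := hnear j q hq hq0
      subst this
      rcases hw.eq_vertex_of_mem_of_mem hje he hq with h | h
      · exact hzv _ h.2
      · exact hzv _ h.2
    · intro hqs
      have hqe : q ∈ edge w e := edge_segment_subset he (right_mem_edge e) hqs
      rcases hw.eq_vertex_of_mem_of_mem hje hqe hq with h | h
      · rw [h.2, h.1]
      · exfalso
        obtain ⟨r, hr0, hr1, hr⟩ := exists_of_mem_segment hqs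
        have h1 := congrArg (fun p => cross τ p (w (e + 1))) hr
        simp only [h.2] at h1
        rw [cross_add_left, cross_smul_left, cross_sub_left, cross_self, hzu] at h1
        nlinarith [mul_nonneg hr0 hs])
  exact ⟨b, hb⟩

/-- A vertex that is visible and both of whose neighbours lie on the positive side of the ray
through it. -/
def IsTip (σ : ℝ) (w : ZMod n → ℝ × ℝ) (b : ZMod n) : Prop :=
  Sees w b ∧ 0 < cross σ (w b) (w (b + 1)) ∧ 0 < cross σ (w b) (w (b - 1))

theorem cross_lt_of_mem_openTri {a u u' p : ℝ × ℝ} (hp : p ∈ segment ℝ a u')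
    (hpT : p ∈ openTri σ a u) :
    0 < cross σ a u' ∧ cross σ a u' + cross σ u' u < cross σ a u := by
  obtain ⟨t, h0, h1, rfl⟩ := exists_of_mem_segment hp
  obtain ⟨c1, c2, c3⟩ := hpT
  rw [cross_add_right, cross_smul_right, cross_sub_right, cross_self] at c1 c3
  rw [cross_add_left, cross_smul_left, cross_sub_left] at c3
  have ht : 0 < t := by
    refine h0.lt_of_ne ?_
    rintro rfl
    linarith
  constructor
  · by_contra! hc
    nlinarith
  · by_contra! hc
    nlinarith

theorem exists_sees_of_neighbours (hw : IsSimpleCurve w) (hg : IsGeneric σ w) {a u u' : ZMod n}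
    (ha : Sees w a) (hu : (u = a + 1 ∧ u' = a - 1) ∨ (u = a - 1 ∧ u' = a + 1))
    (hpos : 0 < cross σ (w a) (w u))
    (hfront : ∀ p ∈ segment ℝ (w a) (w u'), p ∉ openTri σ (w a) (w u)) :
    ∃ b, Sees w b ∧ (b = u ∨ (w b ∈ openTri σ (w a) (w u) ∧
      0 < cross σ (w b) (w (b + 1)) ∧ 0 < cross σ (w b) (w (b - 1)))) := by
  refine exists_sees_of_openTri hw hg hpos fun j p hp hpT q hq => ?_
  have hself : ∀ p ∈ segment ℝ (w a) (w u), p ∉ openTri σ (w a) (w u) := by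
    intro p hp hpT
    have := (cross_lt_of_mem_openTri hp hpT).2
    rw [cross_self] at this
    linarith
  have hea : edge w (a - 1) = segment ℝ (w a) (w (a - 1)) := by
    rw [edge, segment_symm, sub_add_cancel]
  have hboth : (∀ p ∈ edge w a, p ∉ openTri σ (w a) (w u)) ∧
      (∀ p ∈ edge w (a - 1), p ∉ openTri σ (w a) (w u)) := by
    rw [hea]
    rcases hu with ⟨rfl, rfl⟩ | ⟨rfl, rfl⟩
    · exact ⟨hself, hfront⟩
    · exact ⟨hfront, hself⟩
  have hja : a ≠ j := by
    rintro rfl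
    exact hboth.1 p hp hpT
  have hja' : a ≠ j + 1 := by
    rintro rfl
    exact hboth.2 p (by simpa using hp) hpT
  constructor
  · intro hq0
    rw [ha j q hq hq0] at hq
    rcases hw.eq_or_eq_of_mem_edge hq with h | h
    · exact hja h
    · exact hja' h
  · intro hqs
    rcases hu with ⟨rfl, rfl⟩ | ⟨rfl, rfl⟩
    · rcases hw.eq_vertex_of_mem_of_mem hja hqs hq with h | h
      · rw [h.2, h.1]
      · exact absurd h.1 hja'
    · rw [← hea] at hqs
      rcases hw.eq_vertex_of_mem_of_mem (fun h => hja' (by rw [← h]; ring)) hqs hq with h | h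
      · exact absurd (by rw [h.1]; ring) hja
      · exact h.2

/-- From a visible vertex with a neighbour on its positive side one finds a tip inside the triangle
spanned with that neighbour. -/
theorem exists_isTip_of_sees (hw : IsSimpleCurve w) (hg : IsGeneric σ w)
    (hI : ∀ i, Sees w i → ¬ Sees w (i + 1)) {a u : ZMod n}
    (ha : Sees w a) (hu : u = a + 1 ∨ u = a - 1) (hpos : 0 < cross σ (w a) (w u)) :
    ∃ u b, 0 < cross σ (w a) (w u) ∧ IsTip σ w b ∧ w b ∈ openTri σ (w a) (w u) := by
  obtain ⟨u', huu'⟩ : ∃ u', (u = a + 1 ∧ u' = a - 1) ∨ (u = a - 1 ∧ u' = a + 1) := by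
    rcases hu with rfl | rfl
    · exact ⟨_, Or.inl ⟨rfl, rfl⟩⟩
    · exact ⟨_, Or.inr ⟨rfl, rfl⟩⟩
  have key : ∀ u u' : ZMod n, ((u = a + 1 ∧ u' = a - 1) ∨ (u = a - 1 ∧ u' = a + 1)) →
      0 < cross σ (w a) (w u) → (∀ p ∈ segment ℝ (w a) (w u'), p ∉ openTri σ (w a) (w u)) →
      ∃ u b, 0 < cross σ (w a) (w u) ∧ IsTip σ w b ∧ w b ∈ openTri σ (w a) (w u) := by
    intro u u' hu hpos hf
    obtain ⟨b, hb, rfl | ⟨h1, h2⟩⟩ := exists_sees_of_neighbours hw hg ha hu hpos hf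
    · exfalso
      rcases hu with ⟨rfl, -⟩ | ⟨rfl, -⟩
      · exact hI a ha hb
      · exact hI _ hb (by simpa using ha)
    · exact ⟨u, b, hpos, ⟨hb, h2⟩, h1⟩
  by_cases hf : ∀ p ∈ segment ℝ (w a) (w u'), p ∉ openTri σ (w a) (w u)
  · exact key u u' huu' hpos hf
  · push Not at hf
    obtain ⟨p, hp, hpT⟩ := hf
    obtain ⟨h1, h2⟩ := cross_lt_of_mem_openTri hp hpT
    refine key u' u (huu'.symm.imp And.symm And.symm) h1 fun q hq hqT => ?_
    have h3 := (cross_lt_of_mem_openTri hq hqT).2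
    rw [cross_swap σ (w u') (w u)] at h3
    linarith

/-- A tip inside a triangle spanned by the origin and two vertices. -/
def IsInnerTip (σ : ℝ) (w : ZMod n → ℝ × ℝ) (b : ZMod n) : Prop :=
  IsTip σ w b ∧ ∃ a u, 0 < cross σ (w a) (w u) ∧ w b ∈ openTri σ (w a) (w u)

/-- If no two consecutive vertices are visible, then for a suitable orientation every inner tip
is followed by another one, and there is an inner tip. -/
theorem exists_isInnerTip (hw : IsSimpleCurve w) (hg : IsGeneric σ w)
    (hI : ∀ i, Sees w i → ¬ Sees w (i + 1)) :
    ∃ τ : ℝ, IsGeneric τ w ∧ (∃ b, IsInnerTip τ w b) ∧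
      ∀ b, IsInnerTip τ w b → ∃ b', IsInnerTip τ w b' ∧ 0 < cross τ (w b) (w b') := by
  obtain ⟨a, ha⟩ := exists_sees hw hg
  obtain ⟨τ, hτ⟩ : ∃ τ : ℝ, 0 < cross τ (w a) (w (a + 1)) := by
    have h := hg.cross_edge_ne hw a
    rcases lt_or_gt_of_ne h with h | h
    · exact ⟨-σ, by simp only [cross] at h ⊢; linarith⟩
    · exact ⟨σ, h⟩
  have hg' : IsGeneric τ w := hg.congr (smul_ne_of_cross hτ.ne')
  refine ⟨τ, hg', ?_, ?_⟩
  · obtain ⟨u, b, h1, h2, h3⟩ := exists_isTip_of_sees hw hg' hI ha (Or.inl rfl) hτ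
    exact ⟨b, h2, a, u, h1, h3⟩
  · intro b hb
    obtain ⟨u, b', h1, h2, h3⟩ := exists_isTip_of_sees hw hg' hI hb.1.1 (Or.inl rfl) hb.1.2.1
    exact ⟨b', ⟨h2, b, u, h1, h3⟩, h3.1⟩

end

theorem zero_mem_convexHull_of_cross {ι : Type*} [Finite ι] {σ : ℝ} {w : ι → ℝ × ℝ} {S : Set ι}
    (hne : S.Nonempty) (hS : ∀ b ∈ S, ∃ b' ∈ S, 0 < cross σ (w b) (w b')) :
    (0 : ℝ × ℝ) ∈ convexHull ℝ (w '' S) := by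
  by_contra h0
  have hfin : (w '' S).Finite := S.toFinite.image w
  obtain ⟨f, c, hf0, hf⟩ := geometric_hahn_banach_point_closed (convex_convexHull ℝ (w '' S))
    (hfin.isClosed_convexHull (𝕜 := ℝ)) h0
  rw [map_zero] at hf0
  have hpos : ∀ b ∈ S, 0 < f (w b) := fun b hb =>
    hf0.trans (hf _ (subset_convexHull ℝ _ (mem_image_of_mem w hb)))
  have hfe : ∀ p : ℝ × ℝ, f p = p.1 * f (1, 0) + p.2 * f (0, 1) := by
    intro p
    rw [← smul_eq_mul, ← smul_eq_mul, ← map_smul, ← map_smul, ← map_add]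
    congr 1
    ext <;> simp
  set α := f (1, 0)
  set β := f (0, 1)
  obtain ⟨b, hb, hmax⟩ := S.toFinite.exists_maximalFor
    (fun b => σ * (α * (w b).2 - β * (w b).1) / f (w b)) S hne
  obtain ⟨b', hb', hc⟩ := hS b hb
  have h1 : (σ * (α * (w b').2 - β * (w b').1) / f (w b')) ≤
      σ * (α * (w b).2 - β * (w b).1) / f (w b) := by
    by_contra! h
    exact absurd (hmax hb' h.le) (not_le.2 h)
  rw [div_le_div_iff₀ (hpos b' hb') (hpos b hb)] at h1
  have h2 := hpos b hb
  have h3 : 0 < α ^ 2 + β ^ 2 := by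
    by_contra! h
    have ha : α = 0 := by nlinarith [sq_nonneg α, sq_nonneg β]
    have hb : β = 0 := by nlinarith [sq_nonneg α, sq_nonneg β]
    rw [hfe, ha, hb] at h2
    simp at h2
  rw [hfe (w b), hfe (w b')] at h1
  have := mul_pos h3 hc
  unfold cross at this
  nlinarith

theorem forall_mem_of_zmod_interval {n : ℕ} (hn : 3 ≤ n) {M : Set (ZMod n)} {u j₀ : ZMod n}
    (h₀ : j₀ ∈ M) (hu : j₀ ≠ u) (hu' : j₀ ≠ u - 1)
    (hup : ∀ j ∈ M, j ≠ u - 2 → j + 1 ∈ M) (hdown : ∀ j ∈ M, j ≠ u + 1 → j - 1 ∈ M) :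
    ∀ j, j ≠ u → j ≠ u - 1 → j ∈ M := by
  have : NeZero n := ⟨by omega⟩
  have key : ∀ j : ZMod n, j ≠ u → j ≠ u - 1 → ∃ m : ℕ, m ≤ n - 3 ∧ j = u + 1 + (m : ZMod n) := by
    intro j h1 h2
    refine ⟨(j - u - 1).val, ?_, by simp⟩
    have hlt := ZMod.val_lt (j - u - 1)
    by_contra! hc
    have hcast : (((j - u - 1).val : ℕ) : ZMod n) = j - u - 1 := by simp
    obtain h | h : (j - u - 1).val + 1 = n ∨ (j - u - 1).val + 2 = n := by omega
    · have h' := congrArg (Nat.cast : ℕ → ZMod n) h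
      rw [Nat.cast_add, hcast] at h'
      simp only [Nat.cast_one, sub_add_cancel, CharP.cast_eq_zero, sub_eq_zero] at h'
      exact h1 h'
    · have h' := congrArg (Nat.cast : ℕ → ZMod n) h
      rw [Nat.cast_add, hcast] at h'
      simp only [Nat.cast_ofNat, CharP.cast_eq_zero] at h'
      exact h2 (by linear_combination h')
  have hne : ∀ m : ℕ, 0 < m → m < n → (m : ZMod n) ≠ 0 := by
    intro m h1 h2 h
    rw [ZMod.natCast_eq_zero_iff] at h
    exact absurd (Nat.le_of_dvd h1 h) (by omega)
  have up : ∀ m : ℕ, m < n - 3 → u + 1 + (m : ZMod n) ∈ M → u + 1 + ((m + 1 : ℕ) : ZMod n) ∈ M := by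
    intro m hm h
    have := hup _ h (fun he => hne (m + 3) (by omega) (by omega) (by
      push_cast; linear_combination he))
    convert this using 1
    push_cast; ring
  have down : ∀ m : ℕ, m < n - 3 → u + 1 + ((m + 1 : ℕ) : ZMod n) ∈ M →
      u + 1 + (m : ZMod n) ∈ M := by
    intro m hm h
    have := hdown _ h (fun he => hne (m + 1) (by omega) (by omega) (by linear_combination he))
    convert this using 1
    push_cast; ring
  obtain ⟨m₀, hm₀, rfl⟩ := key j₀ hu hu'
  have h0 : u + 1 + ((0 : ℕ) : ZMod n) ∈ M := by
    clear hu hu'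
    induction m₀ with
    | zero => exact h₀
    | succ m ih => exact ih (by omega) (down m (by omega) h₀)
  have hall : ∀ m : ℕ, m ≤ n - 3 → u + 1 + (m : ZMod n) ∈ M := by
    intro m
    induction m with
    | zero => exact fun _ => h0
    | succ m ih => exact fun hm => up m (by omega) (ih (by omega))
  intro j h1 h2
  obtain ⟨m, hm, rfl⟩ := key j h1 h2
  exact hall m hm

/-- A preconnected set that misses the frontier of `P` and is not inside `P` misses `P`. -/
theorem _root_.IsPreconnected.disjoint_of_frontier {α : Type*} [TopologicalSpace α]
    {C P : Set α} (hC : IsPreconnected C) (hP : IsClosed P) (hfr : ∀ x ∈ C, x ∉ frontier P)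
    {p : α} (hp : p ∈ C) (hpP : p ∉ P) {q : α} (hq : q ∈ C) : q ∉ P := by
  intro hqP
  obtain ⟨r, hr, hrc, hrP⟩ := hC.exists_mem_closure_notMem hP.isOpen_compl hp hpP hq
    (fun h => h hqP)
  refine hfr r hr ?_
  rw [frontier_eq_closure_inter_closure]
  exact ⟨subset_closure (not_not.1 hrP), hrc⟩

/-- The non-convex quadrilateral `0 a u b` with reflex vertex `b`. -/
def dart (σ : ℝ) (a u b : ℝ × ℝ) : Set (ℝ × ℝ) :=
  openTri σ a u ∩ ({p | cross σ b p < 0} ∪ {p | cross σ b u < cross σ b p + cross σ p u})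

theorem isOpen_dart (σ : ℝ) (a u b : ℝ × ℝ) : IsOpen (dart σ a u b) :=
  (isOpen_openTri _ _ _).inter ((isOpen_lt (continuous_cross_right σ b) continuous_const).union
    (isOpen_lt continuous_const ((continuous_cross_right σ b).add (continuous_cross_left σ u))))

theorem closure_dart_subset (σ : ℝ) (a u b : ℝ × ℝ) : closure (dart σ a u b) ⊆
    {p | 0 ≤ cross σ a p ∧ 0 ≤ cross σ p u ∧ cross σ a p + cross σ p u ≤ cross σ a u ∧
      (cross σ b p ≤ 0 ∨ cross σ b u ≤ cross σ b p + cross σ p u)} := by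
  intro p hp
  have h := closure_inter_subset_inter_closure _ _ hp
  obtain ⟨h1, h2, h3⟩ := closure_openTri_subset _ _ _ h.1
  refine ⟨h1, h2, h3, ?_⟩
  refine closure_minimal (t := {p | cross σ b p ≤ 0 ∨ cross σ b u ≤ cross σ b p + cross σ p u})
    ?_ ?_ h.2
  · exact fun q hq => hq.imp le_of_lt le_of_lt
  · exact (isClosed_le (continuous_cross_right σ b) continuous_const).union
      (isClosed_le continuous_const ((continuous_cross_right σ b).add (continuous_cross_left σ u)))

theorem convex_openTri (σ : ℝ) (a u : ℝ × ℝ) : Convex ℝ (openTri σ a u) := by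
  rintro p ⟨p1, p2, p3⟩ q ⟨q1, q2, q3⟩ s t hs ht hst
  obtain rfl : t = 1 - s := by linarith
  simp only [openTri, mem_ofPred_eq, cross_add_left, cross_add_right, cross_smul_left,
    cross_smul_right]
  rcases hs.eq_or_lt with rfl | hs
  · simpa using ⟨q1, q2, q3⟩
  · refine ⟨by nlinarith [mul_pos hs p1, mul_nonneg ht q1.le],
      by nlinarith [mul_pos hs p2, mul_nonneg ht q2.le],
      by nlinarith [mul_pos hs (sub_pos.2 p3), mul_nonneg ht (sub_pos.2 q3).le]⟩

theorem isPreconnected_dart {σ : ℝ} {a u b : ℝ × ℝ} (h1 : 0 < cross σ a b) (h2 : 0 < cross σ b u)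
    (h3 : cross σ a b + cross σ b u < cross σ a u) : IsPreconnected (dart σ a u b) := by
  have c1 : Convex ℝ (openTri σ a u ∩ {p | cross σ b p < 0}) := by
    refine (convex_openTri _ _ _).inter (convex_halfSpace_lt ⟨?_, ?_⟩ 0)
    · exact fun p q => cross_add_right σ p q b
    · exact fun t p => cross_smul_right σ t p b
  have c2 : Convex ℝ (openTri σ a u ∩ {p | cross σ b u < cross σ b p + cross σ p u}) := by
    refine (convex_openTri _ _ _).inter (convex_halfSpace_gt ⟨?_, ?_⟩ _)
    · intro p q; rw [cross_add_right, cross_add_left]; ring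
    · intro t p; rw [cross_smul_right, cross_smul_left, smul_eq_mul]; ring
  rw [dart, inter_union_distrib_left]
  set α := cross σ a b with hα
  set β := cross σ b u
  set γ := cross σ a u
  obtain ⟨ε, hε0, hε⟩ : ∃ ε : ℝ, 0 < ε ∧ ε * (3 * α + β) = α :=
    ⟨α / (3 * α + β), by positivity, by field_simp⟩
  have hε2 : 0 < 1 - 2 * ε := by
    by_contra! h
    nlinarith
  set p := (1 - 2 * ε) • a + ε • b + ε • u with hp
  have e1 : cross σ a p = ε * α + ε * γ := by
    simp only [hp, cross_add_right, cross_smul_right, cross_self]; ring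
  have e2 : cross σ p u = (1 - 2 * ε) * γ + ε * β := by
    simp only [hp, cross_add_left, cross_smul_left, cross_self]; ring
  have e3 : cross σ b p = - (1 - 2 * ε) * α + ε * β := by
    simp only [hp, cross_add_right, cross_smul_right, cross_self, cross_swap σ a b]; ring
  have hT : p ∈ openTri σ a u := by
    refine ⟨?_, ?_, ?_⟩
    · rw [e1]; nlinarith
    · rw [e2]; nlinarith
    · rw [e1, e2]; nlinarith
  refine c1.isPreconnected.union p ⟨hT, ?_⟩ ⟨hT, ?_⟩ c2.isPreconnected
  · change cross σ b p < 0
    rw [e3]; nlinarith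
  · change β < cross σ b p + cross σ p u
    rw [e3, e2]; nlinarith

section
variable {n : ℕ} {w : ZMod n → ℝ × ℝ} {σ : ℝ}

/-- A visible vertex that lies in the angle spanned by the two ends of an edge not containing it
lies on the near side of the edge. -/
theorem Sees.mem_openTri (hw : IsSimpleCurve w) {a u b : ZMod n} (hb : Sees w b) {e : ZMod n}
    (he : segment ℝ (w a) (w u) = edge w e) (hbe : b ≠ e) (hbe' : b ≠ e + 1)
    (h1 : 0 < cross σ (w a) (w b)) (h2 : 0 < cross σ (w b) (w u))
    (h3 : 0 < cross σ (w a) (w u)) : w b ∈ openTri σ (w a) (w u) := by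
  refine ⟨h1, h2, ?_⟩
  by_contra! hc
  set s := cross σ (w a) (w b) + cross σ (w b) (w u) with hs
  have hs0 : 0 < s := by positivity
  have hmem : (cross σ (w a) (w u) / s) • w b ∈ segment ℝ (w a) (w u) := by
    refine mem_segment_of_cross h3 ?_ ?_ ?_
    · rw [cross_smul_right]; positivity
    · rw [cross_smul_left]; positivity
    · rw [cross_smul_right, cross_smul_left, ← mul_add, ← hs, div_mul_cancel₀ _ hs0.ne']
  rw [he] at hmem
  have := hb e _ hmem (smul_mem_segment_zero _ (by positivity) ((div_le_one hs0).2 hc))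
  rw [this] at hmem
  rcases hw.eq_or_eq_of_mem_edge hmem with h | h
  · exact hbe h
  · exact hbe' h

/-- An edge that is not at `u` can leave the dart only through the vertices `a` and `b`. -/
theorem eq_or_eq_of_mem_closure_dart (hw : IsSimpleCurve w) {a u b : ZMod n}
    (ha : Sees w a) (hb : Sees w b)
    (hab : (a = u - 1 ∧ b = u + 1) ∨ (a = u + 1 ∧ b = u - 1))
    (hau : 0 < cross σ (w a) (w u)) (hbu : 0 < cross σ (w b) (w u))
    {j : ZMod n} (hj : j ≠ u) (hj' : j ≠ u - 1) {r : ℝ × ℝ} (hr : r ∈ edge w j)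
    (hrc : r ∈ closure (dart σ (w a) (w u) (w b))) (hrd : r ∉ dart σ (w a) (w u) (w b)) :
    r = w a ∨ r = w b := by
  obtain ⟨c1, c2, c3, c4⟩ := closure_dart_subset _ _ _ _ hrc
  have hju : w u ∉ edge w j := fun h => by
    rcases hw.eq_or_eq_of_mem_edge h with h | h
    · exact hj h.symm
    · exact hj' (by rw [h]; ring)
  have hside : ∀ c : ZMod n, (c = u - 1 ∨ c = u + 1) → r ∈ segment ℝ (w c) (w u) → r = w c := by
    intro c hc hrs
    rcases hc with rfl | rfl
    · have hrs' : r ∈ edge w (u - 1) := by rwa [edge, sub_add_cancel]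
      rcases hw.eq_vertex_of_mem_of_mem hj'.symm hrs' hr with h | h
      · exact absurd (by rw [h.1]; ring) hj
      · exact h.2
    · rw [segment_symm] at hrs
      rcases hw.eq_vertex_of_mem_of_mem hj.symm hrs hr with h | h
      · rw [h.2, h.1]
      · exact absurd (by rw [h.1]; ring) hj'
  have hat : r ∈ segment ℝ (w a) (w u) → r = w a := hside a (hab.imp And.left And.left)
  have hbt : r ∈ segment ℝ (w b) (w u) → r = w b := hside b (hab.symm.imp And.right And.right)
  rcases c1.eq_or_lt with d1 | d1
  · exact Or.inl (ha j r hr (mem_segment_zero_of_cross hau d1.symm c2 (by linarith)))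
  rcases c3.eq_or_lt with d3 | d3
  · exact Or.inl (hat (mem_segment_of_cross hau c1 c2 d3))
  have hid := cross_mul_cross σ (w a) (w u) (w b) r
  rw [cross_swap σ r (w u)] at hid
  rcases c2.eq_or_lt with d2 | d2
  · exfalso
    rw [← d2, neg_zero, mul_zero, add_zero] at hid
    rcases c4 with c4 | c4
    · nlinarith [mul_pos hbu d1]
    · rw [← d2, add_zero] at c4
      nlinarith
  right
  have hnd : ¬ (cross σ (w b) r < 0) ∧
      ¬ (cross σ (w b) (w u) < cross σ (w b) r + cross σ r (w u)) := by
    constructor <;> intro h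
    · exact hrd ⟨⟨d1, d2, d3⟩, Or.inl h⟩
    · exact hrd ⟨⟨d1, d2, d3⟩, Or.inr h⟩
  obtain ⟨n1, n2⟩ := hnd
  push Not at n1 n2
  rcases c4 with c4 | c4
  · have c5 := le_antisymm c4 n1
    exact hb j r hr (mem_segment_zero_of_cross hbu c5 d2.le (by linarith))
  · exact hbt (mem_segment_of_cross hbu n1 d2.le (le_antisymm n2 c4))

end

section
variable {n : ℕ} {w : ZMod n → ℝ × ℝ} {σ : ℝ}

theorem notMem_dart_of_mem_segment_left {a u b p : ℝ × ℝ} (hp : p ∈ segment ℝ a u) :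
    p ∉ dart σ a u b := by
  intro h
  have := (cross_lt_of_mem_openTri hp h.1).2
  rw [cross_self] at this
  linarith

theorem notMem_dart_of_mem_segment_right {a u b p : ℝ × ℝ} (hbu : 0 < cross σ b u)
    (hp : p ∈ segment ℝ b u) : p ∉ dart σ a u b := by
  rintro ⟨-, h⟩
  obtain ⟨t, h0, h1, rfl⟩ := exists_of_mem_segment hp
  simp only [mem_union, mem_ofPred_eq, cross_add_right, cross_smul_right, cross_sub_right,
    cross_add_left, cross_smul_left, cross_sub_left, cross_self] at h
  rcases h with h | h
  · nlinarith
  · linarith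

/-- If an edge not at `u` meets the dart, then so do its neighbours, unless they are at `u`. -/
theorem mem_dart_of_edge (hw : IsSimpleCurve w) {a u b : ZMod n}
    (ha : Sees w a) (hb : Sees w b)
    (hab : (a = u - 1 ∧ b = u + 1) ∨ (a = u + 1 ∧ b = u - 1))
    (hau : 0 < cross σ (w a) (w u)) (hbu : 0 < cross σ (w b) (w u))
    {j : ZMod n} (hj : j ≠ u) (hj' : j ≠ u - 1) {p : ℝ × ℝ} (hp : p ∈ edge w j)
    (hpd : p ∈ dart σ (w a) (w u) (w b)) {c c' : ZMod n}
    (hc : (c = j ∧ c' = j + 1) ∨ (c = j + 1 ∧ c' = j)) :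
    w c ∈ dart σ (w a) (w u) (w b) ∨ c = u - 1 ∨ c = u + 1 := by
  by_contra! hcon
  obtain ⟨hcd, hc1, hc2⟩ := hcon
  have hcj : w c ∈ edge w j := by
    rcases hc with ⟨rfl, -⟩ | ⟨rfl, -⟩
    · exact left_mem_edge _
    · exact right_mem_edge _
  have hedge : edge w j = segment ℝ (w c') (w c) := by
    rcases hc with ⟨rfl, rfl⟩ | ⟨rfl, rfl⟩
    · rw [edge, segment_symm]
    · rfl
  obtain ⟨r, hr, hrc, hrd⟩ := exists_mem_segment_closure_notMem (isOpen_dart _ _ _ _) hpd hcd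
  have hrj := edge_segment_subset hp hcj hr
  have hna : w a ∉ dart σ (w a) (w u) (w b) :=
    notMem_dart_of_mem_segment_left (left_mem_segment _ _ _)
  have hnb : w b ∉ dart σ (w a) (w u) (w b) :=
    notMem_dart_of_mem_segment_right hbu (left_mem_segment _ _ _)
  have key : ∀ d, d ≠ c → w d ∉ dart σ (w a) (w u) (w b) → r ≠ w d := by
    rintro d hdc hdd rfl
    have hdc' : d = c' := by
      rcases hw.eq_or_eq_of_mem_edge hrj with h | h <;> rcases hc with ⟨rfl, rfl⟩ | ⟨rfl, rfl⟩
      · exact absurd h hdc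
      · exact h
      · exact h
      · exact absurd h hdc
    subst hdc'
    rw [hedge] at hp
    obtain ⟨s, hs0, hs1, rfl⟩ := exists_of_mem_segment hp
    obtain ⟨t, ht0, ht1, ht⟩ := exists_of_mem_segment hr
    have h0 : (s + t * (1 - s)) • (w c - w d) = 0 := by
      have : w d + (s + t * (1 - s)) • (w c - w d) = w d := by
        conv_rhs => rw [ht]
        module
      simpa using this
    rcases smul_eq_zero.1 h0 with h | h
    · have hs : s = 0 := by nlinarith [mul_nonneg ht0 (sub_nonneg.2 hs1)]
      refine hdd ?_
      simpa [hs] using hpd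
    · exact hdc (hw.injective (sub_eq_zero.1 h).symm)
  rcases eq_or_eq_of_mem_closure_dart hw ha hb hab hau hbu hj hj' hrj hrc hrd with h | h
  · refine key a ?_ hna h
    rintro rfl
    rcases hab with h | h
    · exact hc1 h.1
    · exact hc2 h.1
  · refine key b ?_ hnb h
    rintro rfl
    rcases hab with h | h
    · exact hc2 h.2
    · exact hc1 h.2

theorem notMem_dart_of_mem_edge (hw : IsSimpleCurve w) {a u b : ZMod n}
    (h0 : (0 : ℝ × ℝ) ∈ convexHull ℝ (range w)) (ha : Sees w a) (hb : Sees w b)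
    (hab : (a = u - 1 ∧ b = u + 1) ∨ (a = u + 1 ∧ b = u - 1))
    (hau : 0 < cross σ (w a) (w u)) (hbu : 0 < cross σ (w b) (w u))
    (hab0 : 0 < cross σ (w a) (w b)) {j : ZMod n} {p : ℝ × ℝ} (hp : p ∈ edge w j) :
    p ∉ dart σ (w a) (w u) (w b) := by
  intro hpd
  have hnu : w u ∉ dart σ (w a) (w u) (w b) :=
    notMem_dart_of_mem_segment_left (right_mem_segment _ _ _)
  have hna : w a ∉ dart σ (w a) (w u) (w b) :=
    notMem_dart_of_mem_segment_left (left_mem_segment _ _ _)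
  have hnb : w b ∉ dart σ (w a) (w u) (w b) :=
    notMem_dart_of_mem_segment_right hbu (left_mem_segment _ _ _)
  have hside : ∀ i, i = u - 1 ∨ i = u + 1 → w i ∉ dart σ (w a) (w u) (w b) := by
    rintro i (rfl | rfl) <;> rcases hab with ⟨rfl, rfl⟩ | ⟨rfl, rfl⟩ <;> assumption
  have hseg : ∀ i, i = u - 1 ∨ i = u + 1 → ∀ p ∈ segment ℝ (w i) (w u),
      p ∉ dart σ (w a) (w u) (w b) := by
    rintro i hi p hp
    have : i = a ∨ i = b := by
      rcases hi with rfl | rfl <;> rcases hab with ⟨rfl, rfl⟩ | ⟨rfl, rfl⟩ <;> simp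
    rcases this with rfl | rfl
    · exact notMem_dart_of_mem_segment_left hp
    · exact notMem_dart_of_mem_segment_right hbu hp
  have hnot : ∀ j, ∀ p ∈ edge w j, p ∈ dart σ (w a) (w u) (w b) → j ≠ u ∧ j ≠ u - 1 := by
    refine fun j p hp hpd => ⟨?_, ?_⟩
    · rintro rfl
      exact hseg (j + 1) (Or.inr rfl) p (by rwa [segment_symm]) hpd
    · rintro rfl
      rw [edge, sub_add_cancel] at hp
      exact hseg (u - 1) (Or.inl rfl) p hp hpd
  have hvert : ∀ j, (∃ p ∈ edge w j, p ∈ dart σ (w a) (w u) (w b)) →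
      (w j ∈ dart σ (w a) (w u) (w b) ∨ j = u - 1 ∨ j = u + 1) ∧
      (w (j + 1) ∈ dart σ (w a) (w u) (w b) ∨ j + 1 = u - 1 ∨ j + 1 = u + 1) := by
    rintro j ⟨p, hp, hpd⟩
    obtain ⟨h1, h2⟩ := hnot j p hp hpd
    exact ⟨mem_dart_of_edge hw ha hb hab hau hbu h1 h2 hp hpd (Or.inl ⟨rfl, rfl⟩),
      mem_dart_of_edge hw ha hb hab hau hbu h1 h2 hp hpd (Or.inr ⟨rfl, rfl⟩)⟩
  have hall := forall_mem_of_zmod_interval hw.three_le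
    (M := {j | ∃ p ∈ edge w j, p ∈ dart σ (w a) (w u) (w b)}) ⟨p, hp, hpd⟩
    (hnot j p hp hpd).1 (hnot j p hp hpd).2 (by
      intro i hi hiu
      obtain ⟨q, hq, hqd⟩ := id hi
      obtain ⟨h1, h2⟩ := hnot i q hq hqd
      rcases (hvert i hi).2 with h | h | h
      · exact ⟨_, left_mem_edge _, h⟩
      · exact absurd (by linear_combination h) hiu
      · exact absurd (by linear_combination h) h1) (by
      intro i hi hiu
      obtain ⟨q, hq, hqd⟩ := id hi
      obtain ⟨h1, h2⟩ := hnot i q hq hqd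
      rcases (hvert i hi).1 with h | h | h
      · exact ⟨w i, by simpa using right_mem_edge (w := w) (i - 1), h⟩
      · exact absurd h h2
      · exact absurd h hiu)
  have hpos : ∀ i, 0 < cross σ (w a) (w i) + cross σ (w i) (w u) := by
    have hsidepos : ∀ i, i = u - 1 ∨ i = u + 1 → 0 < cross σ (w a) (w i) + cross σ (w i) (w u) := by
      intro i hi
      have : i = a ∨ i = b := by
        rcases hi with rfl | rfl <;> rcases hab with ⟨rfl, rfl⟩ | ⟨rfl, rfl⟩ <;> simp
      rcases this with rfl | rfl
      · rw [cross_self]; linarith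
      · linarith
    intro i
    by_cases h1 : i = u
    · rw [h1, cross_self]; linarith
    by_cases h2 : i = u - 1
    · exact hsidepos i (Or.inl h2)
    rcases (hvert i (hall i h1 h2)).1 with h | h
    · linarith [h.1.1, h.1.2.1]
    · exact hsidepos i h
  have hcv : Convex ℝ {p | 0 < cross σ (w a) p + cross σ p (w u)} := by
    refine convex_halfSpace_gt ⟨?_, ?_⟩ _
    · intro p q; rw [cross_add_right, cross_add_left]; ring
    · intro t p; rw [cross_smul_right, cross_smul_left, smul_eq_mul]; ring
  have := convexHull_min (s := range w) (by rintro _ ⟨i, rfl⟩; exact hpos i) hcv h0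
  simp at this

/-- If the visible vertices `a` and `b` are the neighbours of `u`, then the region avoids the
triangle `a u b`. -/
theorem notMem_of_sees_sees (hw : IsSimpleCurve w) {P : Set (ℝ × ℝ)} (hP : IsClosed P)
    (hfr : frontier P = ⋃ j, edge w j) (hP0 : (0 : ℝ × ℝ) ∉ P) {a u b : ZMod n}
    (h0 : (0 : ℝ × ℝ) ∈ convexHull ℝ (range w)) (ha : Sees w a) (hb : Sees w b)
    (hab : (a = u - 1 ∧ b = u + 1) ∨ (a = u + 1 ∧ b = u - 1))
    (hau : 0 < cross σ (w a) (w u)) (hbu : 0 < cross σ (w b) (w u))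
    (hab0 : 0 < cross σ (w a) (w b)) :
    cross σ (w a - w u) (w b - w u) ≠ 0 ∧ ∀ s r : ℝ, 0 < s → 0 < r → s + r < 1 →
      w u + s • (w a - w u) + r • (w b - w u) ∉ P := by
  have hT : w b ∈ openTri σ (w a) (w u) := by
    have hba : b ≠ a := by
      rintro rfl
      rw [cross_self] at hab0
      exact lt_irrefl _ hab0
    have hbu' : b ≠ u := by
      rintro rfl
      rw [cross_self] at hbu
      exact lt_irrefl _ hbu
    rcases hab with ⟨ha', hb'⟩ | ⟨ha', hb'⟩
    · refine hb.mem_openTri hw (e := a) ?_ hba ?_ hab0 hbu hau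
      · rw [edge, ha', sub_add_cancel]
      · rw [ha', sub_add_cancel]; exact hbu'
    · refine hb.mem_openTri hw (e := u) ?_ hbu' ?_ hab0 hbu hau
      · rw [edge, ha', segment_symm]
      · rw [← ha']; exact hba
  have hlt := hT.2.2
  have hfree : ∀ p ∈ dart σ (w a) (w u) (w b), p ∉ frontier P := by
    intro p hp h
    rw [hfr] at h
    obtain ⟨j, hj⟩ := mem_iUnion.1 h
    exact notMem_dart_of_mem_edge hw h0 ha hb hab hau hbu hab0 hj hp
  constructor
  · have : cross σ (w a - w u) (w b - w u) =
        cross σ (w a) (w b) + cross σ (w b) (w u) - cross σ (w a) (w u) := by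
      simp only [cross_sub_left, cross_sub_right, cross_self, cross_swap σ (w b) (w u)]; ring
    rw [this]
    linarith
  · intro s r hs hr hsr
    obtain ⟨ε, hε0, -, hεP, hε⟩ := exists_add_smul_sub_mem (p := 0) (hP.isOpen_compl.inter
      (isOpen_lt ((continuous_cross_right σ (w a)).add (continuous_cross_left σ (w u)))
        (continuous_const (y := cross σ (w a) (w u))))) ⟨hP0, by simpa using hau⟩ (w a + w b)
    simp only [zero_add, sub_zero, mem_ofPred_eq] at hεP hε
    refine (isPreconnected_dart hab0 hbu hlt).disjoint_of_frontier hP hfree (p := ε • (w a + w b))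
      ⟨⟨?_, ?_, hε⟩, Or.inl ?_⟩ hεP ⟨⟨?_, ?_, ?_⟩, Or.inr ?_⟩
    · rw [cross_smul_right, cross_add_right, cross_self]; positivity
    · rw [cross_smul_left, cross_add_left]; positivity
    · change cross σ (w b) (ε • (w a + w b)) < 0
      rw [cross_smul_right, cross_add_right, cross_self, cross_swap σ (w a) (w b)]; nlinarith
    · simp only [cross_add_right, cross_smul_right, cross_sub_right, cross_self]
      nlinarith
    · simp only [cross_add_left, cross_smul_left, cross_sub_left, cross_self]
      nlinarith
    · simp only [cross_add_left, cross_smul_left, cross_sub_left, cross_add_right,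
        cross_smul_right, cross_sub_right, cross_self]
      nlinarith
    · simp only [mem_ofPred_eq, cross_add_left, cross_smul_left, cross_sub_left, cross_add_right,
        cross_smul_right, cross_sub_right, cross_self, cross_swap σ (w a) (w b)]
      nlinarith

end

section
variable {n : ℕ} {w v : ZMod n → ℝ × ℝ} {σ : ℝ} {P : Set (ℝ × ℝ)}

/-- A seen vertex is separated from a viewpoint outside the region by no point of the region. -/
theorem Sees.smul_notMem (hw : IsSimpleCurve w) (hg : IsGeneric σ w) (hP : IsClosed P)
    (hfr : frontier P = ⋃ j, edge w j) (hP0 : (0 : ℝ × ℝ) ∉ P) {i : ZMod n} (hi : Sees w i)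
    {t : ℝ} (h0 : 0 ≤ t) (h1 : t < 1) : t • w i ∉ P := by
  have hC : IsPreconnected ((fun t : ℝ => t • w i) '' Ico 0 1) :=
    isPreconnected_Ico.image _ (by fun_prop)
  refine hC.disjoint_of_frontier hP ?_ (p := 0) ⟨0, by simp, by simp⟩ hP0 ⟨t, ⟨h0, h1⟩, rfl⟩
  rintro _ ⟨s, ⟨hs0, hs1⟩, rfl⟩ h
  rw [hfr] at h
  obtain ⟨j, hj⟩ := mem_iUnion.1 h
  have h2 : (s - 1) • w i = 0 := by
    rw [sub_smul, one_smul, sub_eq_zero]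
    exact hi j _ hj (smul_mem_segment_zero _ hs0 hs1.le)
  rcases smul_eq_zero.1 h2 with h | h
  · linarith
  · exact hg.cross_edge_ne hw i (by rw [h, cross_zero_left])

/-- The region avoids the triangle at the vertex `i` spanned by the two edges there. -/
def IsReflex (v : ZMod n → ℝ × ℝ) (P : Set (ℝ × ℝ)) (i : ZMod n) : Prop :=
  cross 1 (v (i - 1) - v i) (v (i + 1) - v i) ≠ 0 ∧ ∀ s r : ℝ, 0 < s → 0 < r → s + r < 1 →
    v i + s • (v (i - 1) - v i) + r • (v (i + 1) - v i) ∉ P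

theorem IsSimpleCurve.exists_ball (hv : IsSimpleCurve v) (i : ZMod n) :
    ∃ O : Set (ℝ × ℝ), IsOpen O ∧ Convex ℝ O ∧ v i ∈ O ∧
      ∀ j, ∀ p ∈ edge v j, p ∈ O → j = i ∨ j = i - 1 := by
  have : NeZero n := ⟨by have := hv.three_le; omega⟩
  have hcl : IsClosed (⋃ j ∈ {j : ZMod n | j ≠ i ∧ j ≠ i - 1}, edge v j) := by
    refine Set.Finite.isClosed_biUnion (Set.toFinite _) fun j _ => ?_
    rw [edge, segment_eq_image ℝ]
    exact (isCompact_Icc.image (by fun_prop)).isClosed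
  have hmem : v i ∈ (⋃ j ∈ {j : ZMod n | j ≠ i ∧ j ≠ i - 1}, edge v j)ᶜ := by
    simp only [mem_compl_iff, mem_iUnion, not_exists]
    intro j hj h
    rcases hv.eq_or_eq_of_mem_edge h with h | h
    · exact hj.1 h.symm
    · exact hj.2 (by rw [h]; ring)
  obtain ⟨ρ, hρ, hball⟩ := Metric.isOpen_iff.1 hcl.isOpen_compl _ hmem
  refine ⟨_, Metric.isOpen_ball, convex_ball (v i) ρ, Metric.mem_ball_self hρ, ?_⟩
  intro j p hp hpO
  by_contra! hc
  have := hball hpO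
  simp only [mem_compl_iff, mem_iUnion, not_exists] at this
  exact this j hc hp

/-- Near a reflex vertex all directions outside the angle lead into the region. -/
theorem IsReflex.exists_mem (hv : IsSimpleCurve v) (hP : IsClosed P)
    (hPint : P = closure (interior P)) (hfr : frontier P = ⋃ j, edge v j) {i : ZMod n}
    (hi : IsReflex v P i) {d : ℝ × ℝ}
    (hd : ∀ x y : ℝ, 0 ≤ x → 0 ≤ y → d ≠ x • (v (i - 1) - v i) + y • (v (i + 1) - v i)) :
    ∃ ε : ℝ, 0 < ε ∧ ε ≤ 1 ∧ v i + ε • d ∈ P := by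
  obtain ⟨O, hO, hOc, hiO, hOe⟩ := hv.exists_ball i
  obtain ⟨hD, hR⟩ := hi
  set a := v i with ha
  set e₁ := v (i - 1) - a with he₁
  set e₂ := v (i + 1) - a with he₂
  set x : ℝ × ℝ → ℝ := fun p => cross 1 p e₂ / cross 1 e₁ e₂ with hx
  set y : ℝ × ℝ → ℝ := fun p => cross 1 e₁ p / cross 1 e₁ e₂ with hy
  have hxy : ∀ p, p = x p • e₁ + y p • e₂ := fun p => eq_of_cross 1 hD
  have hxl : IsLinearMap ℝ x := ⟨fun p q => by simp only [hx, cross_add_left]; ring,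
    fun t p => by simp only [hx, cross_smul_left, smul_eq_mul]; ring⟩
  have hyl : IsLinearMap ℝ y := ⟨fun p q => by simp only [hy, cross_add_right]; ring,
    fun t p => by simp only [hy, cross_smul_right, smul_eq_mul]; ring⟩
  have hxc : Continuous x := by fun_prop
  have hyc : Continuous y := by fun_prop
  have x1 : x e₁ = 1 := div_self hD
  have x2 : x e₂ = 0 := by simp [hx]
  have y1 : y e₁ = 0 := by simp [hy]
  have y2 : y e₂ = 1 := div_self hD
  set W : Set (ℝ × ℝ) := (O ∩ {p | x p < x a}) ∪ (O ∩ {p | y p < y a}) with hW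
  have hWmem : ∀ p, p ∈ W ↔ p ∈ O ∧ (x p < x a ∨ y p < y a) := fun p => by
    rw [hW, ← inter_union_distrib_left]; rfl
  have hWc : IsPreconnected W := by
    obtain ⟨ε, hε0, -, hε⟩ := exists_add_smul_sub_mem hO hiO (a - (e₁ + e₂))
    refine (hOc.inter (convex_halfSpace_lt hxl _)).isPreconnected.union
      (a + ε • (a - (e₁ + e₂) - a)) ⟨hε, ?_⟩ ⟨hε, ?_⟩
      (hOc.inter (convex_halfSpace_lt hyl _)).isPreconnected
    · simp only [mem_ofPred_eq, hxl.map_add, hxl.map_smul, hxl.map_sub, x1, x2, smul_eq_mul]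
      linarith
    · simp only [mem_ofPred_eq, hyl.map_add, hyl.map_smul, hyl.map_sub, y1, y2, smul_eq_mul]
      linarith
  have hWfr : ∀ p ∈ W, p ∉ frontier P := by
    intro p hp h
    rw [hWmem] at hp
    rw [hfr] at h
    obtain ⟨j, hj⟩ := mem_iUnion.1 h
    obtain ⟨t, ht, e, he, hpe⟩ : ∃ t : ℝ, 0 ≤ t ∧ ∃ e, (e = e₁ ∨ e = e₂) ∧ p = a + t • e := by
      rcases hOe j p hj hp.1 with rfl | rfl
      · obtain ⟨t, ht, -, h⟩ := exists_of_mem_segment hj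
        exact ⟨t, ht, _, Or.inr rfl, h⟩
      · rw [edge, sub_add_cancel, segment_symm] at hj
        obtain ⟨t, ht, -, h⟩ := exists_of_mem_segment hj
        exact ⟨t, ht, _, Or.inl rfl, h⟩
    rw [hpe, hxl.map_add, hyl.map_add, hxl.map_smul, hyl.map_smul] at hp
    rcases he with rfl | rfl
    · rw [x1, y1, smul_eq_mul, smul_eq_mul] at hp
      rcases hp.2 with h | h <;> linarith
    · rw [x2, y2, smul_eq_mul, smul_eq_mul] at hp
      rcases hp.2 with h | h <;> linarith
  have hWP : W ⊆ P := by
    intro p hp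
    by_contra hpP
    have hout : ∀ q ∈ W, q ∉ P := fun q hq => hWc.disjoint_of_frontier hP hWfr hp hpP hq
    have haP : a ∈ closure (interior P) := by
      rw [← hPint, ← hP.closure_eq]
      refine frontier_subset_closure ?_
      rw [hfr]
      exact mem_iUnion.2 ⟨i, left_mem_edge i⟩
    obtain ⟨q, ⟨hqO, hq1⟩, hqP⟩ := mem_closure_iff.1 haP (O ∩ {q | x q + y q < x a + y a + 1})
      (hO.inter (isOpen_lt (hxc.add hyc) continuous_const))
      ⟨hiO, by simp only [mem_ofPred_eq]; linarith⟩
    simp only [mem_ofPred_eq] at hq1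
    have hq := hxy (q - a)
    rw [hxl.map_sub, hyl.map_sub] at hq
    have hqW : x a ≤ x q ∧ y a ≤ y q := by
      by_contra hc
      refine hout q ((hWmem q).2 ⟨hqO, ?_⟩) (interior_subset hqP)
      by_contra! h
      exact hc h
    have hq0 : x q = x a ∨ y q = y a := by
      by_contra! hc
      refine hR (x q - x a) (y q - y a) (sub_pos.2 (lt_of_le_of_ne hqW.1 hc.1.symm))
        (sub_pos.2 (lt_of_le_of_ne hqW.2 hc.2.symm)) (by linarith) ?_
      rw [add_assoc, ← hq, add_sub_cancel]
      exact interior_subset hqP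
    obtain ⟨ε, hε0, -, hεO, hεP⟩ := exists_add_smul_sub_mem (hO.inter isOpen_interior)
      ⟨hqO, hqP⟩ (q - (e₁ + e₂))
    refine hout _ ((hWmem _).2 ⟨hεO, ?_⟩) (interior_subset hεP)
    simp only [hxl.map_add, hyl.map_add, hxl.map_smul, hyl.map_smul, hxl.map_sub, hyl.map_sub,
      x1, x2, y1, y2, smul_eq_mul]
    rcases hq0 with h | h
    · left; linarith
    · right; linarith
  obtain ⟨ε, hε0, hε1, hεO⟩ := exists_add_smul_sub_mem hO hiO (a + d)
  rw [add_sub_cancel_left] at hεO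
  refine ⟨ε, hε0, hε1, hWP ((hWmem _).2 ⟨hεO, ?_⟩)⟩
  simp only [hxl.map_add, hyl.map_add, hxl.map_smul, hyl.map_smul, smul_eq_mul]
  have : ¬ (0 ≤ x d ∧ 0 ≤ y d) := fun h => hd _ _ h.1 h.2 (hxy d)
  rw [not_and_or, not_le, not_le] at this
  rcases this with h | h
  · left; nlinarith
  · right; nlinarith

theorem IsReflex.notMem_extremePoints (hv : IsSimpleCurve v) (hP : IsClosed P)
    (hPint : P = closure (interior P)) (hfr : frontier P = ⋃ j, edge v j)
    (hPc : P ⊆ convexHull ℝ (range v)) {i : ZMod n} (hi : IsReflex v P i) :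
    v i ∉ (convexHull ℝ (range v)).extremePoints ℝ := by
  intro hext
  obtain ⟨ε, hε0, -, hε⟩ := hi.exists_mem hv hP hPint hfr
    (d := - ((v (i - 1) - v i) + (v (i + 1) - v i))) (by
      intro x y hx hy h
      have h1 := congrArg (fun p => cross 1 p (v (i + 1) - v i)) h
      have h2 : (- 1 - x) * cross 1 (v (i - 1) - v i) (v (i + 1) - v i) = 0 := by
        simp only [← neg_one_smul ℝ (_ + _ : ℝ × ℝ), cross_add_left, cross_smul_left,
          cross_self] at h1
        linarith
      rcases mul_eq_zero.1 h2 with h | h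
      · linarith
      · exact hi.1 h)
  have hm : (1 / 2 : ℝ) • v (i - 1) + (1 / 2 : ℝ) • v (i + 1) ∈ convexHull ℝ (range v) :=
    convex_convexHull ℝ _ (subset_convexHull ℝ _ (mem_range_self _))
      (subset_convexHull ℝ _ (mem_range_self _)) (by norm_num) (by norm_num) (by norm_num)
  have h := (mem_extremePoints.1 hext).2 _ (hPc hε) _ hm
    ⟨1 / (1 + 2 * ε), 2 * ε / (1 + 2 * ε), by positivity, by positivity, by field_simp, by
      have h0 : (1 + 2 * ε) ≠ 0 := by positivity
      have h1 : 2 * ε / (1 + 2 * ε) = 1 - 1 / (1 + 2 * ε) := by field_simp; ring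
      have h2 : 1 / (1 + 2 * ε) * ε = (1 - 1 / (1 + 2 * ε)) / 2 := by field_simp; ring
      rw [h1, smul_add, smul_smul, h2]
      module⟩
  have h1 := h.1
  rw [add_eq_left, smul_eq_zero, neg_eq_zero] at h1
  rcases h1 with h1 | h1
  · exact hε0.ne' h1
  · refine hi.1 ?_
    rw [← neg_eq_of_add_eq_zero_right h1, ← neg_one_smul ℝ (_ : ℝ × ℝ), cross_smul_right,
      cross_self, mul_zero]

end

section
variable {n : ℕ} {w v : ZMod n → ℝ × ℝ} {σ : ℝ} {P : Set (ℝ × ℝ)}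

theorem mem_openTri_combination {a u b : ℝ × ℝ} (h : b ∈ openTri σ a u) :
    ∃ x y : ℝ, 0 < x ∧ 0 < y ∧ x + y < 1 ∧ b = x • a + y • u := by
  obtain ⟨h1, h2, h3⟩ := h
  have h0 : 0 < cross σ a u := by linarith
  refine ⟨_, _, div_pos h2 h0, div_pos h1 h0, ?_, eq_of_cross σ h0.ne'⟩
  rw [← add_div, div_lt_one h0]
  linarith

/-- A point strictly inside a triangle of points of a convex set is not an extreme point. -/
theorem notMem_extremePoints_of_mem_openTri {K : Set (ℝ × ℝ)} (hK : Convex ℝ K)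
    {X a u b : ℝ × ℝ} (hX : X ∈ K) (ha : a ∈ K) (hu : u ∈ K)
    (h : b - X ∈ openTri σ (a - X) (u - X)) : b ∉ K.extremePoints ℝ := by
  intro hext
  obtain ⟨x, y, hx, hy, hxy, hb⟩ := mem_openTri_combination h
  have hm : (1 - y / (1 - x)) • X + (y / (1 - x)) • u ∈ K := by
    refine hK hX hu ?_ (div_nonneg hy.le (by linarith)) (by ring)
    rw [sub_nonneg, div_le_one (by linarith)]
    linarith
  have hb' : x • a + (1 - x) • ((1 - y / (1 - x)) • X + (y / (1 - x)) • u) = b := by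
    rw [smul_add, smul_smul, smul_smul, mul_sub, mul_div_cancel₀ y (by linarith : 1 - x ≠ 0)]
    rw [sub_eq_iff_eq_add] at hb
    rw [hb]
    module
  have := (mem_extremePoints.1 hext).2 _ ha _ hm ⟨x, 1 - x, hx, by linarith, by ring, hb'⟩
  obtain ⟨c1, c2, -⟩ := h
  rw [this.1, cross_self] at c1
  exact lt_irrefl _ c1

theorem IsTip.not_isReflex {X : ℝ × ℝ} (hv : IsSimpleCurve v) (hw : IsSimpleCurve fun i => v i - X)
    (hg : IsGeneric σ fun i => v i - X) (hP : IsClosed P)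
    (hPint : P = closure (interior P)) (hfr : frontier P = ⋃ j, edge v j)
    (hX : ∀ i, Sees (fun i => v i - X) i → ∀ t : ℝ, 0 ≤ t → t < 1 → X + t • (v i - X) ∉ P)
    {i : ZMod n} (hi : IsTip σ (fun i => v i - X) i) : ¬ IsReflex v P i := by
  intro hr
  obtain ⟨ε, hε0, hε1, hε⟩ := hr.exists_mem hv hP hPint hfr (d := X - v i) (by
    intro x y hx hy h
    obtain ⟨-, h1, h2⟩ := hi
    have h3 := congrArg (cross σ (v i - X)) h
    have e1 : v (i - 1) - v i = (v (i - 1) - X) - (v i - X) := by abel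
    have e2 : v (i + 1) - v i = (v (i + 1) - X) - (v i - X) := by abel
    have e3 : X - v i = (0 : ℝ) • 0 - (v i - X) := by simp
    rw [e1, e2, e3] at h3
    simp only [cross_add_right, cross_smul_right, cross_sub_right, cross_self, sub_zero,
      cross_zero_right, mul_zero] at h3
    have hx0 : x = 0 := by
      simp only [cross_sub_right] at h1 h2
      nlinarith [mul_nonneg hx h2.le, mul_nonneg hy h1.le]
    have hy0 : y = 0 := by
      simp only [cross_sub_right] at h1 h2
      nlinarith [mul_nonneg hx h2.le, mul_nonneg hy h1.le]
    rw [hx0, hy0, zero_smul, zero_smul, add_zero, sub_eq_zero] at h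
    refine hg.cross_edge_ne hw i ?_
    simp [← h])
  refine hX i hi.1 (1 - ε) (by linarith) (by linarith) ?_
  convert hε using 1
  module

theorem subset_convexHull_of_frontier [NeZero n] (hP : IsCompact P)
    (hfr : frontier P = ⋃ j, edge v j) : P ⊆ convexHull ℝ (range v) := by
  intro q hq
  by_contra hqc
  obtain ⟨f, c, hf, hc⟩ := geometric_hahn_banach_closed_point (convex_convexHull ℝ (range v))
    ((finite_range v).isClosed_convexHull (𝕜 := ℝ)) hqc
  have hfree : ∀ p ∈ {p | c < f p}, p ∉ frontier P := by
    intro p hp h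
    rw [hfr] at h
    obtain ⟨j, hj⟩ := mem_iUnion.1 h
    have := hf p ((convex_convexHull ℝ (range v)).segment_subset
      (subset_convexHull ℝ _ (mem_range_self j))
      (subset_convexHull ℝ _ (mem_range_self (j + 1))) hj)
    exact lt_asymm this hp
  obtain ⟨m, hm, hmax⟩ := hP.exists_isMaxOn ⟨q, hq⟩ f.continuous.continuousOn
  have h1 : f q ≤ f m := hmax hq
  have h2 : f (v 0) < c := hf _ (subset_convexHull ℝ _ (mem_range_self 0))
  have h3 : f (m + (m - v 0)) = f m + (f m - f (v 0)) := by simp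
  have hout : m + (m - v 0) ∉ P := by
    intro h
    have h4 : f (m + (m - v 0)) ≤ f m := hmax h
    linarith
  have hconv : Convex ℝ {p | c < f p} := convex_halfSpace_gt f.toLinearMap.isLinear c
  exact hconv.isPreconnected.disjoint_of_frontier hP.isClosed hfree
    (p := m + (m - v 0)) (by change c < _; rw [h3]; linarith) hout hc hq

theorem convexHull_pair_interior (a b : ℝ × ℝ) : interior (segment ℝ a b) = ∅ := by
  rw [eq_empty_iff_forall_notMem]
  intro p hp
  have hseg : ∀ q ∈ segment ℝ a b, cross 1 (q - a) (b - a) = 0 := by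
    intro q hq
    obtain ⟨t, -, -, rfl⟩ := exists_of_mem_segment hq
    rw [add_sub_cancel_left, cross_smul_left, cross_self, mul_zero]
  have hp0 := hseg p (interior_subset hp)
  have hd : ∀ d : ℝ × ℝ, cross 1 d (b - a) = 0 := by
    intro d
    obtain ⟨ε, hε0, -, hε⟩ := exists_add_smul_sub_mem isOpen_interior hp (p + d)
    have h := hseg _ (interior_subset hε)
    rw [add_sub_cancel_left, add_sub_right_comm, cross_add_left, hp0, cross_smul_left] at h
    simpa [hε0.ne'] using h
  have h1 := hd (1, 0)
  have h2 := hd (0, 1)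
  simp only [cross, Prod.fst_sub, Prod.snd_sub] at h1 h2
  have hba : a = b := by
    ext
    · linarith
    · linarith
  subst hba
  obtain ⟨ε, hε0, -, hε⟩ := exists_add_smul_sub_mem isOpen_interior hp (p + (1, 0))
  have h3 := interior_subset hε
  have h4 := interior_subset hp
  rw [segment_same, mem_singleton_iff] at h3 h4
  rw [h4, add_sub_cancel_left, add_eq_left] at h3
  simp [hε0.ne'] at h3

theorem three_le_ncard_extremePoints [NeZero n] (hv : IsSimpleCurve v) (hP : IsCompact P)
    (hPint : P = closure (interior P)) (hfr : frontier P = ⋃ j, edge v j) :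
    3 ≤ {i | v i ∈ (convexHull ℝ (range v)).extremePoints ℝ}.ncard := by
  set E := (convexHull ℝ (range v)).extremePoints ℝ with hE
  have hEr : E ⊆ range v := extremePoints_convexHull_subset
  have hcard : {i | v i ∈ E}.ncard = E.ncard := by
    rw [← ncard_image_of_injective _ hv.injective]
    congr 1
    ext p
    constructor
    · rintro ⟨i, hi, rfl⟩; exact hi
    · intro hp
      obtain ⟨i, rfl⟩ := hEr hp
      exact ⟨i, hp, rfl⟩
  have hEfin : E.Finite := (finite_range v).subset hEr
  have hhull : convexHull ℝ E = convexHull ℝ (range v) := by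
    have := closure_convexHull_extremePoints
      ((finite_range v).isCompact_convexHull (𝕜 := ℝ)) (convex_convexHull ℝ (range v))
    rwa [(hEfin.isClosed_convexHull (𝕜 := ℝ)).closure_eq] at this
  have hPsub := subset_convexHull_of_frontier hP hfr
  have hint_ne : (interior P).Nonempty := by
    rw [nonempty_iff_ne_empty]
    intro h
    rw [h, closure_empty] at hPint
    have h0 : v 0 ∈ frontier P := by
      rw [hfr]
      exact mem_iUnion.2 ⟨0, left_mem_edge 0⟩
    simp [hPint] at h0
  rw [hcard]
  by_contra! hlt
  obtain ⟨a, b, hab⟩ : ∃ a b, E ⊆ {a, b} := by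
    interval_cases h : E.ncard
    · rw [ncard_eq_zero hEfin] at h
      exact ⟨0, 0, by simp [h]⟩
    · obtain ⟨a, ha⟩ := ncard_eq_one.1 h
      exact ⟨a, a, by simp [ha]⟩
    · obtain ⟨a, b, -, hab⟩ := ncard_eq_two.1 h
      exact ⟨a, b, hab.subset⟩
  have h1 : P ⊆ segment ℝ a b := by
    rw [← convexHull_pair]
    exact hPsub.trans (hhull ▸ convexHull_mono hab)
  obtain ⟨p, hp⟩ := hint_ne
  have := interior_mono h1 hp
  rw [convexHull_pair_interior] at this
  exact this

end

/-- The vertices between the guards with starting index `k`. -/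
def unguarded (n : ℕ) (k : ZMod n) : Finset (ZMod n) :=
  (Finset.range (n / 2)).image fun j : ℕ => k + 1 + 2 * (j : ZMod n)

theorem card_unguarded_le (n : ℕ) (k : ZMod n) : (unguarded n k).card ≤ n / 2 :=
  Finset.card_image_le.trans (Finset.card_range _).le

theorem exists_three_of_subset_unguarded {n : ℕ} {k : ZMod n} {S : Finset (ZMod n)}
    (hS : S ⊆ unguarded n k) (h3 : 3 ≤ S.card) :
    ∃ a b c : ℕ, a < b ∧ b < c ∧ c < n / 2 ∧ k + 1 + 2 * (a : ZMod n) ∈ S ∧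
      k + 1 + 2 * (b : ZMod n) ∈ S ∧ k + 1 + 2 * (c : ZMod n) ∈ S := by
  set J := (Finset.range (n / 2)).filter fun j : ℕ => k + 1 + 2 * (j : ZMod n) ∈ S with hJ
  have hsub : S ⊆ J.image fun j : ℕ => k + 1 + 2 * (j : ZMod n) := by
    intro t ht
    obtain ⟨j, hj, rfl⟩ := Finset.mem_image.1 (hS ht)
    exact Finset.mem_image.2 ⟨j, Finset.mem_filter.2 ⟨hj, ht⟩, rfl⟩
  have hJ3 : 2 < J.card := h3.trans ((Finset.card_le_card hsub).trans Finset.card_image_le)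
  set f := J.orderEmbOfFin rfl with hf
  have hmem : ∀ i, f i ∈ J := J.orderEmbOfFin_mem rfl
  have hm := fun i => Finset.mem_filter.1 (hmem i)
  refine ⟨f ⟨0, by omega⟩, f ⟨1, by omega⟩, f ⟨2, hJ3⟩, ?_, ?_, ?_, (hm _).2, (hm _).2, (hm _).2⟩
  · exact f.strictMono (by simp)
  · exact f.strictMono (by simp)
  · exact Finset.mem_range.1 (hm _).1

theorem card_inter_add_card_inter_le {α : Type*} [DecidableEq α] {U R H : Finset α}
    (hUH : Disjoint U H) (hUR : Disjoint U R) (hRH : Disjoint R H) (C : Finset α) :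
    (C ∩ U).card + (C ∩ R).card + (C ∩ H).card ≤ C.card := by
  rw [← Finset.card_union_of_disjoint, ← Finset.card_union_of_disjoint]
  · refine Finset.card_le_card ?_
    rw [← Finset.inter_union_distrib_left, ← Finset.inter_union_distrib_left]
    exact Finset.inter_subset_left
  · rw [← Finset.inter_union_distrib_left]
    exact (Finset.disjoint_union_left.2 ⟨hUH, hRH⟩).mono Finset.inter_subset_right
      Finset.inter_subset_right
  · exact hUR.mono Finset.inter_subset_right Finset.inter_subset_right

theorem card_le_card_inter_add_card_inter {α : Type*} [DecidableEq α] [Fintype α] {C D : Finset α}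
    (h : ∀ x, x ∈ C ∪ D) (H : Finset α) : H.card ≤ (C ∩ H).card + (D ∩ H).card := by
  refine (Finset.card_le_card ?_).trans (Finset.card_union_le _ _)
  rw [← Finset.union_inter_distrib_right]
  exact fun x hx => Finset.mem_inter.2 ⟨h x, hx⟩

section
variable {n : ℕ} {U H R : Finset (ZMod n)} {S : ZMod n → Finset (ZMod n)}

theorem three_le_card_inter (hSU : ∀ k, S k ⊆ U) (hSC : ∀ k, S k ⊆ unguarded n k)
    (hS3 : ∀ k, 3 ≤ (S k).card) (k : ZMod n) : 3 ≤ (unguarded n k ∩ U).card :=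
  (hS3 k).trans (Finset.card_le_card (Finset.subset_inter (hSC k) (hSU k)))

theorem guard_count_six_seven (h : n / 2 = 3) (hSU : ∀ k, S k ⊆ U)
    (hSC : ∀ k, S k ⊆ unguarded n k) (hS3 : ∀ k, 3 ≤ (S k).card) (x : ZMod n) : x ∈ U := by
  have hC := Finset.eq_of_subset_of_card_le (hSC (x - 1))
    ((card_unguarded_le n _).trans (h.le.trans (hS3 _)))
  refine hSU (x - 1) ?_
  rw [hC]
  exact Finset.mem_image.2 ⟨0, by simp [h], by simp⟩

theorem guard_count_eight {U H R : Finset (ZMod 8)} {S : ZMod 8 → Finset (ZMod 8)}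
    (hUH : Disjoint U H) (hUR : Disjoint U R) (hRH : Disjoint R H) (hSU : ∀ k, S k ⊆ U)
    (hSC : ∀ k, S k ⊆ unguarded 8 k) (hS3 : ∀ k, 3 ≤ (S k).card) : H.card ≤ 2 := by
  have key : ∀ k, (unguarded 8 k ∩ H).card ≤ 1 := by
    intro k
    have h1 := card_inter_add_card_inter_le hUH hUR hRH (unguarded 8 k)
    have h2 := three_le_card_inter hSU hSC hS3 k
    have h3 := card_unguarded_le 8 k
    omega
  have h1 := card_le_card_inter_add_card_inter
    (show ∀ x, x ∈ unguarded 8 0 ∪ unguarded 8 1 by decide) H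
  have h2 := key 0
  have h3 := key 1
  omega

theorem guard_count_nine {U H R : Finset (ZMod 9)} {S : ZMod 9 → Finset (ZMod 9)}
    (hUH : Disjoint U H) (hUR : Disjoint U R) (hRH : Disjoint R H) (hSU : ∀ k, S k ⊆ U)
    (hSC : ∀ k, S k ⊆ unguarded 9 k) (hS3 : ∀ k, 3 ≤ (S k).card) : H.card ≤ 2 := by
  have key : ∀ k, (unguarded 9 k ∩ H).card ≤ 1 := by
    intro k
    have h1 := card_inter_add_card_inter_le hUH hUR hRH (unguarded 9 k)
    have h2 := three_le_card_inter hSU hSC hS3 k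
    have h3 := card_unguarded_le 9 k
    omega
  have hadj : ∀ a ∈ H, ∀ b ∈ H, a ≠ b → b = a + 1 ∨ a = b + 1 := by
    intro a ha b hb hab
    by_contra hc
    obtain ⟨k, hka, hkb⟩ := (show ∀ a b : ZMod 9, a ≠ b → ¬(b = a + 1 ∨ a = b + 1) →
      ∃ k, a ∈ unguarded 9 k ∧ b ∈ unguarded 9 k by decide) a b hab hc
    exact hab (Finset.card_le_one.1 (key k) a (Finset.mem_inter.2 ⟨hka, ha⟩) b
      (Finset.mem_inter.2 ⟨hkb, hb⟩))
  by_contra! h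
  obtain ⟨a, ha, b, hb, c, hc, hab, hac, hbc⟩ := Finset.two_lt_card.1 h
  exact (show ∀ a b c : ZMod 9, a ≠ b → a ≠ c → b ≠ c → (b = a + 1 ∨ a = b + 1) →
    (c = a + 1 ∨ a = c + 1) → ¬(c = b + 1 ∨ b = c + 1) by decide) a b c hab hac hbc
    (hadj a ha b hb hab) (hadj a ha c hc hac) (hadj b hb c hc hbc)

theorem guard_count_ten {U H R : Finset (ZMod 10)} {S : ZMod 10 → Finset (ZMod 10)}
    (hUH : Disjoint U H) (hUR : Disjoint U R) (hRH : Disjoint R H) (hSU : ∀ k, S k ⊆ U)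
    (hSC : ∀ k, S k ⊆ unguarded 10 k) (hS3 : ∀ k, 3 ≤ (S k).card)
    (hSR : ∀ k, ∀ t ∈ S k, t + 2 ∈ S k → t + 1 ∈ R) : H.card ≤ 2 := by
  have hR : ∀ k, (unguarded 10 (k + 1) ∩ R).Nonempty := by
    intro k
    obtain ⟨t, ht, ht'⟩ : ∃ t ∈ S k, t + 2 ∈ S k := by
      obtain ⟨a, b, c, hab, hbc, hc, h1, h2, h3⟩ :=
        exists_three_of_subset_unguarded (hSC k) (hS3 k)
      obtain rfl | rfl | ⟨rfl, rfl⟩ : b = a + 1 ∨ c = b + 1 ∨ (a = 0 ∧ c = 4) := by omega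
      · exact ⟨_, h1, by convert h2 using 1; push_cast; ring⟩
      · exact ⟨_, h2, by convert h3 using 1; push_cast; ring⟩
      · refine ⟨_, h3, ?_⟩
        convert h1 using 1
        exact (show ∀ k : ZMod 10, k + 1 + 2 * ((4 : ℕ) : ZMod 10) + 2 =
          k + 1 + 2 * ((0 : ℕ) : ZMod 10) by decide) k
    refine ⟨t + 1, Finset.mem_inter.2 ⟨?_, hSR k t ht ht'⟩⟩
    exact (show ∀ k t : ZMod 10, t ∈ unguarded 10 k → t + 1 ∈ unguarded 10 (k + 1) by decide)
      k t (hSC k ht)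
  have key : ∀ k, (unguarded 10 (k + 1) ∩ H).card ≤ 1 := by
    intro k
    have h1 := card_inter_add_card_inter_le hUH hUR hRH (unguarded 10 (k + 1))
    have h2 := three_le_card_inter hSU hSC hS3 (k + 1)
    have h3 := card_unguarded_le 10 (k + 1)
    have h4 := (hR k).card_pos
    omega
  have h1 := card_le_card_inter_add_card_inter
    (show ∀ x, x ∈ unguarded 10 (0 + 1) ∪ unguarded 10 (1 + 1) by decide) H
  have h2 := key 0
  have h3 := key 1
  omega

theorem guard_count_eleven {U H R : Finset (ZMod 11)} {S : ZMod 11 → Finset (ZMod 11)}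
    (hUH : Disjoint U H) (hUR : Disjoint U R) (hRH : Disjoint R H) (hSU : ∀ k, S k ⊆ U)
    (hSC : ∀ k, S k ⊆ unguarded 11 k) (hS3 : ∀ k, 3 ≤ (S k).card)
    (hSR : ∀ k, ∀ t ∈ S k, t + 2 ∈ S k → t + 1 ∈ R) : H.card ≤ 2 := by
  by_contra! h
  have hU : 7 ≤ U.card := by
    have h1 := Finset.sum_card_bipartiteAbove_eq_sum_card_bipartiteBelow
      (s := (Finset.univ : Finset (ZMod 11))) (t := U) fun k i => i ∈ unguarded 11 k
    have h2 : ∀ k ∈ (Finset.univ : Finset (ZMod 11)),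
        3 ≤ (U.bipartiteAbove (fun k i => i ∈ unguarded 11 k) k).card := by
      intro k _
      refine (hS3 k).trans (Finset.card_le_card fun t ht => ?_)
      exact Finset.mem_filter.2 ⟨hSU k ht, hSC k ht⟩
    have h3 : ∀ i ∈ U, (Finset.univ.bipartiteBelow (fun k i => i ∈ unguarded 11 k) i).card = 5 := by
      exact fun i _ => (show ∀ i : ZMod 11, (Finset.univ.bipartiteBelow
        (fun k i => i ∈ unguarded 11 k) i).card = 5 by decide) i
    have h4 := Finset.card_nsmul_le_sum _ _ _ h2
    rw [h1, Finset.sum_congr rfl h3, Finset.sum_const, Finset.card_univ, ZMod.card] at h4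
    simp only [smul_eq_mul] at h4
    omega
  have hR : 2 ≤ R.card := by
    by_contra! hR
    obtain ⟨r, hr⟩ : ∃ r, ∀ x ∈ R, x = r := by
      rcases R.eq_empty_or_nonempty with rfl | ⟨r, hr⟩
      · exact ⟨0, by simp⟩
      · exact ⟨r, fun x hx => Finset.card_le_one.1 (by omega) x hx r hr⟩
    obtain ⟨x, hx⟩ : H.Nonempty := Finset.card_pos.1 (by omega)
    obtain ⟨k, hk, hkr⟩ : ∃ k, (x = k + 1 ∨ x = k + 5 ∨ x = k + 9) ∧
        ¬ (r - 1 ∈ unguarded 11 k ∧ r + 1 ∈ unguarded 11 k) := by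
      clear hx hr
      revert x r
      decide
    have hno : ∀ t ∈ S k, t + 2 ∉ S k := by
      intro t ht ht'
      obtain rfl := hr _ (hSR k t ht ht')
      refine hkr ⟨hSC k (by simpa using ht), hSC k ?_⟩
      convert ht' using 1
      ring
    refine Finset.disjoint_left.1 hUH (hSU k ?_) hx
    obtain ⟨a, b, c, hab, hbc, hc, h1, h2, h3⟩ :=
      exists_three_of_subset_unguarded (hSC k) (hS3 k)
    have hb1 : b ≠ a + 1 := by
      rintro rfl
      exact hno _ h1 (by convert h2 using 1; push_cast; ring)
    have hc1 : c ≠ b + 1 := by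
      rintro rfl
      exact hno _ h2 (by convert h3 using 1; push_cast; ring)
    obtain ⟨rfl, rfl, rfl⟩ : a = 0 ∧ b = 2 ∧ c = 4 := by omega
    rcases hk with rfl | rfl | rfl
    · convert h1 using 1; simp
    · convert h2 using 1; push_cast; ring
    · convert h3 using 1; push_cast; ring
  have h1 := card_inter_add_card_inter_le hUH hUR hRH Finset.univ
  simp only [Finset.univ_inter, Finset.card_univ, ZMod.card] at h1
  omega

theorem guard_count (hn : n < 12) (hUH : Disjoint U H) (hUR : Disjoint U R) (hRH : Disjoint R H)
    (hSU : ∀ k, S k ⊆ U) (hSC : ∀ k, S k ⊆ unguarded n k) (hS3 : ∀ k, 3 ≤ (S k).card)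
    (hSR : ∀ k, ∀ t ∈ S k, t + 2 ∈ S k → t + 1 ∈ R) : H.card ≤ 2 := by
  have h2 : 3 ≤ n / 2 :=
    (hS3 0).trans ((Finset.card_le_card (hSC 0)).trans (card_unguarded_le n 0))
  by_cases h7 : n / 2 = 3
  · by_contra! h
    obtain ⟨x, hx⟩ : H.Nonempty := Finset.card_pos.1 (by omega)
    exact Finset.disjoint_left.1 hUH (guard_count_six_seven h7 hSU hSC hS3 x) hx
  obtain rfl | rfl | rfl | rfl : n = 8 ∨ n = 9 ∨ n = 10 ∨ n = 11 := by omega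
  · exact guard_count_eight hUH hUR hRH hSU hSC hS3
  · exact guard_count_nine hUH hUR hRH hSU hSC hS3
  · exact guard_count_ten hUH hUR hRH hSU hSC hS3 hSR
  · exact guard_count_eleven hUH hUR hRH hSU hSC hS3 hSR

end

section
variable {n : ℕ} {v : ZMod n → ℝ × ℝ} {P : Set (ℝ × ℝ)}

theorem mem_edge_sub {X p : ℝ × ℝ} {j : ZMod n} :
    p ∈ edge (fun i => v i - X) j ↔ X + p ∈ edge v j := by
  rw [edge, edge, ← mem_segment_translate ℝ X]
  simp

theorem IsSimpleCurve.sub (hv : IsSimpleCurve v) (X : ℝ × ℝ) :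
    IsSimpleCurve fun i => v i - X where
  three_le := hv.three_le
  injective := fun i j h => hv.injective (sub_left_injective h)
  adjacent := fun i => by
    ext p
    rw [mem_inter_iff, mem_edge_sub, mem_edge_sub, ← mem_inter_iff, hv.adjacent,
      mem_singleton_iff, mem_singleton_iff, eq_sub_iff_add_eq']
  disjoint := fun i j h1 h2 h3 => by
    rw [eq_empty_iff_forall_notMem]
    intro p hp
    rw [mem_inter_iff, mem_edge_sub, mem_edge_sub, ← mem_inter_iff, hv.disjoint i j h1 h2 h3] at hp
    exact hp

theorem frontier_preimage_add (hfr : frontier P = ⋃ j, edge v j) (X : ℝ × ℝ) :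
    frontier ((fun p => X + p) ⁻¹' P) = ⋃ j, edge (fun i => v i - X) j := by
  rw [← Homeomorph.coe_addLeft, ← Homeomorph.preimage_frontier, hfr]
  ext p
  simp only [mem_preimage, mem_iUnion, mem_edge_sub, Homeomorph.coe_addLeft]

theorem Sees.notMem {X : ℝ × ℝ} (hv : IsSimpleCurve v) (hP : IsClosed P)
    (hfr : frontier P = ⋃ j, edge v j) (hX : X ∉ P) (hg : IsGeneric 1 fun i => v i - X)
    {i : ZMod n} (hi : Sees (fun i => v i - X) i) {t : ℝ} (h0 : 0 ≤ t) (h1 : t < 1) :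
    X + t • (v i - X) ∉ P :=
  hi.smul_notMem (hv.sub X) hg (hP.preimage (continuous_const_add X)) (frontier_preimage_add hfr X)
    (by simpa using hX) h0 h1

theorem Sees.segment_inter_interior {X : ℝ × ℝ} (hv : IsSimpleCurve v) (hP : IsClosed P)
    (hfr : frontier P = ⋃ j, edge v j) (hX : X ∉ P) (hg : IsGeneric 1 fun i => v i - X)
    {i : ZMod n} (hi : Sees (fun i => v i - X) i) : segment ℝ X (v i) ∩ interior P = ∅ := by
  rw [eq_empty_iff_forall_notMem]
  rintro p ⟨hp, hpP⟩
  obtain ⟨t, h0, h1, rfl⟩ := exists_of_mem_segment hp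
  rcases h1.eq_or_lt with rfl | h1
  · rw [one_smul, add_sub_cancel] at hpP
    have : v i ∈ frontier P := by
      rw [hfr]
      exact mem_iUnion.2 ⟨i, left_mem_edge i⟩
    exact this.2 hpP
  · exact hi.notMem hv hP hfr hX hg h0 h1 (interior_subset hpP)

theorem isReflex_sub {X : ℝ × ℝ} {i : ZMod n} :
    IsReflex (fun i => v i - X) ((fun p => X + p) ⁻¹' P) i ↔ IsReflex v P i := by
  simp only [IsReflex, sub_sub_sub_cancel_right, mem_preimage, ← add_assoc, add_sub_cancel]

/-- An exterior viewpoint that never sees two consecutive vertices sees three vertices that are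
neither reflex nor extreme, and a vertex between two of them is reflex. -/
theorem exists_three_sees {X : ℝ × ℝ} (hv : IsSimpleCurve v) (hP : IsCompact P)
    (hPint : P = closure (interior P)) (hfr : frontier P = ⋃ j, edge v j) (hX : X ∉ P)
    (hg : IsGeneric 1 fun i => v i - X)
    (hI : ∀ i, Sees (fun i => v i - X) i → ¬ Sees (fun i => v i - X) (i + 1)) :
    ∃ S : Finset (ZMod n), 3 ≤ S.card ∧
      (∀ i ∈ S, Sees (fun i => v i - X) i ∧ ¬ IsReflex v P i ∧
        v i ∉ (convexHull ℝ (range v)).extremePoints ℝ) ∧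
      ∀ i ∈ S, i + 2 ∈ S → IsReflex v P (i + 1) := by
  classical
  have : NeZero n := ⟨by have := hv.three_le; omega⟩
  have hw := hv.sub X
  have hPc := hP.isClosed
  obtain ⟨σ, hgσ, ⟨b, hb⟩, hnext⟩ := exists_isInnerTip hw hg hI
  set w : ZMod n → ℝ × ℝ := fun i => v i - X with hwdef
  have h0 : (0 : ℝ × ℝ) ∈ convexHull ℝ (range w) :=
    convexHull_mono (image_subset_range _ _) (zero_mem_convexHull_of_cross (σ := σ) (w := w)
      (S := {b | IsInnerTip σ w b}) ⟨b, hb⟩ hnext)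
  have hXc : X ∈ convexHull ℝ (range v) := by
    have := convexHull_min (s := range w) (by
      rintro _ ⟨i, rfl⟩
      have := subset_convexHull ℝ _ (mem_range_self (f := v) i)
      simpa [hwdef] using this) ((convex_convexHull ℝ (range v)).translate_preimage_right X) h0
    simpa using this
  refine ⟨Finset.univ.filter fun i => IsInnerTip σ w i, ?_, ?_, ?_⟩
  · obtain ⟨c, hc, hbc⟩ := hnext b hb
    obtain ⟨d, hd, hcd⟩ := hnext c hc
    have hne : ∀ {i j}, 0 < cross σ (w i) (w j) → i ≠ j := by
      rintro i j h rfl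
      rw [cross_self] at h
      exact lt_irrefl _ h
    refine Finset.two_lt_card.2 ⟨b, by simpa using hb, c, by simpa using hc, d, by simpa using hd,
      hne hbc, ?_, hne hcd⟩
    rintro rfl
    rw [cross_swap] at hcd
    linarith
  · intro i hi
    obtain ⟨ht, a, u, -, hT⟩ : IsInnerTip σ w i := by simpa using hi
    exact ⟨ht.1, ht.not_isReflex hv hw hgσ hPc hPint hfr
      fun j hj t h0 h1 => hj.notMem hv hPc hfr hX hg h0 h1,
      notMem_extremePoints_of_mem_openTri (convex_convexHull ℝ _) hXc
        (subset_convexHull ℝ _ (mem_range_self a)) (subset_convexHull ℝ _ (mem_range_self u)) hT⟩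
  · intro i hi hi'
    obtain ⟨ht, -⟩ : IsInnerTip σ w i := by simpa using hi
    obtain ⟨ht', -⟩ : IsInnerTip σ w (i + 2) := by simpa using hi'
    have e1 : i = i + 1 - 1 := by ring
    have e2 : i + 2 = i + 1 + 1 := by ring
    have h1 : 0 < cross σ (w i) (w (i + 1)) := ht.2.1
    have h2 : 0 < cross σ (w (i + 2)) (w (i + 1)) := by
      have := ht'.2.2
      rwa [show i + 2 - 1 = i + 1 by ring] at this
    have hPX := hPc.preimage (continuous_const_add X)
    have hfrX := frontier_preimage_add hfr X
    have hPX0 : (0 : ℝ × ℝ) ∉ (fun p => X + p) ⁻¹' P := by simpa using hX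
    rw [← isReflex_sub (X := X), IsReflex, ← e1, ← e2]
    have hne := hgσ i (i + 2) (fun h => two_ne_zero_zmod hv.three_le (by simpa using h.symm))
    rcases lt_or_gt_of_ne hne with h | h
    · rw [cross_swap, neg_lt_zero] at h
      obtain ⟨c1, c2⟩ := notMem_of_sees_sees hw hPX hfrX hPX0 h0 ht'.1 ht.1
        (Or.inr ⟨e2, e1⟩) h2 h1 h
      refine ⟨fun hc => c1 ?_, fun s r hs hr hsr => ?_⟩
      · rw [cross_swap, neg_eq_zero]
        simp only [cross, mul_eq_zero, one_ne_zero, false_or] at hc ⊢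
        exact Or.inr hc
      · rw [add_right_comm]
        exact c2 r s hr hs (by linarith)
    · obtain ⟨c1, c2⟩ := notMem_of_sees_sees hw hPX hfrX hPX0 h0 ht.1 ht'.1
        (Or.inl ⟨e1, e2⟩) h1 h2 h
      refine ⟨fun hc => c1 ?_, c2⟩
      simp only [cross, mul_eq_zero, one_ne_zero, false_or] at hc ⊢
      exact Or.inr hc

theorem dense_isGeneric [NeZero n] (hv : Function.Injective v) :
    Dense {X : ℝ × ℝ | IsGeneric 1 fun i => v i - X} := by
  have heq : {X : ℝ × ℝ | IsGeneric 1 fun i => v i - X} =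
      ⋂ ij : {ij : ZMod n × ZMod n // ij.1 ≠ ij.2},
        {X | cross 1 (v ij.1.1 - X) (v ij.1.2 - X) ≠ 0} := by
    ext X
    simp [IsGeneric]
  rw [heq]
  refine dense_iInter_of_isOpen (fun ij => ?_) fun ij => ?_
  · refine isOpen_ne_fun ?_ continuous_const
    unfold cross
    fun_prop
  · rw [dense_iff_inter_open]
    rintro O hO ⟨p, hp⟩
    by_cases h : cross 1 (v ij.1.1 - p) (v ij.1.2 - p) = 0
    · set e := v ij.1.2 - v ij.1.1 with he
      obtain ⟨ε, hε0, -, hε⟩ := exists_add_smul_sub_mem hO hp (p + (-e.2, e.1))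
      refine ⟨_, hε, ?_⟩
      rw [add_sub_cancel_left]
      have he0 : e ≠ 0 := sub_ne_zero.2 fun h => ij.2 (hv h).symm
      have hpos : 0 < e.1 ^ 2 + e.2 ^ 2 := by
        by_contra! hc
        refine he0 (Prod.ext ?_ ?_)
        · exact pow_eq_zero_iff two_ne_zero |>.1 (by nlinarith [sq_nonneg e.1, sq_nonneg e.2])
        · exact pow_eq_zero_iff two_ne_zero |>.1 (by nlinarith [sq_nonneg e.1, sq_nonneg e.2])
      have hc : cross 1 (v ij.1.1 - (p + ε • (-e.2, e.1))) (v ij.1.2 - (p + ε • (-e.2, e.1))) =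
          cross 1 (v ij.1.1 - p) (v ij.1.2 - p) + ε * (e.1 ^ 2 + e.2 ^ 2) := by
        simp only [cross, he, Prod.fst_sub, Prod.snd_sub, Prod.fst_add, Prod.snd_add,
          Prod.smul_fst, Prod.smul_snd, smul_eq_mul]
        ring
      change _ ≠ _
      rw [hc, h, zero_add]
      positivity
    · exact ⟨p, hp, h⟩

theorem isOpen_segment_inter_nonempty {O : Set (ℝ × ℝ)} (hO : IsOpen O) (g : ℝ × ℝ) :
    IsOpen {X | (segment ℝ X g ∩ O).Nonempty} := by
  have heq : {X | (segment ℝ X g ∩ O).Nonempty} =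
      ⋃ t ∈ Icc (0 : ℝ) 1, (fun X => X + t • (g - X)) ⁻¹' O := by
    ext X
    simp only [mem_ofPred_eq, mem_iUnion, mem_preimage]
    constructor
    · rintro ⟨p, hp, hpO⟩
      obtain ⟨t, h0, h1, rfl⟩ := exists_of_mem_segment hp
      exact ⟨t, ⟨h0, h1⟩, hpO⟩
    · rintro ⟨t, ⟨h0, h1⟩, h⟩
      exact ⟨_, add_smul_sub_mem_segment X g h0 h1, h⟩
  rw [heq]
  exact isOpen_biUnion fun t _ => hO.preimage (by fun_prop)

/-- If some exterior point is not observed, then some exterior point in general position is not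
observed. -/
theorem exists_isGeneric_not_observed [NeZero n] (hv : Function.Injective v) (hP : IsClosed P)
    {G : Set (ℝ × ℝ)} (hG : G.Finite) {X : ℝ × ℝ} (hX : X ∉ P)
    (h : ∀ g ∈ G, segment ℝ X g ∩ interior P ≠ ∅) :
    ∃ Y, Y ∉ P ∧ (IsGeneric 1 fun i => v i - Y) ∧ ∀ g ∈ G, segment ℝ Y g ∩ interior P ≠ ∅ := by
  have hO : IsOpen (Pᶜ ∩ ⋂ g ∈ G, {X | (segment ℝ X g ∩ interior P).Nonempty}) :=
    hP.isOpen_compl.inter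
      (hG.isOpen_biInter fun g _ => isOpen_segment_inter_nonempty isOpen_interior g)
  obtain ⟨Y, ⟨hYP, hYG⟩, hY⟩ := (dense_isGeneric hv).inter_open_nonempty _ hO
    ⟨X, hX, mem_iInter₂.2 fun g hg => nonempty_iff_ne_empty.2 (h g hg)⟩
  exact ⟨Y, hYP, hY, fun g hg => nonempty_iff_ne_empty.1 (mem_iInter₂.1 hYG g hg)⟩

theorem mem_everySecondGuards_or_mem_unguarded [NeZero n] (k i : ZMod n) :
    v i ∈ EverySecondGuards n v k ∨ i ∈ unguarded n k := by
  have hlt := ZMod.val_lt (i - k)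
  have hcast : (((i - k).val : ℕ) : ZMod n) = i - k := by simp
  rcases Nat.even_or_odd' (i - k).val with ⟨j, hj | hj⟩
  · left
    refine ⟨j, by omega, congrArg v ?_⟩
    rw [← hj, hcast, add_sub_cancel]
  · right
    refine Finset.mem_image.2 ⟨j, Finset.mem_range.2 (by omega), ?_⟩
    rw [hj] at hcast
    push_cast at hcast
    linear_combination hcast

theorem add_one_notMem_unguarded {k i : ZMod n} (h : i ∈ unguarded n k) :
    i + 1 ∉ unguarded n k := by
  intro h'
  obtain ⟨a, ha, rfl⟩ := Finset.mem_image.1 h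
  obtain ⟨b, hb, hab⟩ := Finset.mem_image.1 h'
  rw [Finset.mem_range] at ha hb
  have : ((2 * b : ℕ) : ZMod n) = ((2 * a + 1 : ℕ) : ZMod n) := by
    push_cast
    linear_combination hab
  rw [ZMod.natCast_eq_natCast_iff', Nat.mod_eq_of_lt (by omega), Nat.mod_eq_of_lt (by omega)] at this
  omega

theorem _root_.IsSimplePolygon.isSimpleCurve (h : IsSimplePolygon n v P) : IsSimpleCurve v where
  three_le := h.1
  injective := h.2.1
  adjacent := fun i => by
    have := h.2.2.1 i
    rwa [show i + 2 = i + 1 + 1 by ring] at this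
  disjoint := h.2.2.2.1

end

theorem exists_everySecondGuards_observe {n : ℕ} (hn : n < 12) {v : ZMod n → ℝ × ℝ}
    {P : Set (ℝ × ℝ)} (hpoly : IsSimplePolygon n v P) :
    ∃ k : ZMod n, ∀ X : ℝ × ℝ, X ∉ P →
      ∃ g ∈ EverySecondGuards n v k, segment ℝ X g ∩ interior P = ∅ := by
  classical
  have hv := hpoly.isSimpleCurve
  obtain ⟨h3, -, -, -, hP, hPint, hfr⟩ := hpoly
  have : NeZero n := ⟨by omega⟩
  by_contra! hbad
  have key : ∀ k, ∃ S : Finset (ZMod n), 3 ≤ S.card ∧ S ⊆ unguarded n k ∧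
      (∀ i ∈ S, ¬ IsReflex v P i ∧ v i ∉ (convexHull ℝ (range v)).extremePoints ℝ) ∧
      ∀ i ∈ S, i + 2 ∈ S → IsReflex v P (i + 1) := by
    intro k
    obtain ⟨X₀, hX₀, hbad⟩ := hbad k
    have hfin : (EverySecondGuards n v k).Finite := (finite_range v).subset (by
      rintro _ ⟨j, -, rfl⟩
      exact mem_range_self _)
    obtain ⟨X, hX, hg, hno⟩ := exists_isGeneric_not_observed hv.injective hP.isClosed hfin hX₀
      fun g hg => (hbad g hg).ne_empty
    have hsee : ∀ i, Sees (fun i => v i - X) i → i ∈ unguarded n k := fun i hi =>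
      (mem_everySecondGuards_or_mem_unguarded k i).resolve_left fun h =>
        hno _ h (hi.segment_inter_interior hv hP.isClosed hfr hX hg)
    obtain ⟨S, hS3, hS, hSR⟩ := exists_three_sees hv hP hPint hfr hX hg
      fun i hi hi' => add_one_notMem_unguarded (hsee i hi) (hsee _ hi')
    exact ⟨S, hS3, fun i hi => hsee i (hS i hi).1, fun i hi => (hS i hi).2, hSR⟩
  choose S hS3 hSC hS hSR using key
  have hH := three_le_ncard_extremePoints hv hP hPint hfr
  have hle := guard_count (U := Finset.univ.filter fun i => ∃ k, i ∈ S k)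
    (H := Finset.univ.filter fun i => v i ∈ (convexHull ℝ (range v)).extremePoints ℝ)
    (R := Finset.univ.filter fun i => IsReflex v P i) (S := S) hn ?_ ?_ ?_ ?_ hSC hS3 ?_
  · rw [← ncard_coe_finset, Finset.coe_filter] at hle
    simp only [Finset.mem_univ, true_and] at hle
    omega
  · rw [Finset.disjoint_filter]
    rintro i - ⟨k, hk⟩
    exact (hS k i hk).2
  · rw [Finset.disjoint_filter]
    rintro i - ⟨k, hk⟩
    exact (hS k i hk).1
  · rw [Finset.disjoint_filter]
    exact fun i _ hi => hi.notMem_extremePoints hv hP.isClosed hPint hfr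
      (subset_convexHull_of_frontier hP hfr)
  · exact fun k i hi => Finset.mem_filter.2 ⟨Finset.mem_univ _, k, hi⟩
  · exact fun k t ht ht' => Finset.mem_filter.2 ⟨Finset.mem_univ _, hSR k t ht ht'⟩

end Fortress
/-- For any simple polygon with fewer than 12 sides there is a choice of starting
vertex such that the every-second-vertex guard set observes every point outside
the fortress. -/
theorem fortress_lt_twelve_guardable
    {n : ℕ} (hn : n < 12) {v : ZMod n → ℝ × ℝ} {P : Set (ℝ × ℝ)}
    (hpoly : IsSimplePolygon n v P) :
    ∃ k : ZMod n, ∀ X : ℝ × ℝ, X ∉ P →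
      ∃ g ∈ EverySecondGuards n v k, segment ℝ X g ∩ interior P = ∅ := by
  exact Fortress.exists_everySecondGuards_observe hn hpoly
end

section
/- There exists a simple 12-gon with region P ⊆ ℝ² and vertex cycle v 0, …, v 11 such that for every starting index k, some point X outside P is not observed by any guard of the every-second-vertex guard set G_k = {v((k + 2j) mod 12) : 0 ≤ j < 6}. -/
open Set Filter Topology

/-- Twice the signed area of the triangle `a b c`. -/
def cross {R : Type*} [Ring R] (a b c : R × R) : R :=
  (b.1 - a.1) * (c.2 - a.2) - (b.2 - a.2) * (c.1 - a.1)

theorem cross_add_smul (a b c d : ℝ × ℝ) {s t : ℝ} (h : s + t = 1) :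
    cross a b (s • c + t • d) = s * cross a b c + t * cross a b d := by
  obtain rfl : s = 1 - t := by linarith
  simp only [cross, Prod.fst_add, Prod.snd_add, Prod.smul_fst, Prod.smul_snd, smul_eq_mul]
  ring

theorem segment_inter_eq_empty_of_cross {a b c d : ℝ × ℝ}
    (h : 0 < cross a b c * cross a b d) : segment ℝ a b ∩ segment ℝ c d = ∅ := by
  rw [eq_empty_iff_forall_notMem]
  rintro p ⟨⟨s, t, hs, ht, hst, rfl⟩, s', t', hs', ht', hst', hp⟩
  have h1 : cross a b (s • a + t • b) = 0 := by
    rw [cross_add_smul _ _ _ _ hst]; simp only [cross]; ring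
  rw [← hp, cross_add_smul _ _ _ _ hst'] at h1
  rcases mul_pos_iff.1 h with ⟨h2, h3⟩ | ⟨h2, h3⟩
  · rcases hs'.eq_or_lt with rfl | hs0
    · rw [zero_add] at hst'; subst hst'; linarith
    · nlinarith [mul_pos hs0 h2, mul_nonneg ht' h3.le]
  · rcases hs'.eq_or_lt with rfl | hs0
    · rw [zero_add] at hst'; subst hst'; linarith
    · nlinarith [mul_pos hs0 (neg_pos.2 h2), mul_nonneg ht' (neg_pos.2 h3).le]

theorem segment_inter_eq_singleton_of_cross {a b c : ℝ × ℝ} (h : cross a b c ≠ 0) :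
    segment ℝ a b ∩ segment ℝ b c = {b} := by
  ext p
  constructor
  · rintro ⟨⟨s, t, hs, ht, hst, rfl⟩, s', t', hs', ht', hst', hp⟩
    have h1 : cross a b (s • a + t • b) = 0 := by
      rw [cross_add_smul _ _ _ _ hst]; simp only [cross]; ring
    have h2 : cross a b b = 0 := by simp only [cross]; ring
    rw [← hp, cross_add_smul _ _ _ _ hst', h2, mul_zero, zero_add] at h1
    obtain rfl := (mul_eq_zero.1 h1).resolve_right h
    rw [add_zero] at hst'
    rw [← hp, hst']
    simp
  · rintro rfl
    exact ⟨right_mem_segment ℝ a p, left_mem_segment ℝ p c⟩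

/-- The vertices of the polygon, with integer coordinates. -/
def intVertex : ZMod 12 → ℤ × ℤ :=
  ![(9, 5), (-3, -6), (5, 3), (7, 4), (0, 1), (-3, 2), (2, 0), (1, -1),
    (-3, 1), (-2, 0), (-4, -9), (-4, 2)]

/-- The vertices of the polygon. -/
def vertex (i : ZMod 12) : ℝ × ℝ := ((intVertex i).1, (intVertex i).2)

theorem cross_vertex (i j k : ZMod 12) :
    cross (vertex i) (vertex j) (vertex k) =
      (cross (intVertex i) (intVertex j) (intVertex k) : ℤ) := by
  simp [cross, vertex]

theorem vertex_injective : Function.Injective vertex := by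
  have h : Function.Injective intVertex := by unfold Function.Injective; decide
  intro i j hij
  apply h
  simpa [vertex, Prod.ext_iff] using hij

theorem adjacent_edges_inter (i : ZMod 12) :
    segment ℝ (vertex i) (vertex (i + 1)) ∩ segment ℝ (vertex (i + 1)) (vertex (i + 2)) =
      {vertex (i + 1)} := by
  apply segment_inter_eq_singleton_of_cross
  rw [cross_vertex, Int.cast_ne_zero]
  revert i
  decide

theorem nonadjacent_edges_inter (i j : ZMod 12) (h1 : j ≠ i) (h2 : j ≠ i + 1) (h3 : i ≠ j + 1) :
    segment ℝ (vertex i) (vertex (i + 1)) ∩ segment ℝ (vertex j) (vertex (j + 1)) = ∅ := by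
  have key : ∀ i j : ZMod 12, j ≠ i → j ≠ i + 1 → i ≠ j + 1 →
      0 < cross (intVertex i) (intVertex (i + 1)) (intVertex j) *
          cross (intVertex i) (intVertex (i + 1)) (intVertex (j + 1)) ∨
      0 < cross (intVertex j) (intVertex (j + 1)) (intVertex i) *
          cross (intVertex j) (intVertex (j + 1)) (intVertex (i + 1)) := by
    decide
  rcases key i j h1 h2 h3 with h | h
  · apply segment_inter_eq_empty_of_cross
    rw [cross_vertex, cross_vertex]
    exact_mod_cast h
  · rw [inter_comm]
    apply segment_inter_eq_empty_of_cross
    rw [cross_vertex, cross_vertex]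
    exact_mod_cast h

/-- The affine function vanishing on the line of the `i`-th edge, positive on its inner side. -/
def side (i : ZMod 12) (p : ℝ × ℝ) : ℝ := cross (vertex (i + 1)) (vertex i) p

/-- A min-max combination of the edge functions that is positive inside the polygon, zero on it
and negative outside. -/
def height (p : ℝ × ℝ) : ℝ :=
  min (min (max
    (min (side 0 p) (max (min (side 1 p) (side 2 p)) (min (side 3 p) (side 4 p))))
    (min (side 5 p) (max (min (side 6 p) (side 7 p)) (min (side 8 p) (side 9 p)))))
    (side 10 p)) (side 11 p)

/-- The closed region bounded by the polygon. -/
def region : Set (ℝ × ℝ) := {p | 0 ≤ height p}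

theorem continuous_side (i : ZMod 12) : Continuous (side i) := by
  unfold side cross
  fun_prop

theorem continuous_height : Continuous height := by
  have := continuous_side
  unfold height
  fun_prop

theorem intVertex_values :
    intVertex 0 = (9, 5) ∧ intVertex 1 = (-3, -6) ∧ intVertex 2 = (5, 3) ∧
    intVertex 3 = (7, 4) ∧ intVertex 4 = (0, 1) ∧ intVertex 5 = (-3, 2) ∧ intVertex 6 = (2, 0) ∧
    intVertex 7 = (1, -1) ∧ intVertex 8 = (-3, 1) ∧ intVertex 9 = (-2, 0) ∧
    intVertex 10 = (-4, -9) ∧ intVertex 11 = (-4, 2) := by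
  decide

theorem intVertex_succ_values :
    intVertex (0 + 1) = (-3, -6) ∧ intVertex (1 + 1) = (5, 3) ∧ intVertex (2 + 1) = (7, 4) ∧
    intVertex (3 + 1) = (0, 1) ∧ intVertex (4 + 1) = (-3, 2) ∧ intVertex (5 + 1) = (2, 0) ∧
    intVertex (6 + 1) = (1, -1) ∧ intVertex (7 + 1) = (-3, 1) ∧ intVertex (8 + 1) = (-2, 0) ∧
    intVertex (9 + 1) = (-4, -9) ∧ intVertex (10 + 1) = (-4, 2) ∧ intVertex (11 + 1) = (9, 5) := by
  decide

theorem side_values (p : ℝ × ℝ) :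
    side 0 p = -11 * p.1 + 12 * p.2 + 39 ∧ side 1 p = 9 * p.1 - 8 * p.2 - 21 ∧
    side 2 p = p.1 - 2 * p.2 + 1 ∧ side 3 p = -3 * p.1 + 7 * p.2 - 7 ∧
    side 4 p = p.1 + 3 * p.2 - 3 ∧ side 5 p = -2 * p.1 - 5 * p.2 + 4 ∧
    side 6 p = -p.1 + p.2 + 2 ∧ side 7 p = 2 * p.1 + 4 * p.2 + 2 ∧ side 8 p = -p.1 - p.2 - 2 ∧
    side 9 p = -9 * p.1 + 2 * p.2 - 18 ∧ side 10 p = 11 * p.1 + 44 ∧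
    side 11 p = 3 * p.1 - 13 * p.2 + 38 := by
  simp only [side, cross, vertex, intVertex_values, intVertex_succ_values]
  push_cast
  refine ⟨?_, ?_, ?_, ?_, ?_, ?_, ?_, ?_, ?_, ?_, ?_, ?_⟩ <;> ring

theorem height_pos_iff (p : ℝ × ℝ) : 0 < height p ↔
    (((0 < side 0 p ∧ (0 < side 1 p ∧ 0 < side 2 p ∨ 0 < side 3 p ∧ 0 < side 4 p)) ∨
      (0 < side 5 p ∧ (0 < side 6 p ∧ 0 < side 7 p ∨ 0 < side 8 p ∧ 0 < side 9 p))) ∧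
      0 < side 10 p) ∧ 0 < side 11 p := by
  simp only [height, lt_min_iff, lt_max_iff]

theorem height_nonneg_iff (p : ℝ × ℝ) : 0 ≤ height p ↔
    (((0 ≤ side 0 p ∧ (0 ≤ side 1 p ∧ 0 ≤ side 2 p ∨ 0 ≤ side 3 p ∧ 0 ≤ side 4 p)) ∨
      (0 ≤ side 5 p ∧ (0 ≤ side 6 p ∧ 0 ≤ side 7 p ∨ 0 ≤ side 8 p ∧ 0 ≤ side 9 p))) ∧
      0 ≤ side 10 p) ∧ 0 ≤ side 11 p := by
  simp only [height, le_min_iff, le_max_iff]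

theorem height_nonpos_iff (p : ℝ × ℝ) : height p ≤ 0 ↔
    (((side 0 p ≤ 0 ∨ ((side 1 p ≤ 0 ∨ side 2 p ≤ 0) ∧ (side 3 p ≤ 0 ∨ side 4 p ≤ 0))) ∧
      (side 5 p ≤ 0 ∨ ((side 6 p ≤ 0 ∨ side 7 p ≤ 0) ∧ (side 8 p ≤ 0 ∨ side 9 p ≤ 0)))) ∨
      side 10 p ≤ 0) ∨ side 11 p ≤ 0 := by
  simp only [height, min_le_iff, max_le_iff]

theorem forall_zmod_twelve {q : ZMod 12 → Prop} (h : q 0 ∧ q 1 ∧ q 2 ∧ q 3 ∧ q 4 ∧ q 5 ∧ q 6 ∧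
    q 7 ∧ q 8 ∧ q 9 ∧ q 10 ∧ q 11) (i : ZMod 12) : q i := by
  obtain ⟨h0, h1, h2, h3, h4, h5, h6, h7, h8, h9, h10, h11⟩ := h
  fin_cases i <;> assumption

/-- The point of the plane with coordinates `s` along the `i`-th edge and `t` in the direction of
its inner normal. -/
def nearEdge (i : ZMod 12) (s t : ℝ) : ℝ × ℝ :=
  ((vertex (i + 1)).1 + s * ((vertex i).1 - (vertex (i + 1)).1)
      - t * ((vertex i).2 - (vertex (i + 1)).2),
   (vertex (i + 1)).2 + s * ((vertex i).2 - (vertex (i + 1)).2)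
      + t * ((vertex i).1 - (vertex (i + 1)).1))

theorem nearEdge_values (s t : ℝ) :
    nearEdge 0 s t = (-3 + 12 * s - 11 * t, -6 + 11 * s + 12 * t) ∧
    nearEdge 1 s t = (5 - 8 * s + 9 * t, 3 - 9 * s - 8 * t) ∧
    nearEdge 2 s t = (7 - 2 * s + t, 4 - s - 2 * t) ∧
    nearEdge 3 s t = (7 * s - 3 * t, 1 + 3 * s + 7 * t) ∧
    nearEdge 4 s t = (-3 + 3 * s + t, 2 - s + 3 * t) ∧
    nearEdge 5 s t = (2 - 5 * s - 2 * t, 2 * s - 5 * t) ∧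
    nearEdge 6 s t = (1 + s - t, -1 + s + t) ∧
    nearEdge 7 s t = (-3 + 4 * s + 2 * t, 1 - 2 * s + 4 * t) ∧
    nearEdge 8 s t = (-2 - s - t, s - t) ∧
    nearEdge 9 s t = (-4 + 2 * s - 9 * t, -9 + 9 * s + 2 * t) ∧
    nearEdge 10 s t = (-4 + 11 * t, 2 - 11 * s) ∧
    nearEdge 11 s t = (9 - 13 * s + 3 * t, 5 - 3 * s - 13 * t) := by
  simp only [nearEdge, vertex, intVertex_values, intVertex_succ_values, Prod.mk.injEq]
  push_cast
  refine ⟨?_, ?_, ?_, ?_, ?_, ?_, ?_, ?_, ?_, ?_, ?_, ?_⟩ <;> constructor <;> ring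

theorem height_nearEdge_pos (i : ZMod 12) : ∀ s t : ℝ, 0 < t → t < s / 500 →
    t < (1 - s) / 500 → 0 < height (nearEdge i s t) := by
  revert i
  apply forall_zmod_twelve
  refine ⟨?_, ?_, ?_, ?_, ?_, ?_, ?_, ?_, ?_, ?_, ?_, ?_⟩ <;>
  · intro s t h0 h1 h2
    rw [← not_le, height_nonpos_iff]
    simp only [nearEdge_values, side_values]
    rintro ((⟨h | ⟨h | h, h' | h'⟩, k | ⟨k | k, k' | k'⟩⟩ | h) | h) <;> linarith

theorem height_nearEdge_neg (i : ZMod 12) : ∀ s t : ℝ, t < 0 → -t < s / 500 →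
    -t < (1 - s) / 500 → height (nearEdge i s t) < 0 := by
  revert i
  apply forall_zmod_twelve
  refine ⟨?_, ?_, ?_, ?_, ?_, ?_, ?_, ?_, ?_, ?_, ?_, ?_⟩ <;>
  · intro s t h0 h1 h2
    rw [← not_le, height_nonneg_iff]
    simp only [nearEdge_values, side_values]
    rintro ⟨⟨⟨h, ⟨k, k'⟩ | ⟨k, k'⟩⟩ | ⟨h, ⟨k, k'⟩ | ⟨k, k'⟩⟩, l⟩, l'⟩ <;> linarith

theorem mem_edge_iff (i : ZMod 12) (p : ℝ × ℝ) :
    p ∈ segment ℝ (vertex i) (vertex (i + 1)) ↔ ∃ s, 0 ≤ s ∧ s ≤ 1 ∧ p = nearEdge i s 0 := by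
  constructor
  · rintro ⟨s, t, hs, ht, hst, rfl⟩
    refine ⟨s, hs, by linarith, ?_⟩
    obtain rfl : t = 1 - s := by linarith
    ext <;> simp [nearEdge] <;> ring
  · rintro ⟨s, hs, hs1, rfl⟩
    refine ⟨s, 1 - s, hs, by linarith, by ring, ?_⟩
    ext <;> simp [nearEdge] <;> ring

theorem tendsto_nearEdge (i : ZMod 12) (s c : ℝ) :
    Tendsto (fun e : ℝ => nearEdge i (s + e * (1 / 2 - s)) (e * c)) (𝓝[>] 0)
      (𝓝 (nearEdge i s 0)) := by
  have h : Continuous fun e : ℝ => nearEdge i (s + e * (1 / 2 - s)) (e * c) := by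
    unfold nearEdge
    fun_prop
  have h0 := h.tendsto 0
  simp only [zero_mul, add_zero] at h0
  exact h0.mono_left nhdsWithin_le_nhds

theorem edge_subset_closure_pos (i : ZMod 12) :
    segment ℝ (vertex i) (vertex (i + 1)) ⊆ closure {p | 0 < height p} := by
  intro p hp
  obtain ⟨s, hs, hs1, rfl⟩ := (mem_edge_iff i p).1 hp
  refine mem_closure_of_tendsto (tendsto_nearEdge i s (1 / 2000)) ?_
  filter_upwards [Ioo_mem_nhdsGT (zero_lt_one' ℝ)] with e he
  exact height_nearEdge_pos i _ _ (by linarith [he.1])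
    (by nlinarith [he.1, he.2]) (by nlinarith [he.1, he.2])

theorem edge_subset_closure_neg (i : ZMod 12) :
    segment ℝ (vertex i) (vertex (i + 1)) ⊆ closure {p | height p < 0} := by
  intro p hp
  obtain ⟨s, hs, hs1, rfl⟩ := (mem_edge_iff i p).1 hp
  refine mem_closure_of_tendsto (tendsto_nearEdge i s (-1 / 2000)) ?_
  filter_upwards [Ioo_mem_nhdsGT (zero_lt_one' ℝ)] with e he
  exact height_nearEdge_neg i _ _ (by linarith [he.1])
    (by nlinarith [he.1, he.2]) (by nlinarith [he.1, he.2])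

theorem mem_edges_of_eq_nearEdge {p : ℝ × ℝ} (i : ZMod 12) (s : ℝ) (h0 : 0 ≤ s) (h1 : s ≤ 1)
    (h2 : p.1 = (nearEdge i s 0).1) (h3 : p.2 = (nearEdge i s 0).2) :
    p ∈ ⋃ i : ZMod 12, segment ℝ (vertex i) (vertex (i + 1)) :=
  mem_iUnion.2 ⟨i, (mem_edge_iff i p).2 ⟨s, h0, h1, Prod.ext h2 h3⟩⟩

set_option maxHeartbeats 2000000 in
theorem mem_edges_of_height_eq_zero {p : ℝ × ℝ} (hp : height p = 0) :
    p ∈ ⋃ i : ZMod 12, segment ℝ (vertex i) (vertex (i + 1)) := by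
  have h1 := (height_nonneg_iff p).1 hp.ge
  have h2 := (height_nonpos_iff p).1 hp.le
  simp only [side_values] at h1 h2
  rcases h1 with ⟨⟨⟨h, ⟨k, k'⟩ | ⟨k, k'⟩⟩ | ⟨h, ⟨k, k'⟩ | ⟨k, k'⟩⟩, l⟩, l'⟩ <;>
  rcases h2 with (⟨m | ⟨m | m, m' | m'⟩, n | ⟨n | n, n' | n'⟩⟩ | m) | m <;>
  first |
      (refine mem_edges_of_eq_nearEdge 0 ((p.1 + 3) / 12) ?_ ?_ ?_ ?_ <;>
        (try simp only [nearEdge_values]) <;> linarith) |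
      (refine mem_edges_of_eq_nearEdge 1 ((5 - p.1) / 8) ?_ ?_ ?_ ?_ <;>
        (try simp only [nearEdge_values]) <;> linarith) |
      (refine mem_edges_of_eq_nearEdge 2 ((7 - p.1) / 2) ?_ ?_ ?_ ?_ <;>
        (try simp only [nearEdge_values]) <;> linarith) |
      (refine mem_edges_of_eq_nearEdge 3 (p.1 / 7) ?_ ?_ ?_ ?_ <;>
        (try simp only [nearEdge_values]) <;> linarith) |
      (refine mem_edges_of_eq_nearEdge 4 ((p.1 + 3) / 3) ?_ ?_ ?_ ?_ <;>
        (try simp only [nearEdge_values]) <;> linarith) |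
      (refine mem_edges_of_eq_nearEdge 5 ((2 - p.1) / 5) ?_ ?_ ?_ ?_ <;>
        (try simp only [nearEdge_values]) <;> linarith) |
      (refine mem_edges_of_eq_nearEdge 6 (p.1 - 1) ?_ ?_ ?_ ?_ <;>
        (try simp only [nearEdge_values]) <;> linarith) |
      (refine mem_edges_of_eq_nearEdge 7 ((p.1 + 3) / 4) ?_ ?_ ?_ ?_ <;>
        (try simp only [nearEdge_values]) <;> linarith) |
      (refine mem_edges_of_eq_nearEdge 8 (-2 - p.1) ?_ ?_ ?_ ?_ <;>
        (try simp only [nearEdge_values]) <;> linarith) |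
      (refine mem_edges_of_eq_nearEdge 9 ((p.1 + 4) / 2) ?_ ?_ ?_ ?_ <;>
        (try simp only [nearEdge_values]) <;> linarith) |
      (refine mem_edges_of_eq_nearEdge 10 ((2 - p.2) / 11) ?_ ?_ ?_ ?_ <;>
        (try simp only [nearEdge_values]) <;> linarith) |
      (refine mem_edges_of_eq_nearEdge 11 ((9 - p.1) / 13) ?_ ?_ ?_ ?_ <;>
        (try simp only [nearEdge_values]) <;> linarith)

theorem isClosed_region : IsClosed region := isClosed_le continuous_const continuous_height

theorem isCompact_region : IsCompact region := by
  refine (isCompact_Icc (a := ((-4, -9) : ℝ × ℝ)) (b := (9, 5))).of_isClosed_subset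
    isClosed_region ?_
  intro p hp
  have h1 := (height_nonneg_iff p).1 hp
  simp only [side_values] at h1
  rcases h1 with ⟨⟨⟨h, ⟨k, k'⟩ | ⟨k, k'⟩⟩ | ⟨h, ⟨k, k'⟩ | ⟨k, k'⟩⟩, l⟩, l'⟩ <;>
  refine ⟨⟨?_, ?_⟩, ?_, ?_⟩ <;> dsimp only <;> linarith

theorem pos_subset_interior_region : {p | 0 < height p} ⊆ interior region :=
  interior_maximal (fun p hp => le_of_lt (show 0 < height p from hp))
    (isOpen_lt continuous_const continuous_height)

theorem region_eq_closure_interior : region = closure (interior region) := by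
  apply Subset.antisymm
  · intro p hp
    rcases (show 0 ≤ height p from hp).eq_or_lt with h | h
    · obtain ⟨i, hi⟩ := mem_iUnion.1 (mem_edges_of_height_eq_zero h.symm)
      exact closure_mono pos_subset_interior_region (edge_subset_closure_pos i hi)
    · exact subset_closure (pos_subset_interior_region h)
  · exact closure_minimal interior_subset isClosed_region

theorem frontier_region :
    frontier region = ⋃ i : ZMod 12, segment ℝ (vertex i) (vertex (i + 1)) := by
  apply Subset.antisymm
  · rw [isClosed_region.frontier_eq]
    rintro p ⟨hp, hp'⟩
    refine mem_edges_of_height_eq_zero (le_antisymm ?_ hp)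
    exact not_lt.1 fun h => hp' (pos_subset_interior_region h)
  · refine iUnion_subset fun i p hp => ?_
    rw [frontier_eq_closure_inter_closure]
    exact ⟨closure_mono (fun q h => le_of_lt (show 0 < height q from h))
        (edge_subset_closure_pos i hp),
      closure_mono (fun q h => not_le.2 (show height q < 0 from h)) (edge_subset_closure_neg i hp)⟩

theorem isSimplePolygon_region : IsSimplePolygon 12 vertex region :=
  ⟨by norm_num, vertex_injective, adjacent_edges_inter, nonadjacent_edges_inter,
    isCompact_region, region_eq_closure_interior, frontier_region⟩

/-- An exterior point that sees none of the vertices whose index has the parity of `i`. -/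
def hiddenPoint (i : ZMod 12) : ℝ × ℝ :=
  if i.val % 2 = 0 then (-1, -2) else (2, 1)

theorem hiddenPoint_notMem (i : ZMod 12) : hiddenPoint i ∉ region := by
  unfold hiddenPoint
  split_ifs <;>
  · rw [region, mem_ofPred_eq, height_nonneg_iff]
    norm_num [side_values]

theorem segment_inter_interior_region {a b : ℝ × ℝ} (t : ℝ) (h0 : 0 ≤ t) (h1 : t ≤ 1)
    (h : 0 < height (a.1 + t * (b.1 - a.1), a.2 + t * (b.2 - a.2))) :
    (segment ℝ a b ∩ interior region).Nonempty := by
  refine ⟨_, ⟨1 - t, t, by linarith, h0, by ring, ?_⟩, pos_subset_interior_region h⟩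
  ext <;> simp <;> ring

theorem hiddenPoint_values :
    hiddenPoint 0 = (-1, -2) ∧ hiddenPoint 1 = (2, 1) ∧ hiddenPoint 2 = (-1, -2) ∧
    hiddenPoint 3 = (2, 1) ∧ hiddenPoint 4 = (-1, -2) ∧ hiddenPoint 5 = (2, 1) ∧
    hiddenPoint 6 = (-1, -2) ∧ hiddenPoint 7 = (2, 1) ∧ hiddenPoint 8 = (-1, -2) ∧
    hiddenPoint 9 = (2, 1) ∧ hiddenPoint 10 = (-1, -2) ∧ hiddenPoint 11 = (2, 1) := by
  refine ⟨?_, ?_, ?_, ?_, ?_, ?_, ?_, ?_, ?_, ?_, ?_, ?_⟩ <;>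
  first | exact if_pos rfl | exact if_neg (by decide)

theorem segment_hiddenPoint (i : ZMod 12) :
    (segment ℝ (hiddenPoint i) (vertex i) ∩ interior region).Nonempty := by
  revert i
  apply forall_zmod_twelve
  simp only [hiddenPoint_values]
  refine ⟨segment_inter_interior_region (1 / 2) ?_ ?_ ?_,
    segment_inter_interior_region (1 / 4) ?_ ?_ ?_,
    segment_inter_interior_region (1 / 3) ?_ ?_ ?_,
    segment_inter_interior_region (2 / 3) ?_ ?_ ?_,
    segment_inter_interior_region (2 / 3) ?_ ?_ ?_,
    segment_inter_interior_region (1 / 2) ?_ ?_ ?_,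
    segment_inter_interior_region (2 / 3) ?_ ?_ ?_,
    segment_inter_interior_region (1 / 2) ?_ ?_ ?_,
    segment_inter_interior_region (2 / 3) ?_ ?_ ?_,
    segment_inter_interior_region (1 / 2) ?_ ?_ ?_,
    segment_inter_interior_region (1 / 2) ?_ ?_ ?_,
    segment_inter_interior_region (1 / 2) ?_ ?_ ?_⟩ <;>
  norm_num [height_pos_iff, vertex, intVertex_values, side_values]

/-- There is a simple 12-gon such that for every starting index the
every-second-vertex guard placement fails: some exterior point is seen by no guard. -/
theorem exists_twelve_gon_guards_fail :
    ∃ (v : ZMod 12 → ℝ × ℝ) (P : Set (ℝ × ℝ)), IsSimplePolygon 12 v P ∧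
      ∀ k : ZMod 12, ∃ X : ℝ × ℝ, X ∉ P ∧
        ∀ g ∈ EverySecondGuards 12 v k, (segment ℝ X g ∩ interior P).Nonempty := by
  refine ⟨vertex, region, isSimplePolygon_region,
    fun k => ⟨hiddenPoint k, hiddenPoint_notMem k, ?_⟩⟩
  rintro g ⟨j, hj, rfl⟩
  have h : ∀ k : ZMod 12, ∀ j < 6,
      (k + ((2 * j : ℕ) : ZMod 12)).val % 2 = k.val % 2 := by decide
  have h' : hiddenPoint (k + ((2 * j : ℕ) : ZMod 12)) = hiddenPoint k := by
    simp only [hiddenPoint, h k j hj]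
  rw [← h']
  exact segment_hiddenPoint _
end
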